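/- Let f be a Steinhaus random multiplicative function and let ε > 0 be sufficiently small. Then almost surely, for all sufficiently large x (with the threshold depending on the sample point), |∑_{n ≤ x, P(n) > √x} f(n)| ≤ √x · (log log x)^{1/4 + ε}. -/

import Mathlib

open MeasureTheory ProbabilityTheory Filter Real

noncomputable section

/-- The largest prime factor of `n`, with `P 1 = 1` (and `P 0 = 1`). -/
def Pfac (n : ℕ) : ℕ := if n ≤ 1 then 1 else n.primeFactors.sup id

/-- A Steinhaus random multiplicative function: the values at primes are independent,
each uniformly distributed on the unit circle, and `f` is completely multiplicative. -/
structure IsSteinhausRMF {Ω : Type*} [MeasurableSpace Ω] (μ : Measure Ω)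
    (f : Ω → ℕ → ℂ) : Prop where
  meas : ∀ n : ℕ, Measurable fun ω => f ω n
  indep : iIndepFun (m := fun _ : Nat.Primes => (inferInstance : MeasurableSpace ℂ))
    (fun (p : Nat.Primes) (ω : Ω) => f ω (p : ℕ)) μ
  unif : ∀ p : ℕ, p.Prime →
    Measure.map (fun ω => f ω p) μ =
      Measure.map (fun θ : ℝ => Complex.exp (2 * π * θ * Complex.I))
        (volume.restrict (Set.Ioc (0 : ℝ) 1))
  map_one : ∀ ω : Ω, f ω 1 = 1
  map_mul : ∀ (ω : Ω) (m n : ℕ), 1 ≤ m → 1 ≤ n → f ω (m * n) = f ω m * f ω n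



/-- circle map -/
def eC (θ : ℝ) : ℂ := Complex.exp (2 * π * θ * Complex.I)

/-- uniform law on the circle -/
def uC : Measure ℂ := Measure.map (fun θ : ℝ => Complex.exp (2 * π * θ * Complex.I))
        (volume.restrict (Set.Ioc (0 : ℝ) 1))

lemma eC_meas : Measurable eC := by unfold eC; fun_prop

lemma eC_cont : Continuous eC := by unfold eC; fun_prop

lemma uC_eq : uC = Measure.map eC (volume.restrict (Set.Ioc (0 : ℝ) 1)) := rfl

instance uC_prob : IsProbabilityMeasure uC := by
  constructor
  rw [uC_eq, Measure.map_apply eC_meas MeasurableSet.univ]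
  simp

lemma norm_eC (θ : ℝ) : ‖eC θ‖ = 1 := by
  unfold eC
  have : (2 * π * θ * Complex.I : ℂ) = ((2 * π * θ : ℝ) : ℂ) * Complex.I := by push_cast; ring
  rw [this, Complex.norm_exp_ofReal_mul_I]

lemma uC_norm : ∀ᵐ z ∂uC, ‖z‖ = 1 := by
  rw [uC_eq, ae_map_iff eC_meas.aemeasurable (measurableSet_eq_fun (by fun_prop) (by fun_prop))]
  exact ae_of_all _ norm_eC

lemma eC_add (a b : ℝ) : eC (a + b) = eC a * eC b := by
  unfold eC; rw [← Complex.exp_add]; congr 1; push_cast; ring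

lemma eC_one : eC 1 = 1 := by
  unfold eC; push_cast; rw [mul_one]; exact Complex.exp_two_pi_mul_I

lemma eC_periodic : Function.Periodic eC 1 := fun x => by rw [eC_add, eC_one, mul_one]

lemma exists_eC (c : ℂ) (hc : ‖c‖ = 1) : ∃ a, c = eC a := by
  refine ⟨Complex.arg c / (2 * π), ?_⟩
  unfold eC
  have h := Complex.norm_mul_exp_arg_mul_I c
  rw [hc] at h
  have : (π : ℂ) ≠ 0 := by exact_mod_cast Real.pi_ne_zero
  conv_lhs => rw [← h]
  push_cast
  rw [one_mul]
  congr 1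
  field_simp

lemma uC_integral {E : Type*} [NormedAddCommGroup E] [NormedSpace ℝ E] (g : ℂ → E)
    (hg : AEStronglyMeasurable g uC) :
    ∫ z, g z ∂uC = ∫ θ in (0:ℝ)..1, g (eC θ) := by
  rw [uC_eq] at *
  rw [integral_map eC_meas.aemeasurable hg, intervalIntegral.integral_of_le zero_le_one]

lemma uC_rot (c : ℂ) (hc : ‖c‖ = 1) : Measure.map (fun z => c * z) uC = uC := by
  obtain ⟨a, rfl⟩ := exists_eC c hc
  have hm : Measurable (fun z : ℂ => eC a * z) := by fun_prop
  haveI : IsProbabilityMeasure (Measure.map (fun z : ℂ => eC a * z) uC) :=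
    Measure.isProbabilityMeasure_map hm.aemeasurable
  ext s hs
  rw [Measure.map_apply hm hs]
  have key : ∀ t : Set ℂ, MeasurableSet t →
      uC.real t = ∫ θ in (0:ℝ)..1, t.indicator (fun _ => (1:ℝ)) (eC θ) := by
    intro t ht
    rw [← uC_integral _ (by exact (measurable_const.indicator ht).aestronglyMeasurable)]
    rw [integral_indicator ht]; simp
  have h1 : uC.real ((fun z => eC a * z) ⁻¹' s) = uC.real s := by
    rw [key _ (hm hs), key _ hs]
    have e : ∀ θ : ℝ, ((fun z => eC a * z) ⁻¹' s).indicator (fun _ => (1:ℝ)) (eC θ)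
        = (fun θ => s.indicator (fun _ => (1:ℝ)) (eC θ)) (a + θ) := by
      intro θ
      simp only [Set.indicator]
      rw [eC_add]
      rfl
    simp_rw [e]
    rw [intervalIntegral.integral_comp_add_left (fun θ => s.indicator (fun _ => (1:ℝ)) (eC θ)) a]
    have hp : Function.Periodic (fun θ => s.indicator (fun _ => (1:ℝ)) (eC θ)) 1 := by
      intro x; simp only [eC_periodic x]
    have := hp.intervalIntegral_add_eq a 0
    simpa using this
  exact (ENNReal.toReal_eq_toReal_iff' (measure_ne_top _ _) (measure_ne_top _ _)).1 h1

/-- Steinhaus with norm one everywhere. -/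
structure SRMF {Ω : Type*} [MeasurableSpace Ω] (μ : Measure Ω)
    (f : Ω → ℕ → ℂ) : Prop extends IsSteinhausRMF μ f where
  norm_one : ∀ ω n, 1 ≤ n → ‖f ω n‖ = 1

section
variable {Ω : Type*} [mΩ : MeasurableSpace Ω] {μ : Measure Ω} [IsProbabilityMeasure μ]
  {f : Ω → ℕ → ℂ}

/-- sigma algebra generated by `f p` with `p ∈ S`. -/
@[reducible] def sig (f : Ω → ℕ → ℂ) (S : Set Nat.Primes) : MeasurableSpace Ω :=
  ⨆ p ∈ S, MeasurableSpace.comap (fun ω => f ω (p : ℕ)) inferInstance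

@[reducible] def Past (f : Ω → ℕ → ℂ) (N : ℕ) : MeasurableSpace Ω := sig f {p | (p : ℕ) < N}

lemma sig_mono (f : Ω → ℕ → ℂ) {S T : Set Nat.Primes} (h : S ⊆ T) : sig f S ≤ sig f T :=
  biSup_mono h

lemma Past_mono (f : Ω → ℕ → ℂ) {M N : ℕ} (h : M ≤ N) : Past f M ≤ Past f N :=
  sig_mono f (fun _ hp => lt_of_lt_of_le hp h)

lemma sig_le (hf : IsSteinhausRMF μ f) (S : Set Nat.Primes) : sig f S ≤ mΩ :=
  iSup₂_le fun p _ => (hf.meas p).comap_le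

lemma Past_le (hf : IsSteinhausRMF μ f) (N : ℕ) : Past f N ≤ mΩ := sig_le hf _

lemma sig_meas_prime (f : Ω → ℕ → ℂ) {S : Set Nat.Primes} (p : Nat.Primes) (hp : p ∈ S) :
    Measurable[sig f S] (fun ω => f ω (p : ℕ)) := by
  have : MeasurableSpace.comap (fun ω => f ω (p : ℕ)) inferInstance ≤ sig f S :=
    le_iSup₂ (f := fun (p : Nat.Primes) (_ : p ∈ S) =>
      MeasurableSpace.comap (fun ω => f ω (p : ℕ)) (inferInstance : MeasurableSpace ℂ)) p hp
  exact (comap_measurable _).mono this le_rfl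

lemma sig_meas (hf : IsSteinhausRMF μ f) {S : Set Nat.Primes} (n : ℕ) (hn : 1 ≤ n)
    (h : ∀ p : Nat.Primes, (p : ℕ) ∣ n → p ∈ S) :
    Measurable[sig f S] (fun ω => f ω n) := by
  induction n using Nat.recOnMul with
  | zero => omega
  | one => simp_rw [hf.map_one]; exact measurable_const
  | prime p hp => exact sig_meas_prime f ⟨p, hp⟩ (h ⟨p, hp⟩ dvd_rfl)
  | mul a b iha ihb =>
    have ha : 1 ≤ a := Nat.one_le_iff_ne_zero.2 (by rintro rfl; simp at hn)
    have hb : 1 ≤ b := Nat.one_le_iff_ne_zero.2 (by rintro rfl; simp at hn)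
    simp_rw [hf.map_mul _ a b ha hb]
    exact (iha ha fun p hp => h p (hp.mul_right b)).mul (ihb hb fun p hp => h p (hp.mul_left a))

lemma Past_meas (hf : IsSteinhausRMF μ f) {N : ℕ} (n : ℕ) (hn : 1 ≤ n)
    (h : ∀ p : ℕ, p.Prime → p ∣ n → p < N) :
    Measurable[Past f N] (fun ω => f ω n) :=
  sig_meas hf n hn fun p hp => h p p.2 hp

lemma Past_meas_lt (hf : IsSteinhausRMF μ f) {N : ℕ} (n : ℕ) (hn : 1 ≤ n) (h : n < N) :
    Measurable[Past f N] (fun ω => f ω n) :=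
  Past_meas hf n hn fun _ _ hp => lt_of_le_of_lt (Nat.le_of_dvd hn hp) h

/-- joint law of the past and a new prime -/
lemma map_sig_prime (hf : IsSteinhausRMF μ f) {S : Set Nat.Primes} (p : Nat.Primes) (hp : p ∉ S) :
    @Measure.map Ω (Ω × ℂ) mΩ (@Prod.instMeasurableSpace Ω ℂ (sig f S) _)
      (fun ω => (ω, f ω p)) μ = @Measure.prod Ω ℂ (sig f S) _ (μ.trim (sig_le hf S)) uC := by
  have h1 := indep_iSup_of_disjoint (fun i : Nat.Primes => (hf.meas i).comap_le) hf.indep.iIndep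
    (S := S) (T := {p}) (by simpa using hp)
  have h2 : @IndepFun Ω Ω ℂ mΩ (sig f S) _ id (fun ω => f ω p) μ := by
    unfold ProbabilityTheory.IndepFun Kernel.IndepFun
    unfold ProbabilityTheory.Indep at h1
    convert h1 using 1
    · simp [MeasurableSpace.comap_id, sig]
    · simp
  have hid : @Measurable Ω Ω mΩ (sig f S) id := measurable_id.mono le_rfl (sig_le hf S) 
  have h3 := (@indepFun_iff_map_prod_eq_prod_map_map Ω Ω ℂ mΩ μ id (fun ω => f ω p) (sig f S) _ inferInstance
    (@Measurable.aemeasurable Ω Ω mΩ (sig f S) id μ hid) (hf.meas p).aemeasurable).1 h2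
  have h4 : @Measure.map Ω Ω mΩ (sig f S) id μ = μ.trim (sig_le hf S) :=
    (trim_eq_map (sig_le hf S)).symm
  have h5 : Measure.map (fun ω => f ω p) μ = uC := hf.unif p p.2
  rw [h4, h5] at h3
  exact h3

lemma lintegral_step_sig (hf : IsSteinhausRMF μ f) {S : Set Nat.Primes} (p : Nat.Primes)
    (hp : p ∉ S) (Φ : Ω → ℂ → ENNReal)
    (hΦ : @Measurable (Ω × ℂ) _ (@Prod.instMeasurableSpace Ω ℂ (sig f S) _) _
      (Function.uncurry Φ)) :
    ∫⁻ ω, Φ ω (f ω p) ∂μ = ∫⁻ ω, ∫⁻ z, Φ ω z ∂uC ∂μ := by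
  have hm : @Measurable Ω (Ω × ℂ) mΩ (@Prod.instMeasurableSpace Ω ℂ (sig f S) _)
      (fun ω => (ω, f ω p)) :=
    @Measurable.prodMk Ω mΩ Ω ℂ (sig f S) _ _ _ (measurable_id.mono le_rfl (sig_le hf S)) (hf.meas p)
  have e1 := @lintegral_map Ω (Ω × ℂ) mΩ (@Prod.instMeasurableSpace Ω ℂ (sig f S) _) μ _ _ hΦ hm
  rw [map_sig_prime hf p hp] at e1
  have e2 := @lintegral_prod Ω ℂ (sig f S) _ (μ.trim (sig_le hf S)) uC _ _ hΦ.aemeasurable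
  rw [e2] at e1
  have e3 := @lintegral_trim Ω (sig f S) mΩ μ (sig_le hf S) (fun ω => ∫⁻ z, Φ ω z ∂uC)
    (@Measurable.lintegral_prod_right' Ω ℂ (sig f S) _ uC _ _ hΦ)
  simp only [Function.uncurry] at e1
  rw [e3] at e1
  exact e1.symm

lemma lintegral_step (hf : IsSteinhausRMF μ f) {N : ℕ} (hN : N.Prime) (Φ : Ω → ℂ → ENNReal)
    (hΦ : @Measurable (Ω × ℂ) _ (@Prod.instMeasurableSpace Ω ℂ (Past f N) _) _
      (Function.uncurry Φ)) :
    ∫⁻ ω, Φ ω (f ω N) ∂μ = ∫⁻ ω, ∫⁻ z, Φ ω z ∂uC ∂μ :=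
  lintegral_step_sig hf ⟨N, hN⟩ (fun h => lt_irrefl N h) Φ hΦ

end

section
variable {Ω : Type*} [mΩ : MeasurableSpace Ω] {μ : Measure Ω} [IsProbabilityMeasure μ]
  {f : Ω → ℕ → ℂ}

lemma indepFun_sig (hf : IsSteinhausRMF μ f) {S : Set Nat.Primes} (p : Nat.Primes) (hp : p ∉ S)
    {E : Type*} [MeasurableSpace E] {Z : Ω → E} (hZ : Measurable[sig f S] Z) :
    IndepFun Z (fun ω => f ω p) μ := by
  have h1 := indep_iSup_of_disjoint (fun i : Nat.Primes => (hf.meas i).comap_le) hf.indep.iIndep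
    (S := S) (T := {p}) (by simpa using hp)
  rw [IndepFun_iff_Indep]
  refine indep_of_indep_of_le_left (indep_of_indep_of_le_right h1 ?_) ?_
  · simp
  · exact hZ.comap_le

lemma exists_SRMF (hf : IsSteinhausRMF μ f) :
    ∃ g : Ω → ℕ → ℂ, SRMF μ g ∧ ∀ᵐ ω ∂μ, g ω = f ω := by
  classical
  let A : Set Ω := {ω | ∀ p : Nat.Primes, ‖f ω p‖ = 1}
  have hA : MeasurableSet A := by
    have : A = ⋂ p : Nat.Primes, {ω | ‖f ω p‖ = 1} := by ext; simp [A]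
    rw [this]
    exact MeasurableSet.iInter fun p =>
      measurableSet_eq_fun (hf.meas p).norm measurable_const
  have hA1 : ∀ᵐ ω ∂μ, ω ∈ A := by
    simp only [A, Set.mem_setOf_eq, ae_all_iff]
    intro p
    have h := hf.unif p p.2
    have h2 : ∀ᵐ z ∂(Measure.map (fun ω => f ω p) μ), ‖z‖ = 1 := by rw [h]; exact uC_norm
    exact ae_of_ae_map (hf.meas p).aemeasurable h2
  let g : Ω → ℕ → ℂ := fun ω n => if ω ∈ A then f ω n else 1
  have hg : ∀ᵐ ω ∂μ, g ω = f ω := by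
    filter_upwards [hA1] with ω hω
    funext n; simp [g, hω]
  refine ⟨g, ⟨⟨?_, ?_, ?_, ?_, ?_⟩, ?_⟩, hg⟩
  · intro n
    exact Measurable.ite hA (hf.meas n) measurable_const
  · refine hf.indep.congr fun p => ?_
    filter_upwards [hg] with ω hω
    rw [hω]
  · intro p hp
    rw [← hf.unif p hp]
    refine Measure.map_congr ?_
    filter_upwards [hg] with ω hω
    rw [hω]
  · intro ω; by_cases h : ω ∈ A <;> simp [g, h, hf.map_one]
  · intro ω m n hm hn
    by_cases h : ω ∈ A <;> simp [g, h, hf.map_mul ω m n hm hn]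
  · intro ω n hn
    by_cases h : ω ∈ A
    · simp only [g, h, if_true]
      induction n using Nat.recOnMul with
      | zero => omega
      | one => simp [hf.map_one]
      | prime p hp => exact h ⟨p, hp⟩
      | mul a b iha ihb =>
        have ha : 1 ≤ a := Nat.one_le_iff_ne_zero.2 (by rintro rfl; simp at hn)
        have hb : 1 ≤ b := Nat.one_le_iff_ne_zero.2 (by rintro rfl; simp at hn)
        rw [hf.map_mul _ a b ha hb, norm_mul, iha ha, ihb hb, mul_one]
    · simp [g, h]

/-- twist by `n^{-it}` -/
def tw (f : Ω → ℕ → ℂ) (t : ℝ) : Ω → ℕ → ℂ := fun ω n => f ω n * (n : ℂ) ^ (-(t * Complex.I))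

lemma norm_cpow_tw (t : ℝ) (n : ℕ) (hn : 1 ≤ n) : ‖(n : ℂ) ^ (-(t * Complex.I))‖ = 1 := by
  rw [Complex.norm_natCast_cpow_of_pos hn]; simp

lemma tw_SRMF (hf : SRMF μ f) (t : ℝ) : SRMF μ (tw f t) := by
  refine ⟨⟨?_, ?_, ?_, ?_, ?_⟩, ?_⟩
  · intro n; exact (hf.meas n).mul_const _
  · have := hf.indep.comp (fun (p : Nat.Primes) (z : ℂ) => z * ((p : ℕ) : ℂ) ^ (-(t * Complex.I)))
      (fun p => by fun_prop)
    exact this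
  · intro p hp
    have h1 : (fun ω => tw f t ω p) = (fun z => (p : ℂ) ^ (-(t * Complex.I)) * z) ∘ (fun ω => f ω p) := by
      funext ω; simp [tw, mul_comm]
    rw [h1, ← Measure.map_map (by fun_prop) (hf.meas p), hf.unif p hp]
    exact uC_rot _ (norm_cpow_tw t p hp.one_lt.le)
  · intro ω; simp [tw, hf.map_one]
  · intro ω m n hm hn
    simp only [tw]
    rw [hf.map_mul ω m n hm hn]
    push_cast
    rw [Complex.natCast_mul_natCast_cpow]
    ring
  · intro ω n hn
    simp only [tw]
    rw [norm_mul, hf.norm_one ω n hn, norm_cpow_tw t n hn, mul_one]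

lemma Past_tw (hf : SRMF μ f) (t : ℝ) (N : ℕ) : Past (tw f t) N ≤ Past f N := by
  refine iSup₂_le fun p hp => ?_
  have h : Measurable[Past f N] (fun ω => tw f t ω p) := by
    have := (sig_meas_prime f (S := {p : Nat.Primes | (p:ℕ) < N}) p hp).mul_const
      (((p : ℕ) : ℂ) ^ (-(t * Complex.I)))
    exact this
  exact h.comap_le

lemma f_pow (hf : IsSteinhausRMF μ f) (ω : Ω) (n : ℕ) (hn : 1 ≤ n) (k : ℕ) :
    f ω (n ^ k) = f ω n ^ k := by
  induction k with
  | zero => simp [hf.map_one]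
  | succ k ih => rw [pow_succ, hf.map_mul ω _ _ (Nat.one_le_pow _ _ hn) hn, ih, pow_succ]

lemma uC_pow_conj (a b : ℕ) (hab : a ≠ b) : ∫ z, z ^ a * (starRingEnd ℂ) z ^ b ∂uC = 0 := by
  -- rotation argument
  set I := ∫ z, z ^ a * (starRingEnd ℂ) z ^ b ∂uC with hI
  obtain ⟨s, hs⟩ : ∃ s : ℝ, eC s ^ a * (starRingEnd ℂ) (eC s) ^ b ≠ 1 := by
    refine ⟨1 / (2 * ((a:ℝ) - b)), ?_⟩
    have hab' : ((a:ℂ) - b) ≠ 0 := by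
      rw [sub_ne_zero]; exact_mod_cast hab
    have h1 : (starRingEnd ℂ) (eC (1 / (2 * ((a:ℝ) - b)))) = Complex.exp (-(2 * π * (1 / (2 * ((a:ℂ) - b))) * Complex.I)) := by
      unfold eC
      rw [← Complex.exp_conj]
      congr 1
      simp [Complex.conj_ofNat]
    rw [h1]
    unfold eC
    rw [← Complex.exp_nat_mul, ← Complex.exp_nat_mul, ← Complex.exp_add]
    have : (a * (2 * π * ((1 / (2 * ((a:ℝ) - b)) : ℝ) : ℂ) * Complex.I) + b * -(2 * π * (1 / (2 * ((a:ℂ) - b))) * Complex.I)) = π * Complex.I := by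
      push_cast; field_simp; ring
    rw [this, Complex.exp_pi_mul_I]
    norm_num
  have h2 : I = (eC s ^ a * (starRingEnd ℂ) (eC s) ^ b) * I := by
    conv_lhs => rw [hI, ← uC_rot (eC s) (norm_eC s)]
    rw [integral_map (by fun_prop) (by
      refine Continuous.aestronglyMeasurable ?_
      exact (continuous_pow a).mul ((Complex.continuous_conj).pow b))]
    rw [hI, ← integral_const_mul]
    congr 1
    funext z
    rw [map_mul, mul_pow, mul_pow]; ring
  have h3 : (1 - eC s ^ a * (starRingEnd ℂ) (eC s) ^ b) * I = 0 := by
    rw [sub_mul, one_mul, sub_eq_zero]; exact h2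
  rcases mul_eq_zero.1 h3 with h | h
  · exact absurd (sub_eq_zero.1 h).symm hs
  · exact h

lemma orthonormal_f (hf : SRMF μ f) (m n : ℕ) (hm : 1 ≤ m) (hn : 1 ≤ n) :
    ∫ ω, f ω m * (starRingEnd ℂ) (f ω n) ∂μ = if m = n then 1 else 0 := by
  split_ifs with h
  · subst h
    have : ∀ ω, f ω m * (starRingEnd ℂ) (f ω m) = 1 := fun ω => by
      rw [Complex.mul_conj, Complex.normSq_eq_norm_sq, hf.norm_one ω m hm]; simp
    simp [this]
  · obtain ⟨p, hp, hne⟩ : ∃ p, p.Prime ∧ m.factorization p ≠ n.factorization p := by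
      by_contra hcon
      push Not at hcon
      apply h
      refine Nat.eq_of_factorization_eq (by omega) (by omega) fun p => ?_
      by_cases hp : p.Prime
      · exact hcon p hp
      · simp [Nat.factorization_eq_zero_of_not_prime _ hp]
    have dec : ∀ k : ℕ, 1 ≤ k → ∃ k' : ℕ, 1 ≤ k' ∧ ¬ p ∣ k' ∧ k = p ^ (k.factorization p) * k' := by
      intro k hk
      refine ⟨k / p ^ k.factorization p, Nat.div_pos (Nat.ordProj_le p (by omega)) (by have := hp.pos; positivity), ?_, ?_⟩
      · exact Nat.not_dvd_ordCompl hp (by omega)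
      · exact (Nat.ordProj_mul_ordCompl_eq_self k p).symm
    obtain ⟨m', hm1, hm2, hm3⟩ := dec m hm
    obtain ⟨n', hn1, hn2, hn3⟩ := dec n hn
    set a := m.factorization p
    set b := n.factorization p
    have hfm : ∀ ω, f ω m = f ω p ^ a * f ω m' := fun ω => by
      rw [hm3, hf.map_mul ω _ _ (Nat.one_le_pow _ _ hp.pos) hm1, f_pow hf.1 ω p hp.one_lt.le]
    have hfn : ∀ ω, f ω n = f ω p ^ b * f ω n' := fun ω => by
      rw [hn3, hf.map_mul ω _ _ (Nat.one_le_pow _ _ hp.pos) hn1, f_pow hf.1 ω p hp.one_lt.le]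
    let P : Nat.Primes := ⟨p, hp⟩
    have hme : ∀ k, 1 ≤ k → ¬ p ∣ k → Measurable[sig f {P}ᶜ] (fun ω => f ω k) := by
      intro k hk hpk
      refine sig_meas hf.1 k hk fun q hq => ?_
      simp only [Set.mem_compl_iff, Set.mem_singleton_iff]
      rintro rfl
      exact hpk hq
    have hZ : Measurable[sig f {P}ᶜ] (fun ω => f ω m' * (starRingEnd ℂ) (f ω n')) :=
      (hme m' hm1 hm2).mul (Complex.continuous_conj.measurable.comp (hme n' hn1 hn2))
    have hind := indepFun_sig hf.1 P (S := {P}ᶜ) (by simp) hZ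
    have hg : Measurable (fun z : ℂ => z ^ a * (starRingEnd ℂ) z ^ b) :=
      ((continuous_pow a).mul ((Complex.continuous_conj).pow b)).measurable
    have hind2 := hind.comp measurable_id hg
    have e := hind2.integral_mul_eq_mul_integral
      ((hZ.mono (sig_le hf.1 _) le_rfl).aestronglyMeasurable)
      ((hg.comp (hf.meas p)).aestronglyMeasurable)
    have e2 : ∫ ω, ((fun z : ℂ => z ^ a * (starRingEnd ℂ) z ^ b) ∘ fun ω => f ω P) ω ∂μ = 0 := by
      have := integral_map (μ := μ) (hf.meas p).aemeasurable (f := fun z : ℂ => z ^ a * (starRingEnd ℂ) z ^ b) hg.aestronglyMeasurable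
      rw [hf.unif p hp] at this
      rw [show (∫ ω, ((fun z : ℂ => z ^ a * (starRingEnd ℂ) z ^ b) ∘ fun ω => f ω P) ω ∂μ) = ∫ ω, (f ω p) ^ a * (starRingEnd ℂ) (f ω p) ^ b ∂μ from rfl, ← this]
      exact uC_pow_conj a b hne
    rw [e2, mul_zero] at e
    rw [← e]
    congr 1
    funext ω
    rw [hfm, hfn, map_mul, map_pow]
    simp only [Pi.mul_apply, Function.comp_apply, id_eq]
    show _ = f ω m' * (starRingEnd ℂ) (f ω n') * (f ω p ^ a * (starRingEnd ℂ) (f ω p) ^ b)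
    ring
end


/-- `L_N` -/
def LN (N : ℕ) : ℝ := ∏ p ∈ N.primesBelow, (1 - (p : ℝ)⁻¹)⁻¹

lemma sum_log_prime_div (N : ℕ) (hN : 1 ≤ N) :
    ∑ p ∈ N.primesBelow, log p / p ≤ log N + 2 := by
  have h1 : ∑ n ∈ Finset.Icc 1 N, log (n : ℝ) ≤ N * log N := by
    calc _ ≤ ∑ n ∈ Finset.Icc 1 N, log (N : ℝ) := by
          refine Finset.sum_le_sum fun n hn => ?_
          rw [Finset.mem_Icc] at hn
          exact log_le_log (by exact_mod_cast hn.1) (by exact_mod_cast hn.2)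
      _ = _ := by simp
  have h2 : ∑ p ∈ N.primesBelow, ((N / p : ℕ) : ℝ) * log p ≤ ∑ n ∈ Finset.Icc 1 N, log (n : ℝ) := by
    have e1 : ∀ p ∈ N.primesBelow, ((N / p : ℕ) : ℝ) * log p
        = ∑ n ∈ Finset.Icc 1 N, if p ∣ n then log (p:ℝ) else 0 := by
      intro p hp
      rw [← Finset.sum_filter, Finset.sum_const, nsmul_eq_mul]
      congr 2
      have := Nat.Ioc_filter_dvd_card_eq_div N p
      rw [← this]; rfl
    rw [Finset.sum_congr rfl e1, Finset.sum_comm]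
    refine Finset.sum_le_sum fun n hn => ?_
    rw [Finset.mem_Icc] at hn
    rw [← Finset.sum_filter]
    have hsub : (N.primesBelow.filter (fun p => p ∣ n)) ⊆ n.primeFactors := by
      intro p hp
      rw [Finset.mem_filter, Nat.mem_primesBelow] at hp
      exact Nat.mem_primeFactors.2 ⟨hp.1.2, hp.2, by omega⟩
    calc _ ≤ ∑ p ∈ n.primeFactors, log (p : ℝ) := by
          refine Finset.sum_le_sum_of_subset_of_nonneg hsub fun p hp _ => ?_
          exact log_nonneg (by exact_mod_cast (Nat.prime_of_mem_primeFactors hp).one_lt.le)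
      _ = log ((∏ p ∈ n.primeFactors, p : ℕ) : ℝ) := by
          push_cast
          rw [log_prod]
          intro p hp
          exact_mod_cast (Nat.prime_of_mem_primeFactors hp).ne_zero
      _ ≤ log n := by
          refine log_le_log ?_ ?_
          · exact_mod_cast Finset.prod_pos fun p hp => (Nat.prime_of_mem_primeFactors hp).pos
          · exact_mod_cast Nat.le_of_dvd hn.1 (Nat.prod_primeFactors_dvd n)
  have h3 : ∑ p ∈ N.primesBelow, log (p:ℝ) ≤ 2 * N := by
    have := Chebyshev.theta_le_log4_mul_x (x := N) (by positivity)
    rw [Chebyshev.theta_eq_sum_primesLE_log] at this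
    have h4 : log 4 ≤ 2 := by
      have : (4:ℝ) = 2 ^ 2 := by norm_num
      rw [this, log_pow]
      have := log_two_lt_d9
      push_cast
      linarith
    calc _ ≤ ∑ p ∈ N.primesLE, log (p:ℝ) := by
          refine Finset.sum_le_sum_of_subset_of_nonneg ?_ fun p hp _ => ?_
          · intro p hp
            rw [Nat.mem_primesBelow] at hp
            rw [Nat.mem_primesLE]
            exact ⟨hp.1.le, hp.2⟩
          · rw [Nat.mem_primesLE] at hp
            exact log_nonneg (by exact_mod_cast hp.2.one_lt.le)
      _ ≤ _ := this
      _ ≤ _ := by gcongr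
  have hN0 : (0:ℝ) < N := by exact_mod_cast hN
  have h5 : N * ∑ p ∈ N.primesBelow, log p / p ≤ N * (log N + 2) := by
    rw [Finset.mul_sum]
    calc _ ≤ ∑ p ∈ N.primesBelow, (((N / p : ℕ) : ℝ) * log p + log p) := by
          refine Finset.sum_le_sum fun p hp => ?_
          rw [Nat.mem_primesBelow] at hp
          have hp0 : (0:ℝ) < p := by exact_mod_cast hp.2.pos
          have hl : 0 ≤ log (p:ℝ) := log_nonneg (by exact_mod_cast hp.2.one_lt.le)
          have : (N:ℝ) / p ≤ ((N / p : ℕ) : ℝ) + 1 := by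
            rw [← Nat.floor_div_eq_div (K := ℝ)]
            exact (Nat.lt_floor_add_one _).le
          calc (N:ℝ) * (log p / p) = (N / p) * log p := by ring
            _ ≤ (((N / p : ℕ) : ℝ) + 1) * log p := by gcongr
            _ = _ := by ring
      _ ≤ _ := by rw [Finset.sum_add_distrib]; linarith
  exact le_of_mul_le_mul_left h5 hN0

lemma prime_inv_le_half {p : ℕ} (hp : p.Prime) : (p:ℝ)⁻¹ ≤ 1/2 := by
  have : (2:ℝ) ≤ p := by exact_mod_cast hp.two_le
  rw [one_div]; exact inv_anti₀ (by norm_num) this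

lemma LN_pos (N : ℕ) : 0 < LN N := by
  refine Finset.prod_pos fun p hp => ?_
  have := prime_inv_le_half (Nat.prime_of_mem_primesBelow hp)
  exact inv_pos.2 (by linarith)

lemma LN_succ (N : ℕ) : LN (N+1) = if N.Prime then LN N * (1 - (N:ℝ)⁻¹)⁻¹ else LN N := by
  unfold LN
  rw [Nat.primesBelow_succ]
  split_ifs with h
  · rw [Finset.prod_insert (Nat.notMem_primesBelow N), mul_comm]
  · rfl

lemma LN_mono : Monotone LN := by
  refine monotone_nat_of_le_succ fun N => ?_
  rw [LN_succ]
  split_ifs with h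
  · have h1 := prime_inv_le_half h
    have h2 : (0:ℝ) < (N:ℝ)⁻¹ := inv_pos.2 (by exact_mod_cast h.pos)
    have : (1:ℝ) ≤ (1 - (N:ℝ)⁻¹)⁻¹ := one_le_inv_iff₀.2 ⟨by linarith, by linarith⟩
    nlinarith [LN_pos N]
  · rfl

lemma one_le_LN (N : ℕ) : 1 ≤ LN N := by
  have := LN_mono (Nat.zero_le N)
  simpa [LN] using this

/-- `n ↦ n^{-s}` -/
def powHom (s : ℝ) (hs : s ≠ 0): ℕ →*₀ ℝ where
  toFun n := (n:ℝ) ^ (-s)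
  map_zero' := by
    simp [hs]
  map_one' := by simp
  map_mul' m n := by push_cast; exact mul_rpow (by positivity) (by positivity)

lemma powHom_lt (s : ℝ) (hs : 0 < s) {p : ℕ} (hp : p.Prime) : ‖(powHom s hs.ne') p‖ < 1 := by
  show ‖(p:ℝ) ^ (-s)‖ < 1
  rw [Real.norm_of_nonneg (by positivity)]
  exact rpow_lt_one_of_one_lt_of_neg (by exact_mod_cast hp.one_lt) (by linarith)

lemma log_le_LN (N : ℕ) (hN : 1 ≤ N) : log N ≤ LN N := by
  have h := EulerProduct.summable_and_hasSum_smoothNumbers_prod_primesBelow_geometric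
    (f := (powHom 1 one_ne_zero : ℕ →* ℝ)) (fun {p} hp => powHom_lt 1 one_pos hp) N
  have h2 : HasSum (fun m : N.smoothNumbers => (m:ℝ) ^ (-1:ℝ)) (LN N) := by
    have := h.2
    unfold LN
    have e : ∀ p : ℕ, (1 - (p:ℝ)⁻¹)⁻¹ = (1 - ((powHom 1 one_ne_zero : ℕ →* ℝ)) p)⁻¹ := by
      intro p
      rw [← rpow_neg_one (p:ℝ)]; rfl
    rw [Finset.prod_congr rfl fun p _ => e p]
    exact this
  have h3 : ∑ n ∈ Finset.Icc 1 (N - 1), ((n:ℝ))⁻¹ ≤ LN N := by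
    rw [← h2.tsum_eq]
    rw [tsum_subtype (N.smoothNumbers) (fun m : ℕ => (m:ℝ)^(-1:ℝ))]
    have hs : Summable (Set.indicator (N.smoothNumbers) (fun m : ℕ => (m:ℝ)^(-1:ℝ))) :=
      summable_subtype_iff_indicator.1 h2.summable
    calc _ = ∑ n ∈ Finset.Icc 1 (N - 1), Set.indicator (N.smoothNumbers) (fun m : ℕ => (m:ℝ)^(-1:ℝ)) n := by
          refine Finset.sum_congr rfl fun n hn => ?_
          rw [Finset.mem_Icc] at hn
          rw [Set.indicator_of_mem (Nat.mem_smoothNumbers_of_lt hn.1 (by omega)), rpow_neg_one]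
      _ ≤ _ := hs.sum_le_tsum _ fun n _ => Set.indicator_nonneg (fun m _ => by positivity) n
  refine le_trans ?_ h3
  have := log_add_one_le_harmonic (N-1)
  have e : ((N - 1 : ℕ) : ℝ) + 1 = N := by rw [Nat.cast_sub hN]; simp
  rw [Nat.cast_add, Nat.cast_one, e, harmonic_eq_sum_Icc] at this
  simpa using this

lemma zeta_partial (δ : ℝ) (hδ : 0 < δ) (K : ℕ) :
    ∑ n ∈ Finset.Icc 1 (K+1), (n:ℝ) ^ (-(1+δ)) ≤ 1 + (1/δ) * (1 - ((K+1:ℕ):ℝ)^(-δ)) := by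
  induction K with
  | zero => simp
  | succ K ih =>
    rw [Finset.sum_Icc_succ_top (by omega)]
    have key : (((K+1+1:ℕ)):ℝ) ^ (-(1+δ)) ≤ (1/δ) * (((K+1:ℕ):ℝ)^(-δ) - ((K+1+1:ℕ):ℝ)^(-δ)) := by
      set n : ℝ := ((K+1+1:ℕ):ℝ) with hn
      have hn2 : 2 ≤ n := by rw [hn]; exact_mod_cast (by omega)
      have hk : ((K+1:ℕ):ℝ) = n * (1 - n⁻¹) := by
        rw [mul_sub, mul_inv_cancel₀ (by positivity), hn]; push_cast; ring
      have hinv : n⁻¹ ≤ 1/2 := by rw [one_div]; exact inv_anti₀ (by norm_num) hn2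
      have hpos : 0 < n⁻¹ := by positivity
      rw [hk, mul_rpow (by positivity) (by linarith)]
      have h1 : 1 + δ * n⁻¹ ≤ (1 - n⁻¹) ^ (-δ) := by
        rw [rpow_def_of_pos (by linarith)]
        have := log_le_sub_one_of_pos (show (0:ℝ) < 1 - n⁻¹ by linarith)
        calc 1 + δ * n⁻¹ ≤ exp (δ * n⁻¹) := by linarith [add_one_le_exp (δ * n⁻¹)]
          _ ≤ _ := by apply exp_le_exp.2; nlinarith
      have h2 : n ^ (-(1+δ)) = n⁻¹ * n ^ (-δ) := by
        rw [← rpow_neg_one, ← rpow_add (by positivity)]; ring_nf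
      rw [h2]
      have h3 : 0 < n ^ (-δ) := by positivity
      rw [one_div, le_inv_mul_iff₀ hδ]
      nlinarith
    linarith

lemma LN_le : ∃ C : ℝ, 0 < C ∧ ∀ N : ℕ, 2 ≤ N → LN N ≤ C * log N := by
  refine ⟨(1 / log 2 + 1) * exp (2 * (1 + 2 / log 2)), by have := log_pos (one_lt_two : (1:ℝ) < 2); positivity, fun N hN => ?_⟩
  have hl2 := log_pos (one_lt_two : (1:ℝ) < 2)
  have hNl : log 2 ≤ log N := log_le_log (by norm_num) (by exact_mod_cast hN)
  have hlN : 0 < log N := by linarith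
  set δ := 1 / log N with hδ
  have hδ0 : 0 < δ := by positivity
  have h := EulerProduct.summable_and_hasSum_smoothNumbers_prod_primesBelow_geometric
    (f := (powHom (1+δ) (by positivity) : ℕ →* ℝ)) (fun {p} hp => powHom_lt (1+δ) (by positivity) hp) N
  have h2 : ∏ p ∈ N.primesBelow, (1 - (p:ℝ)^(-(1+δ)))⁻¹ ≤ 1 + log N := by
    have h3 : HasSum (fun m : N.smoothNumbers => (m:ℝ) ^ (-(1+δ):ℝ)) (∏ p ∈ N.primesBelow, (1 - (p:ℝ)^(-(1+δ)))⁻¹) := h.2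
    rw [← h3.tsum_eq, tsum_subtype (N.smoothNumbers) (fun m : ℕ => (m:ℝ)^(-(1+δ):ℝ))]
    have hs : Summable (Set.indicator (N.smoothNumbers) (fun m : ℕ => (m:ℝ)^(-(1+δ):ℝ))) :=
      summable_subtype_iff_indicator.1 h3.summable
    refine hs.tsum_le_of_sum_le fun s => ?_
    obtain ⟨K, hK⟩ : ∃ K, s ⊆ Finset.range (K+2) := by
      obtain ⟨K, hK⟩ := s.exists_nat_subset_range
      exact ⟨K, hK.trans (Finset.range_mono (by omega))⟩
    calc _ ≤ ∑ n ∈ Finset.range (K+2), Set.indicator (N.smoothNumbers) (fun m : ℕ => (m:ℝ)^(-(1+δ):ℝ)) n :=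
          Finset.sum_le_sum_of_subset_of_nonneg hK fun n _ _ => Set.indicator_nonneg (fun m _ => by positivity) n
      _ ≤ ∑ n ∈ Finset.range (K+2), (n:ℝ)^(-(1+δ):ℝ) :=
          Finset.sum_le_sum fun n _ => Set.indicator_le_self' (fun _ _ => by positivity) n
      _ = ∑ n ∈ Finset.Icc 1 (K+1), (n:ℝ)^(-(1+δ):ℝ) := by
          rw [Finset.range_eq_Ico, Finset.sum_eq_sum_Ico_succ_bot (by omega)]
          rw [Nat.cast_zero, zero_rpow (by linarith), zero_add]; rfl
      _ ≤ _ := zeta_partial δ hδ0 K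
      _ ≤ 1 + (1/δ) * 1 := by
          gcongr
          have : (0:ℝ) ≤ ((K+1:ℕ):ℝ)^(-δ) := by positivity
          linarith
      _ = _ := by rw [hδ]; simp
  have h4 : LN N ≤ (∏ p ∈ N.primesBelow, (1 - (p:ℝ)^(-(1+δ)))⁻¹) * exp (2 * δ * ∑ p ∈ N.primesBelow, log p / p) := by
    rw [Finset.mul_sum, exp_sum, ← Finset.prod_mul_distrib]
    unfold LN
    refine Finset.prod_le_prod (fun p hp => ?_) fun p hp => ?_
    · have := prime_inv_le_half (Nat.prime_of_mem_primesBelow hp)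
      exact inv_nonneg.2 (by linarith)
    · have hpp := Nat.prime_of_mem_primesBelow hp
      have hi := prime_inv_le_half hpp
      have hp0 : (0:ℝ) < p := by exact_mod_cast hpp.pos
      have hip : (0:ℝ) < (p:ℝ)⁻¹ := by positivity
      have e1 : (p:ℝ)^(-(1+δ)) = (p:ℝ)⁻¹ * exp (-(δ * log p)) := by
        rw [show -(1+δ) = -1 + -δ by ring, rpow_add hp0, rpow_neg_one, rpow_def_of_pos hp0]
        ring_nf
      have hlp : 0 ≤ log (p:ℝ) := log_nonneg (by exact_mod_cast hpp.one_lt.le)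
      have e2 : exp (-(δ * log p)) ≤ 1 := exp_le_one_iff.2 (by have := mul_nonneg hδ0.le hlp; linarith)
      have e3 : 1 - δ * log p ≤ exp (-(δ * log p)) := by linarith [add_one_le_exp (-(δ * log p))]
      rw [e1]
      set E := exp (-(δ * log p)) with hE
      have e0 : 0 < E := exp_pos _
      have hd1 : 0 < 1 - (p:ℝ)⁻¹ := by linarith
      have hd2 : 0 < 1 - (p:ℝ)⁻¹ * E := by nlinarith
      rw [inv_mul_eq_div, inv_eq_one_div, div_le_div_iff₀ hd1 hd2]
      have e4 : 1 + 2 * δ * (log p / p) ≤ exp (2 * δ * (log p / p)) := by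
        linarith [add_one_le_exp (2 * δ * (log p / p))]
      have e5 : 0 ≤ δ * log p := mul_nonneg hδ0.le hlp
      have e6 : log p / p = (p:ℝ)⁻¹ * log p := by ring
      calc 1 * (1 - (p:ℝ)⁻¹ * E) ≤ 1 - (p:ℝ)⁻¹ * (1 - δ * log p) := by
            rw [one_mul]; gcongr
        _ ≤ (1 + 2 * δ * (log p / p)) * (1 - (p:ℝ)⁻¹) := by
            rw [e6]
            nlinarith [mul_nonneg hip.le e5]
        _ ≤ _ := by gcongr
  have h5 := sum_log_prime_div N (by omega)
  have h6 : 2 * δ * ∑ p ∈ N.primesBelow, log p / p ≤ 2 * (1 + 2 / log 2) := by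
    calc _ ≤ 2 * δ * (log N + 2) := by gcongr
      _ = 2 * (1 + 2 / log N) := by rw [hδ]; field_simp
      _ ≤ _ := by gcongr
  calc LN N ≤ _ := h4
    _ ≤ (1 + log N) * exp (2 * (1 + 2 / log 2)) := by gcongr
    _ ≤ ((1 / log 2 + 1) * log N) * exp (2 * (1 + 2 / log 2)) := by
        gcongr
        rw [add_mul, one_mul]
        gcongr
        rw [one_div, inv_mul_eq_div, le_div_iff₀ hl2]; linarith
    _ = _ := by ring

lemma log_LN_le (N : ℕ) : log (LN N) ≤ 2 * ∑ p ∈ N.primesBelow, (p:ℝ)⁻¹ := by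
  unfold LN
  rw [log_prod, Finset.mul_sum]
  · refine Finset.sum_le_sum fun p hp => ?_
    have hi := prime_inv_le_half (Nat.prime_of_mem_primesBelow hp)
    have hip : (0:ℝ) ≤ (p:ℝ)⁻¹ := by positivity
    have hd : 0 < 1 - (p:ℝ)⁻¹ := by linarith
    calc log ((1 - (p:ℝ)⁻¹)⁻¹) ≤ (1 - (p:ℝ)⁻¹)⁻¹ - 1 := log_le_sub_one_of_pos (by positivity)
      _ ≤ _ := by
        rw [sub_le_iff_le_add, inv_le_iff_one_le_mul₀ hd]
        nlinarith
  · intro p hp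
    have hi := prime_inv_le_half (Nat.prime_of_mem_primesBelow hp)
    have hd : 0 < 1 - (p:ℝ)⁻¹ := by linarith
    positivity

section sieve
open ArithmeticFunction

def GR (R : ℕ) : ℝ := ∑ m ∈ Finset.Icc 1 R, ((moebius m : ℤ) : ℝ) ^ 2 / m
def yR (R m : ℕ) : ℝ := ((moebius m : ℤ) : ℝ) / (m * GR R)
def lamR (R d : ℕ) : ℝ :=
  d * ∑ m ∈ Finset.Icc 1 R, if d ∣ m then ((moebius (m / d) : ℤ) : ℝ) * yR R m else 0

lemma GR_pos (R : ℕ) (hR : 1 ≤ R) : 0 < GR R := by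
  unfold GR
  refine Finset.sum_pos' (fun m _ => by positivity) ⟨1, by simp [hR], by simp⟩

lemma moebius_abs_sq (m : ℕ) : |((moebius m : ℤ) : ℝ)| = ((moebius m : ℤ) : ℝ) ^ 2 := by
  rcases moebius_eq_or m with h | h | h <;> simp [h]

lemma moebius_abs_le (m : ℕ) : |((moebius m : ℤ) : ℝ)| ≤ 1 := by
  rcases moebius_eq_or m with h | h | h <;> simp [h]

lemma lamR_one (R : ℕ) (hR : 1 ≤ R) : lamR R 1 = 1 := by
  unfold lamR yR
  simp only [Nat.cast_one, one_mul, one_dvd, if_true, Nat.div_one]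
  have : ∀ m ∈ Finset.Icc 1 R, ((moebius m : ℤ) : ℝ) * (((moebius m : ℤ) : ℝ) / (m * GR R))
      = (((moebius m : ℤ) : ℝ) ^ 2 / m) / GR R := by
    intro m _
    rw [← mul_div_assoc, ← sq, div_div]
  rw [Finset.sum_congr rfl this, ← Finset.sum_div]
  exact div_self (GR_pos R hR).ne'

lemma lamR_abs (R d : ℕ) (hR : 1 ≤ R) : |lamR R d| ≤ d := by
  have hG := GR_pos R hR
  unfold lamR
  rw [abs_mul, Nat.abs_cast]
  have h1 : ∑ m ∈ Finset.Icc 1 R, |yR R m| = 1 := by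
    have : ∀ m ∈ Finset.Icc 1 R, |yR R m| = (((moebius m : ℤ) : ℝ) ^ 2 / m) / GR R := by
      intro m _
      unfold yR
      rw [abs_div, moebius_abs_sq, abs_of_nonneg (by positivity), div_div]
    rw [Finset.sum_congr rfl this, ← Finset.sum_div]
    exact div_self hG.ne'
  calc _ ≤ (d:ℝ) * ∑ m ∈ Finset.Icc 1 R, |yR R m| := by
        gcongr
        refine (Finset.abs_sum_le_sum_abs _ _).trans (Finset.sum_le_sum fun m _ => ?_)
        split_ifs
        · rw [abs_mul]
          exact mul_le_of_le_one_left (abs_nonneg _) (moebius_abs_le _)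
        · simp
    _ = d := by rw [h1, mul_one]

lemma dual_moebius (k m : ℕ) (hk : 1 ≤ k) (hm : 1 ≤ m) :
    ∑ d ∈ m.divisors, (if k ∣ d then ((moebius (m / d) : ℤ) : ℝ) else 0) = if m = k then 1 else 0 := by
  rw [← Finset.sum_filter]
  by_cases hkm : k ∣ m
  · obtain ⟨c, rfl⟩ := hkm
    have hc : c ≠ 0 := by rintro rfl; simp at hm
    have e : ∑ d ∈ (k * c).divisors.filter (fun d => k ∣ d), ((moebius (k * c / d) : ℤ) : ℝ)
        = ∑ d ∈ c.divisors, ((moebius (c / d) : ℤ) : ℝ) := by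
      symm
      refine Finset.sum_bij (fun d _ => k * d) ?_ ?_ ?_ ?_
      · intro d hd
        rw [Finset.mem_filter, Nat.mem_divisors]
        exact ⟨⟨mul_dvd_mul_left k (Nat.dvd_of_mem_divisors hd), by omega⟩, dvd_mul_right _ _⟩
      · intro a _ b _ h
        exact Nat.eq_of_mul_eq_mul_left hk h
      · intro d hd
        rw [Finset.mem_filter, Nat.mem_divisors] at hd
        obtain ⟨⟨h1, _⟩, ⟨b, rfl⟩⟩ := hd
        exact ⟨b, Nat.mem_divisors.2 ⟨Nat.dvd_of_mul_dvd_mul_left hk h1, hc⟩, rfl⟩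
      · intro d _
        rw [Nat.mul_div_mul_left _ _ hk]
    rw [e, Nat.sum_div_divisors c (fun d => ((moebius d : ℤ) : ℝ))]
    have h2 : ∑ d ∈ c.divisors, (moebius d : ℤ) = if c = 1 then 1 else 0 := by
      rw [← coe_mul_zeta_apply, moebius_mul_coe_zeta, one_apply]
    have h3 : (∑ d ∈ c.divisors, ((moebius d : ℤ) : ℝ)) = if c = 1 then 1 else 0 := by
      rw [← Int.cast_sum, h2]; split_ifs <;> simp
    rw [h3]
    have : (c = 1) ↔ (k * c = k) := by
      constructor
      · rintro rfl; simp
      · intro h; exact Nat.eq_of_mul_eq_mul_left hk (by simpa using h)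
    simp only [this]
  · rw [if_neg (by rintro rfl; exact hkm dvd_rfl)]
    refine Finset.sum_eq_zero fun d hd => ?_
    rw [Finset.mem_filter] at hd
    exact absurd (hd.2.trans (Nat.dvd_of_mem_divisors hd.1)) hkm

lemma lamR_dual (R k : ℕ) (hk : k ∈ Finset.Icc 1 R) :
    ∑ d ∈ Finset.Icc 1 R, (if k ∣ d then lamR R d / d else 0) = yR R k := by
  have hk' := Finset.mem_Icc.1 hk
  have e1 : ∀ d ∈ Finset.Icc 1 R, (if k ∣ d then lamR R d / d else 0)
      = ∑ m ∈ Finset.Icc 1 R, if d ∣ m then (if k ∣ d then ((moebius (m / d) : ℤ) : ℝ) else 0) * yR R m else 0 := by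
    intro d hd
    have hd' := Finset.mem_Icc.1 hd
    have hd0 : (d:ℝ) ≠ 0 := by exact_mod_cast (by omega : d ≠ 0)
    unfold lamR
    rw [mul_div_cancel_left₀ _ hd0]
    split_ifs with h
    · rfl
    · simp
  rw [Finset.sum_congr rfl e1, Finset.sum_comm]
  have e2 : ∀ m ∈ Finset.Icc 1 R, (∑ d ∈ Finset.Icc 1 R, if d ∣ m then (if k ∣ d then ((moebius (m / d) : ℤ) : ℝ) else 0) * yR R m else 0)
      = (if m = k then 1 else 0) * yR R m := by
    intro m hm
    have hm' := Finset.mem_Icc.1 hm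
    rw [← dual_moebius k m hk'.1 hm'.1, Finset.sum_mul, ← Finset.sum_filter]
    refine Finset.sum_congr ?_ fun _ _ => rfl
    ext d
    rw [Finset.mem_filter, Nat.mem_divisors, Finset.mem_Icc]
    constructor
    · rintro ⟨_, h⟩; exact ⟨h, by omega⟩
    · rintro ⟨h, _⟩
      exact ⟨⟨Nat.pos_of_dvd_of_pos h hm'.1, (Nat.le_of_dvd hm'.1 h).trans hm'.2⟩, h⟩
  rw [Finset.sum_congr rfl e2]
  simp only [ite_mul, one_mul, zero_mul]
  rw [Finset.sum_ite_eq' , if_pos hk]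

lemma lamR_quad (R : ℕ) (hR : 1 ≤ R) :
    ∑ d ∈ Finset.Icc 1 R, ∑ e ∈ Finset.Icc 1 R, lamR R d * lamR R e / (Nat.lcm d e : ℝ) ≤ 1 / GR R := by
  have hG := GR_pos R hR
  have e1 : ∀ d ∈ Finset.Icc 1 R, ∀ e ∈ Finset.Icc 1 R, lamR R d * lamR R e / (Nat.lcm d e : ℝ)
      = ∑ k ∈ Finset.Icc 1 R, (Nat.totient k : ℝ) * ((if k ∣ d then lamR R d / d else 0) * (if k ∣ e then lamR R e / e else 0)) := by
    intro d hd e he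
    have hd' := Finset.mem_Icc.1 hd
    have he' := Finset.mem_Icc.1 he
    have hd0 : (d:ℝ) ≠ 0 := by exact_mod_cast (by omega : d ≠ 0)
    have he0 : (e:ℝ) ≠ 0 := by exact_mod_cast (by omega : e ≠ 0)
    have hg : (Nat.gcd d e : ℝ) * (Nat.lcm d e : ℝ) = d * e := by exact_mod_cast Nat.gcd_mul_lcm d e
    have hl0 : (Nat.lcm d e : ℝ) ≠ 0 := by exact_mod_cast (Nat.lcm_ne_zero (by omega) (by omega))
    have h1 : (Nat.gcd d e : ℝ) = ∑ k ∈ Finset.Icc 1 R, if (k ∣ d ∧ k ∣ e) then (Nat.totient k : ℝ) else 0 := by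
      conv_lhs => rw [← Nat.sum_totient (Nat.gcd d e)]
      push_cast
      rw [← Finset.sum_filter]
      refine Finset.sum_congr ?_ fun _ _ => rfl
      ext k
      rw [Finset.mem_filter, Nat.mem_divisors, Finset.mem_Icc, Nat.dvd_gcd_iff]
      constructor
      · rintro ⟨h, _⟩
        exact ⟨⟨Nat.pos_of_dvd_of_pos h.1 hd'.1, (Nat.le_of_dvd hd'.1 h.1).trans hd'.2⟩, h⟩
      · rintro ⟨_, h⟩; exact ⟨h, Nat.gcd_ne_zero_left (by omega)⟩
    have h2 : lamR R d * lamR R e / (Nat.lcm d e : ℝ) = (Nat.gcd d e : ℝ) * (lamR R d / d * (lamR R e / e)) := by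
      field_simp
      linear_combination (-(lamR R d * lamR R e)) * hg
    rw [h2, h1, Finset.sum_mul]
    refine Finset.sum_congr rfl fun k _ => ?_
    by_cases a : k ∣ d <;> by_cases b : k ∣ e <;> simp [a, b]
  calc _ = ∑ k ∈ Finset.Icc 1 R, (Nat.totient k : ℝ) * (yR R k) ^ 2 := by
        rw [Finset.sum_congr rfl fun d hd => Finset.sum_congr rfl (e1 d hd)]
        rw [Finset.sum_congr rfl fun d hd => Finset.sum_comm, Finset.sum_comm]
        refine Finset.sum_congr rfl fun k hk => ?_
        rw [← lamR_dual R k hk, sq, Finset.sum_mul_sum, Finset.mul_sum]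
        refine Finset.sum_congr rfl fun d _ => ?_
        rw [Finset.mul_sum]
    _ ≤ ∑ k ∈ Finset.Icc 1 R, (((moebius k : ℤ) : ℝ) ^ 2 / k) / (GR R) ^ 2 := by
        refine Finset.sum_le_sum fun k hk => ?_
        have hk' := Finset.mem_Icc.1 hk
        have hk0 : (0:ℝ) < k := by exact_mod_cast hk'.1
        have ht : (Nat.totient k : ℝ) ≤ k := by exact_mod_cast Nat.totient_le k
        unfold yR
        calc _ ≤ (k:ℝ) * (((moebius k : ℤ) : ℝ) / (k * GR R)) ^ 2 := by gcongr
          _ = _ := by field_simp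
    _ = _ := by
        rw [← Finset.sum_div]
        show GR R / GR R ^ 2 = _
        field_simp

lemma GR_ge (R : ℕ) : Real.log R ≤ 2 * GR R := by
  have h0 : Real.log R ≤ ∑ n ∈ Finset.Icc 1 R, (n:ℝ)⁻¹ := by
    rcases Nat.eq_zero_or_pos R with rfl | hR
    · simp
    have := log_add_one_le_harmonic R
    rw [harmonic_eq_sum_Icc] at this
    push_cast at this
    refine le_trans (Real.log_le_log (by exact_mod_cast hR) (by linarith)) this
  have h1 : ∑ k ∈ Finset.Icc 1 R, ((k:ℝ)^2)⁻¹ ≤ 2 := by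
    have : ∀ n : ℕ, 1 ≤ n → ∑ k ∈ Finset.Icc 1 n, ((k:ℝ)^2)⁻¹ ≤ 2 - 1 / n := by
      intro n hn
      induction n, hn using Nat.le_induction with
      | base => norm_num
      | succ n hn ih =>
        rw [Finset.sum_Icc_succ_top (by omega)]
        have hn0 : (0:ℝ) < n := by exact_mod_cast hn
        have : (((n+1:ℕ):ℝ)^2)⁻¹ ≤ 1 / n - 1 / ((n+1:ℕ):ℝ) := by
          push_cast
          rw [div_sub_div _ _ hn0.ne' (by positivity), inv_eq_one_div, div_le_div_iff₀ (by positivity) (by positivity)]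
          nlinarith
        linarith
    rcases Nat.eq_zero_or_pos R with rfl | hR
    · simp
    have h2 := this R hR
    have : (0:ℝ) ≤ 1 / (R:ℝ) := by positivity
    linarith
  have h2 : ∑ n ∈ Finset.Icc 1 R, (n:ℝ)⁻¹ ≤ (∑ k ∈ Finset.Icc 1 R, ((k:ℝ)^2)⁻¹) * GR R := by
    unfold GR
    rw [Finset.sum_mul_sum, ← Finset.sum_product']
    have key : ∀ n ∈ Finset.Icc 1 R, ∃ q ∈ Finset.Icc 1 R ×ˢ Finset.Icc 1 R, n = q.1 ^ 2 * q.2 ∧ Squarefree q.2 := by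
      intro n hn
      have hn' := Finset.mem_Icc.1 hn
      obtain ⟨a, b, h, hs⟩ := Nat.sq_mul_squarefree n
      have hb : b ≠ 0 := by rintro rfl; simp at h; omega
      have ha : a ≠ 0 := by rintro rfl; simp at h; omega
      refine ⟨(b, a), ?_, h.symm, hs⟩
      rw [Finset.mem_product, Finset.mem_Icc, Finset.mem_Icc]
      dsimp only
      have hb1 : b ≤ n := by rw [← h]; nlinarith [Nat.pos_of_ne_zero ha, Nat.pos_of_ne_zero hb]
      have ha1 : a ≤ n := by rw [← h]; exact Nat.le_mul_of_pos_left _ (by positivity)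
      omega
    choose! q hq1 hq2 hq3 using key
    have hinj : Set.InjOn q (Finset.Icc 1 R) := by
      intro a ha b hb hab
      rw [hq2 a ha, hq2 b hb, hab]
    calc _ = ∑ n ∈ Finset.Icc 1 R, (((q n).1:ℝ)^2)⁻¹ * ((((moebius (q n).2 : ℤ)):ℝ)^2 / (q n).2) := by
          refine Finset.sum_congr rfl fun n hn => ?_
          have : ((moebius (q n).2 : ℤ):ℝ)^2 = 1 := by
            exact_mod_cast moebius_sq_eq_one_of_squarefree (hq3 n hn)
          rw [this]
          conv_lhs => rw [hq2 n hn]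
          push_cast
          rw [mul_inv, one_div]
      _ = ∑ x ∈ (Finset.Icc 1 R).image q, ((x.1:ℝ)^2)⁻¹ * ((((moebius x.2 : ℤ)):ℝ)^2 / x.2) := by
          rw [Finset.sum_image hinj]
      _ ≤ _ := by
          refine Finset.sum_le_sum_of_subset_of_nonneg ?_ fun x _ _ => by positivity
          intro x hx
          obtain ⟨n, hn, rfl⟩ := Finset.mem_image.1 hx
          exact hq1 n hn
  have hG : 0 ≤ GR R := by unfold GR; positivity
  nlinarith

lemma count_dvd (a b D : ℕ) (hab : a ≤ b) (hD : 1 ≤ D) :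
    |(((Finset.Ioc a b).filter (fun n => D ∣ n)).card : ℝ) - ((b:ℝ) - a) / D| ≤ 1 := by
  have h1 : ((Finset.Ioc a b).filter (fun n => D ∣ n)).card + a / D = b / D := by
    rw [← Nat.Ioc_filter_dvd_card_eq_div a D, ← Nat.Ioc_filter_dvd_card_eq_div b D,
      ← Finset.card_union_of_disjoint, ← Finset.filter_union]
    · rw [Finset.union_comm, Finset.Ioc_union_Ioc_eq_Ioc (by omega) hab]
    · rw [Finset.disjoint_left]
      intro x hx hy
      simp only [Finset.mem_filter, Finset.mem_Ioc] at hx hy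
      omega
  have h2 : (((Finset.Ioc a b).filter (fun n => D ∣ n)).card : ℝ) = ((b / D : ℕ):ℝ) - ((a / D : ℕ):ℝ) := by
    rw [eq_sub_iff_add_eq]; exact_mod_cast h1
  rw [h2, ← Nat.floor_div_eq_div (K := ℝ), ← Nat.floor_div_eq_div (K := ℝ), sub_div]
  have a1 := Nat.floor_le (show (0:ℝ) ≤ (a:ℝ)/D by positivity)
  have a2 := Nat.lt_floor_add_one ((a:ℝ)/D)
  have b1 := Nat.floor_le (show (0:ℝ) ≤ (b:ℝ)/D by positivity)
  have b2 := Nat.lt_floor_add_one ((b:ℝ)/D)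
  rw [abs_le]; constructor <;> linarith

lemma sieve_bound (R a b : ℕ) (hR : 2 ≤ R) (hab : a ≤ b) :
    (((Finset.Ioc a b).filter Nat.Prime).card : ℝ) ≤ R + ((b:ℝ) - a) * (2 / Real.log R) + (R:ℝ)^4 := by
  have hR1 : 1 ≤ R := by omega
  have hlR : 0 < Real.log (R:ℝ) := log_pos (by exact_mod_cast hR)
  have hG := GR_pos R hR1
  set w : ℕ → ℝ := fun n => ∑ d ∈ Finset.Icc 1 R, if d ∣ n then lamR R d else 0 with hw
  have h1 : (((Finset.Ioc a b).filter Nat.Prime).card : ℝ) ≤ R + ∑ n ∈ Finset.Ioc a b, w n ^ 2 := by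
    have hsub : (Finset.Ioc a b).filter Nat.Prime ⊆ Finset.Icc 1 R ∪ (Finset.Ioc a b).filter (fun n => n.Prime ∧ R < n) := by
      intro n hn
      rw [Finset.mem_filter, Finset.mem_Ioc] at hn
      simp only [Finset.mem_union, Finset.mem_Icc, Finset.mem_filter, Finset.mem_Ioc]
      have := hn.2.pos
      by_cases h : n ≤ R
      · left; omega
      · right; exact ⟨hn.1, hn.2, by omega⟩
    have hc := (Finset.card_le_card hsub).trans (Finset.card_union_le _ _)
    have hc2 : ((((Finset.Ioc a b).filter (fun n => n.Prime ∧ R < n))).card : ℝ) ≤ ∑ n ∈ Finset.Ioc a b, w n ^ 2 := by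
      rw [Finset.card_eq_sum_ones, Nat.cast_sum]
      calc _ = ∑ n ∈ (Finset.Ioc a b).filter (fun n => n.Prime ∧ R < n), w n ^ 2 := by
            refine Finset.sum_congr rfl fun n hn => ?_
            rw [Finset.mem_filter] at hn
            have : w n = 1 := by
              simp only [hw]
              rw [Finset.sum_eq_single_of_mem 1 (by simp [hR1])]
              · simp [lamR_one R hR1]
              · intro d hd hd1
                rw [if_neg]
                intro hdn
                rw [Finset.mem_Icc] at hd
                rcases (Nat.dvd_prime hn.2.1).1 hdn with h | h
                · exact hd1 h
                · omega
            rw [this]; simp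
        _ ≤ _ := Finset.sum_le_sum_of_subset_of_nonneg (Finset.filter_subset _ _) fun _ _ _ => by positivity
    have hc' : (((Finset.Ioc a b).filter Nat.Prime).card : ℝ) ≤ ((Finset.Icc 1 R).card : ℝ) + (((Finset.Ioc a b).filter (fun n => n.Prime ∧ R < n)).card : ℝ) := by exact_mod_cast hc
    rw [Nat.card_Icc] at hc'
    simp only [Nat.add_sub_cancel] at hc'
    linarith
  have h2 : ∑ n ∈ Finset.Ioc a b, w n ^ 2 = ∑ d ∈ Finset.Icc 1 R, ∑ e ∈ Finset.Icc 1 R,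
      lamR R d * lamR R e * (((Finset.Ioc a b).filter (fun n => Nat.lcm d e ∣ n)).card : ℝ) := by
    have : ∀ n ∈ Finset.Ioc a b, w n ^ 2 = ∑ d ∈ Finset.Icc 1 R, ∑ e ∈ Finset.Icc 1 R, if Nat.lcm d e ∣ n then lamR R d * lamR R e else 0 := by
      intro n _
      simp only [hw, sq]
      rw [Finset.sum_mul_sum]
      refine Finset.sum_congr rfl fun d _ => Finset.sum_congr rfl fun e _ => ?_
      simp only [Nat.lcm_dvd_iff]
      by_cases x : d ∣ n <;> by_cases y : e ∣ n <;> simp [x, y]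
    rw [Finset.sum_congr rfl this, Finset.sum_comm]
    refine Finset.sum_congr rfl fun d _ => ?_
    rw [Finset.sum_comm]
    refine Finset.sum_congr rfl fun e _ => ?_
    rw [← Finset.sum_filter, Finset.sum_const, nsmul_eq_mul, mul_comm]
  have h3 : ∑ n ∈ Finset.Ioc a b, w n ^ 2 ≤ ((b:ℝ) - a) * (1 / GR R) + (R:ℝ)^4 := by
    rw [h2]
    have hba : (0:ℝ) ≤ (b:ℝ) - a := by rw [sub_nonneg]; exact_mod_cast hab
    calc _ ≤ ∑ d ∈ Finset.Icc 1 R, ∑ e ∈ Finset.Icc 1 R,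
          (((b:ℝ) - a) * (lamR R d * lamR R e / (Nat.lcm d e : ℝ)) + (R:ℝ) * R) := by
          refine Finset.sum_le_sum fun d hd => Finset.sum_le_sum fun e he => ?_
          have hd' := Finset.mem_Icc.1 hd
          have he' := Finset.mem_Icc.1 he
          have hl := count_dvd a b (Nat.lcm d e) hab (Nat.pos_of_ne_zero (Nat.lcm_ne_zero (by omega) (by omega)))
          set c := (((Finset.Ioc a b).filter (fun n => Nat.lcm d e ∣ n)).card : ℝ)
          have hA : |lamR R d * lamR R e| ≤ (R:ℝ) * R := by
            rw [abs_mul]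
            have x := lamR_abs R d hR1
            have y := lamR_abs R e hR1
            have x' : (d:ℝ) ≤ R := by exact_mod_cast hd'.2
            have y' : (e:ℝ) ≤ R := by exact_mod_cast he'.2
            exact mul_le_mul (x.trans x') (y.trans y') (abs_nonneg _) (by positivity)
          have hB : lamR R d * lamR R e * (c - ((b:ℝ) - a) / (Nat.lcm d e : ℝ)) ≤ (R:ℝ) * R := by
            refine (le_abs_self _).trans ?_
            rw [abs_mul]
            calc _ ≤ (R:ℝ) * R * 1 := mul_le_mul hA hl (abs_nonneg _) (by positivity)
              _ = _ := mul_one _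
          have e : lamR R d * lamR R e * c = lamR R d * lamR R e * (c - ((b:ℝ) - a) / (Nat.lcm d e : ℝ)) + ((b:ℝ) - a) * (lamR R d * lamR R e / (Nat.lcm d e : ℝ)) := by ring
          rw [e]; linarith
      _ = ((b:ℝ) - a) * (∑ d ∈ Finset.Icc 1 R, ∑ e ∈ Finset.Icc 1 R, lamR R d * lamR R e / (Nat.lcm d e : ℝ)) + (R:ℝ)^4 := by
          simp only [Finset.sum_add_distrib, ← Finset.mul_sum]
          simp
          ring
      _ ≤ _ := by
          have := lamR_quad R hR1
          gcongr
  have h4 : 1 / GR R ≤ 2 / Real.log R := by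
    rw [div_le_div_iff₀ hG hlR]
    have := GR_ge R
    linarith
  have hba : (0:ℝ) ≤ (b:ℝ) - a := by rw [sub_nonneg]; exact_mod_cast hab
  have h5 := mul_le_mul_of_nonneg_left h4 hba
  linarith

lemma BT (a b : ℕ) (hb : 2 ^ 20 ≤ b) (hab : a ≤ b) (h : √(b:ℝ) ≤ (b:ℝ) - a) :
    (((Finset.Ioc a b).filter Nat.Prime).card : ℝ) ≤ 60 * ((b:ℝ) - a) / Real.log b := by
  have hb' : (2:ℝ) ^ (20:ℕ) ≤ b := by exact_mod_cast hb
  have hb0 : (0:ℝ) < b := lt_of_lt_of_le (by positivity) hb'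
  set s : ℝ := (b:ℝ) ^ ((1:ℝ)/20) with hs
  have hs2 : 2 ≤ s := by
    have : ((2:ℝ)^(20:ℕ)) ^ ((1:ℝ)/20) ≤ s := rpow_le_rpow (by positivity) hb' (by norm_num)
    refine le_trans (le_of_eq ?_) this
    rw [← rpow_natCast, ← rpow_mul (by norm_num)]; norm_num
  have hspow : ∀ k : ℕ, s ^ k = (b:ℝ) ^ ((k:ℝ)/20) := by
    intro k
    rw [hs, ← rpow_natCast, ← rpow_mul hb0.le]; congr 1; ring
  have hs20 : s ^ 20 = b := by rw [hspow]; norm_num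
  set R := ⌊s^2⌋₊ with hR
  have hR1 : (R:ℝ) ≤ s^2 := Nat.floor_le (by positivity)
  have hR2 : s ≤ R := by
    have := Nat.lt_floor_add_one (s^2)
    have h2 : s + 1 ≤ s^2 := by nlinarith
    linarith
  have hR3 : 2 ≤ R := by
    have : (2:ℝ) ≤ R := hs2.trans hR2
    exact_mod_cast this
  have hlog : Real.log b = 20 * Real.log s := by rw [← hs20, Real.log_pow]; norm_num
  have hls : 0 < Real.log s := Real.log_pos (by linarith)
  have hlR : Real.log s ≤ Real.log R := Real.log_le_log (by linarith) hR2
  have hls2 : Real.log s ≤ s := (Real.log_le_sub_one_of_pos (by linarith)).trans (by linarith)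
  have hsq : √(b:ℝ) = s^10 := by
    rw [← hs20, show s^20 = (s^10)^2 by ring, Real.sqrt_sq (by positivity)]
  have hmain := sieve_bound R a b hR3 hab
  have hba : 0 ≤ (b:ℝ) - a := le_trans (by positivity) h
  have t1 : ((b:ℝ) - a) * (2 / Real.log R) ≤ ((b:ℝ) - a) * (2 / Real.log s) := by gcongr
  have t2 : (R:ℝ) + (R:ℝ)^4 ≤ 2 * s^8 := by
    have : (R:ℝ)^4 ≤ (s^2)^4 := by gcongr
    have h3 : s^2 ≤ s^8 := pow_le_pow_right₀ (by linarith) (by norm_num)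
    nlinarith
  have t3 : 2 * s^8 ≤ ((b:ℝ) - a) * (1 / Real.log s) := by
    rw [mul_one_div, le_div_iff₀ hls]
    calc 2 * s^8 * Real.log s ≤ 2 * s^8 * s := by gcongr
      _ ≤ s * s^8 * s := by gcongr
      _ = s^10 := by ring
      _ ≤ _ := by rw [← hsq]; exact h
  have e : 60 * ((b:ℝ) - a) / Real.log b = ((b:ℝ) - a) * (2 / Real.log s) + ((b:ℝ) - a) * (1 / Real.log s) := by
    rw [hlog]; field_simp; ring
  rw [e]; linarith
end sieve

section ballot

def psiM (s : ℝ) : ℝ := max (-s) 0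

def stayP (B : ℝ) (ν : ℕ → Measure ℝ) : ℕ → ℕ → ℝ → ℝ
  | 0, _, _ => 1
  | m+1, k, s => ∫ x, (if s + x ≤ B then stayP B ν m (k+1) (s+x) else 0) ∂(ν k)

def mmP (B : ℝ) (ν : ℕ → Measure ℝ) : ℕ → ℕ → ℝ → ℝ
  | 0, _, s => psiM s
  | m+1, k, s => ∫ x, (if s + x ≤ B then mmP B ν m (k+1) (s+x) else 0) ∂(ν k)

def bbP (ν : ℕ → Measure ℝ) : ℕ → ℕ → ℝ → ℝ
  | 0, _, s => psiM s
  | m+1, k, s => ∫ x, bbP ν m (k+1) (s+x) ∂(ν k)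

structure StepLaw (ν : ℕ → Measure ℝ) : Prop where
  prob : ∀ k, IsProbabilityMeasure (ν k)
  bd : ∀ k, ∀ᵐ x ∂(ν k), |x| ≤ 2 ∧ x ≤ 1
  mean : ∀ k, ∫ x, x ∂(ν k) = 0

/-- nice functions : nonneg, antitone, linear growth -/
structure Nice (g : ℝ → ℝ) : Prop where
  nonneg : ∀ s, 0 ≤ g s
  anti : Antitone g
  growth : ∃ C, ∀ s, g s ≤ C + |s|

lemma Nice.bdd {g : ℝ → ℝ} (hg : Nice g) {ν : Measure ℝ} [IsProbabilityMeasure ν]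
    (hb : ∀ᵐ x ∂ν, |x| ≤ 2 ∧ x ≤ 1) (s : ℝ) : Integrable (fun x => g (s + x)) ν := by
  obtain ⟨C, hC⟩ := hg.growth
  refine Integrable.of_bound (C := C + |s| + 2) ?_ ?_
  · exact (hg.anti.measurable.comp (measurable_const_add s)).aestronglyMeasurable
  · filter_upwards [hb] with x hx
    rw [Real.norm_of_nonneg (hg.nonneg _)]
    have := hC (s + x)
    have := abs_add_le s x
    linarith [hx.1]

lemma Nice.cut {g : ℝ → ℝ} (hg : Nice g) (B : ℝ) : Nice (fun s => if s ≤ B then g s else 0) := by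
  refine ⟨fun s => ?_, ?_, ?_⟩
  · split_ifs; exacts [hg.nonneg s, le_rfl]
  · intro s t hst
    dsimp only
    split_ifs with h1 h2 h2
    · exact hg.anti hst
    · linarith
    · exact hg.nonneg s
    · exact le_rfl
  · obtain ⟨C, hC⟩ := hg.growth
    refine ⟨C, fun s => ?_⟩
    have := hC s
    have := hg.nonneg s

    split_ifs <;> linarith

lemma Nice.int {g : ℝ → ℝ} (hg : Nice g) {ν : Measure ℝ} [IsProbabilityMeasure ν]
    (hb : ∀ᵐ x ∂ν, |x| ≤ 2 ∧ x ≤ 1) : Nice (fun s => ∫ x, g (s + x) ∂ν) := by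
  refine ⟨fun s => integral_nonneg fun x => hg.nonneg _, ?_, ?_⟩
  · intro s t hst
    exact integral_mono (hg.bdd hb t) (hg.bdd hb s) fun x => hg.anti (by linarith)
  · obtain ⟨C, hC⟩ := hg.growth
    refine ⟨C + 2, fun s => ?_⟩
    calc ∫ x, g (s + x) ∂ν ≤ ∫ x, (C + |s| + 2) ∂ν := by
          refine integral_mono_ae (hg.bdd hb s) (integrable_const _) ?_
          filter_upwards [hb] with x hx
          have := hC (s + x)
          have := abs_add_le s x
          linarith [hx.1]
      _ = _ := by simp; ring

lemma nice_psi : Nice psiM := by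
  refine ⟨fun s => le_max_right _ _, ?_, ⟨0, fun s => ?_⟩⟩
  · intro s t h; unfold psiM; exact max_le_max (by linarith) le_rfl
  · unfold psiM; rw [zero_add]; exact max_le (neg_le_abs s) (abs_nonneg s)

lemma nice_stay (B : ℝ) {ν : ℕ → Measure ℝ} (h : StepLaw ν) (m k : ℕ) : Nice (stayP B ν m k) := by
  induction m generalizing k with
  | zero => exact ⟨fun _ => zero_le_one, fun _ _ _ => le_rfl, ⟨1, fun s => by simp [stayP]⟩⟩
  | succ m ih =>
    have := h.prob k
    exact ((ih (k+1)).cut B).int (h.bd k)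

lemma nice_mm (B : ℝ) {ν : ℕ → Measure ℝ} (h : StepLaw ν) (m k : ℕ) : Nice (mmP B ν m k) := by
  induction m generalizing k with
  | zero => exact nice_psi
  | succ m ih =>
    have := h.prob k
    exact ((ih (k+1)).cut B).int (h.bd k)

lemma nice_bb {ν : ℕ → Measure ℝ} (h : StepLaw ν) (m k : ℕ) : Nice (bbP ν m k) := by
  induction m generalizing k with
  | zero => exact nice_psi
  | succ m ih =>
    have := h.prob k
    exact (ih (k+1)).int (h.bd k)

lemma stay_le_one (B : ℝ) {ν : ℕ → Measure ℝ} (h : StepLaw ν) (m k : ℕ) (s : ℝ) :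
    stayP B ν m k s ≤ 1 := by
  induction m generalizing k s with
  | zero => exact le_rfl
  | succ m ih =>
    have := h.prob k
    show ∫ x, _ ∂(ν k) ≤ 1
    calc _ ≤ ∫ x, (1:ℝ) ∂(ν k) := by
          refine integral_mono (((nice_stay B h m (k+1)).cut B).bdd (h.bd k) s) (integrable_const _) fun x => ?_
          dsimp only
          split_ifs
          · exact ih _ _
          · exact zero_le_one
      _ = 1 := by simp

lemma cheb_assoc {ν : Measure ℝ} [IsProbabilityMeasure ν] {g h : ℝ → ℝ} (hg : Antitone g) (hh : Antitone h)
    (ig : Integrable g ν) (ih : Integrable h ν) (igh : Integrable (fun x => g x * h x) ν) :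
    (∫ x, g x ∂ν) * (∫ x, h x ∂ν) ≤ ∫ x, g x * h x ∂ν := by
  set G := ∫ x, g x ∂ν
  set H := ∫ x, h x ∂ν
  set J := ∫ x, g x * h x ∂ν
  have inner : ∀ x, ∫ y, (g x - g y) * (h x - h y) ∂ν = g x * h x - g x * H - h x * G + J := by
    intro x
    have e : ∀ y, (g x - g y) * (h x - h y) = g x * h x - g x * h y - h x * g y + g y * h y := fun y => by ring
    simp_rw [e]
    rw [integral_add (by fun_prop) igh, integral_sub (by fun_prop) (by fun_prop), integral_sub (by fun_prop) (by fun_prop),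
      integral_const_mul, integral_const_mul]
    simp [G, H, J, integral_const_mul]
  have h1 : 0 ≤ ∫ x, (∫ y, (g x - g y) * (h x - h y) ∂ν) ∂ν := by
    refine integral_nonneg fun x => integral_nonneg fun y => ?_
    dsimp only
    rcases le_total x y with hxy | hxy
    · exact mul_nonneg (sub_nonneg.2 (hg hxy)) (sub_nonneg.2 (hh hxy))
    · exact mul_nonneg_of_nonpos_of_nonpos (sub_nonpos.2 (hg hxy)) (sub_nonpos.2 (hh hxy))
  simp_rw [inner] at h1
  rw [integral_add (by fun_prop) (by fun_prop), integral_sub (by fun_prop) (by fun_prop), integral_sub (by fun_prop) (by fun_prop),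
      integral_mul_const, integral_mul_const] at h1
  simp at h1
  change 0 ≤ J - G * H - H * G + J at h1
  linarith

lemma mm_ge (B : ℝ) {ν : ℕ → Measure ℝ} (h : StepLaw ν) (m k : ℕ) (s : ℝ) :
    bbP ν m k s * stayP B ν m k s ≤ mmP B ν m k s := by
  induction m generalizing k s with
  | zero => simp [bbP, stayP, mmP]
  | succ m ih =>
    have := h.prob k
    have n1 := nice_bb h m (k+1)
    have n2 := (nice_stay B h m (k+1)).cut B
    have n3 := (nice_mm B h m (k+1)).cut B
    have a1 : Antitone (fun x => bbP ν m (k+1) (s + x)) := fun x y hxy => n1.anti (by linarith)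
    have a2 : Antitone (fun x => if s + x ≤ B then stayP B ν m (k+1) (s+x) else 0) :=
      fun x y hxy => n2.anti (show s + x ≤ s + y by linarith)
    have i12 : Integrable (fun x => bbP ν m (k+1) (s + x) * (if s + x ≤ B then stayP B ν m (k+1) (s+x) else 0)) (ν k) := by
      refine (n1.bdd (h.bd k) s).mul_bdd (c := 1) ?_ ?_
      · exact (n2.bdd (h.bd k) s).aestronglyMeasurable
      · refine ae_of_all _ fun x => ?_
        rw [Real.norm_of_nonneg (n2.nonneg (s+x))]
        split_ifs
        · exact stay_le_one B h m (k+1) _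
        · exact zero_le_one
    refine (cheb_assoc a1 a2 (n1.bdd (h.bd k) s) (n2.bdd (h.bd k) s) i12).trans ?_
    refine integral_mono i12 (n3.bdd (h.bd k) s) fun x => ?_
    dsimp only
    split_ifs
    · exact ih _ _
    · simp

lemma mm_le (B : ℝ) (hB : 0 ≤ B) {ν : ℕ → Measure ℝ} (h : StepLaw ν) (m k : ℕ) (s : ℝ) (hs : s ≤ B) :
    mmP B ν m k s ≤ B + 1 - s := by
  induction m generalizing k s with
  | zero => 
    show max (-s) 0 ≤ _
    exact max_le (by linarith) (by linarith)
  | succ m ih =>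
    have := h.prob k
    have n3 := (nice_mm B h m (k+1)).cut B
    have ix : Integrable (fun x : ℝ => x) (ν k) := by
      refine Integrable.of_bound (C := 2) measurable_id.aestronglyMeasurable ?_
      filter_upwards [h.bd k] with x hx using hx.1
    calc mmP B ν (m+1) k s ≤ ∫ x, (B + 1 - s - x) ∂(ν k) := by
          refine integral_mono_ae (n3.bdd (h.bd k) s) ((integrable_const _).sub ix) ?_
          filter_upwards [h.bd k] with x hx

          split_ifs with h1
          · linarith [ih (k+1) (s+x) h1]
          · linarith [hx.2]
      _ = B + 1 - s := by
          rw [integral_sub (integrable_const _) ix, h.mean k]; simp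

lemma psi_lower (a : ℝ) (ha : 0 < a) (s : ℝ) : (s^2 / a - s^4 / a^3 - s) / 2 ≤ psiM s := by
  have h1 : (|s| - s)/2 ≤ psiM s := by
    unfold psiM
    rcases abs_cases s with h | h
    · rw [h.1]; simp
    · rw [h.1]; refine le_trans ?_ (le_max_left _ _); linarith
  have h2 : s^2 / a - s^4 / a^3 ≤ |s| := by
    have e1 : s^2 = |s|^2 := (sq_abs s).symm
    have e2 : s^4 = |s|^4 := by rw [show s^4 = (s^2)^2 by ring, e1]; ring
    rw [e1, e2]
    set u := |s|
    have hu : 0 ≤ u := abs_nonneg s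
    rw [div_sub_div _ _ ha.ne' (by positivity), div_le_iff₀ (by positivity)]
    rcases le_total u a with h | h
    · have : u ^ 2 * a ^ 3 ≤ u * a ^ 4 := by
        have : u ^ 2 * a ^ 3 = u * a ^ 3 * u := by ring
        have h3 : u * a ^ 4 = u * a ^ 3 * a := by ring
        rw [this, h3]; gcongr
      nlinarith [mul_nonneg ha.le (pow_nonneg hu 4)]
    · have : u ^ 2 * a ^ 3 ≤ a * u ^ 4 := by
        have e1 : u ^ 2 * a ^ 3 = u^2 * a * a^2 := by ring
        have e2 : a * u ^ 4 = u^2 * a * u^2 := by ring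
        rw [e1, e2]; gcongr
      nlinarith [mul_nonneg hu (pow_nonneg ha.le 4)]
  linarith

def vv (ν : ℕ → Measure ℝ) (k : ℕ) : ℝ := ∫ x, x^2 ∂(ν k)

lemma bb_ge {ν : ℕ → Measure ℝ} (h : StepLaw ν) (a : ℝ) (ha : 0 < a) (m k : ℕ) (s : ℝ) :
    ((s^2 + ∑ j ∈ Finset.range m, vv ν (k+j)) / a
      - (s^4 + 8 * s^2 * (∑ j ∈ Finset.range m, vv ν (k+j)) + 4 * (∑ j ∈ Finset.range m, vv ν (k+j))^2
        + 12 * (∑ j ∈ Finset.range m, vv ν (k+j))) / a^3 - s) / 2 ≤ bbP ν m k s := by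
  induction m generalizing k s with
  | zero => simpa [bbP] using psi_lower a ha s
  | succ m ih =>
    have := h.prob k
    have e : ∑ j ∈ Finset.range (m+1), vv ν (k+j) = (∑ j ∈ Finset.range m, vv ν (k+1+j)) + vv ν k := by
      rw [Finset.sum_range_succ']; simp only [add_zero]; congr 1
      exact Finset.sum_congr rfl fun j _ => by congr 1; ring
    rw [e]
    set S := ∑ j ∈ Finset.range m, vv ν (k+1+j)
    set v := vv ν k
    have hS : 0 ≤ S := Finset.sum_nonneg fun j _ => integral_nonneg fun x => sq_nonneg x
    have hv : 0 ≤ v := integral_nonneg fun x => sq_nonneg x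
    have ip : ∀ n : ℕ, Integrable (fun x : ℝ => x^n) (ν k) := by
      intro n
      refine Integrable.of_bound (C := 2^n) (measurable_id.pow_const n).aestronglyMeasurable ?_
      filter_upwards [h.bd k] with x hx
      rw [norm_pow]; exact pow_le_pow_left₀ (norm_nonneg _) hx.1 n
    have i1 : Integrable (fun x : ℝ => x) (ν k) := by simpa using ip 1
    have i2 := ip 2
    have lb : ∀ᵐ x ∂(ν k), (((s^2 + S)/a - (s^4 + 8 * s^2 * S + 4 * S^2 + 12 * S)/a^3 - s)/2
        + (s / a - (2 * s^3 + 8 * s * S)/a^3 - 1/2) * x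
        + (1/(2*a) - (4 * s^2 + 4 * S + 6) / a^3) * x^2) ≤ bbP ν m (k+1) (s+x) := by
      filter_upwards [h.bd k] with x hx
      refine le_trans ?_ (ih (k+1) (s+x))
      have hx2 : x^2 ≤ 4 := by have := sq_le_sq' (by linarith [(abs_le.1 hx.1).1]) (abs_le.1 hx.1).2; linarith
      have key : (s+x)^4 ≤ s^4 + 4*s^3*x + 8*s^2*x^2 + 12 * x^2 := by
        nlinarith [sq_nonneg (s*x - x^2), mul_le_mul_of_nonneg_left hx2 (sq_nonneg x)]
      have k3 : (s+x)^4 / a^3 ≤ (s^4 + 4*s^3*x + 8*s^2*x^2 + 12 * x^2)/a^3 := by gcongr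
      have e2 : (((s+x)^2 + S) / a - ((s+x)^4 + 8 * (s+x)^2 * S + 4 * S^2 + 12 * S)/a^3 - (s+x))/2
        - (((s^2 + S)/a - (s^4 + 8 * s^2 * S + 4 * S^2 + 12 * S)/a^3 - s)/2
        + (s / a - (2 * s^3 + 8 * s * S)/a^3 - 1/2) * x
        + (1/(2*a) - (4 * s^2 + 4 * S + 6) / a^3) * x^2) = ((s^4 + 4*s^3*x + 8*s^2*x^2 + 12 * x^2)/a^3 - (s+x)^4/a^3)/2 := by
        field_simp; ring
      linarith
    have h1 := integral_mono_ae (((integrable_const _).add (i1.const_mul _)).add (i2.const_mul _)) ((nice_bb h m (k+1)).bdd (h.bd k) s) lb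
    refine le_trans ?_ h1
    rw [integral_add' ((integrable_const _).add (i1.const_mul _)) (i2.const_mul _), integral_add' (integrable_const _) (i1.const_mul _), integral_const_mul, integral_const_mul,
      h.mean k]
    change _ ≤ _ + _ * v
    simp only [integral_const, probReal_univ, one_smul, mul_zero, add_zero]
    have e3 : ((s^2 + S)/a - (s^4 + 8 * s^2 * S + 4 * S^2 + 12 * S)/a^3 - s)/2 + (1/(2*a) - (4 * s^2 + 4 * S + 6) / a^3) * v
       - ((s^2 + (S + v)) / a - (s^4 + 8 * s^2 * (S + v) + 4 * (S + v)^2 + 12 * (S + v))/a^3 - s)/2 = 2 * v^2 / a^3 := by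
      field_simp; ring
    have : 0 ≤ 2 * v^2 / a^3 := by positivity
    linarith

lemma ballot (B : ℝ) (hB : 0 ≤ B) {ν : ℕ → Measure ℝ} (h : StepLaw ν) (m k : ℕ)
    (hS : 1 ≤ ∑ j ∈ Finset.range m, vv ν (k+j)) :
    stayP B ν m k 0 ≤ 24 * (B + 1) / √(∑ j ∈ Finset.range m, vv ν (k+j)) := by
  set S := ∑ j ∈ Finset.range m, vv ν (k+j) with hSd
  have hq : 1 ≤ √S := by rw [Real.one_le_sqrt]; exact hS
  have hq2 : √S ^ 2 = S := Real.sq_sqrt (by linarith)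
  set q := √S
  have h1 := bb_ge h (6 * q) (by positivity) m k 0
  have h2 := mm_ge B h m k 0
  have h3 := mm_le B hB h m k 0 hB
  rw [← hSd] at h1
  have h4 : q / 24 ≤ bbP ν m k 0 := by
    refine le_trans ?_ h1
    have : (((0:ℝ)^2 + S) / (6*q) - (0^4 + 8 * 0^2 * S + 4 * S^2 + 12 * S)/(6*q)^3 - 0)/2
      = q / 12 - (4 * S^2 + 12 * S)/(432 * q^3) := by
      rw [← hq2]; field_simp; ring
    rw [this]
    have : (4 * S^2 + 12 * S)/(432 * q^3) ≤ q / 27 := by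
      rw [div_le_div_iff₀ (by positivity) (by norm_num)]
      have : q * (432 * q^3) = 432 * S^2 := by rw [← hq2]; ring
      rw [this]; nlinarith
    linarith
  have h5 := (nice_stay B h m k).nonneg 0
  rw [le_div_iff₀ (by linarith)]
  nlinarith [mul_le_mul_of_nonneg_right h4 h5]
end ballot

section step

def wP (r : ℝ) (z : ℂ) : ℝ := (1 - r^2) / ‖1 - r * z‖^2
def xP (r : ℝ) (z : ℂ) : ℝ := Real.log ((1 - r^2) / ‖1 - r * z‖)

lemma wP_meas (r : ℝ) : Measurable (wP r) := by unfold wP; fun_prop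
lemma xP_meas (r : ℝ) : Measurable (xP r) := by unfold xP; fun_prop

lemma r_lt {r : ℝ} (hr0 : 0 ≤ r) (hr : r^2 ≤ 1/2) : r ≤ 3/4 := by nlinarith

lemma nrm_lb {r : ℝ} (hr0 : 0 ≤ r) {z : ℂ} (hz : ‖z‖ = 1) : 1 - r ≤ ‖1 - r * z‖ := by
  have := norm_sub_norm_le (1:ℂ) (r * z)
  rwa [norm_one, norm_mul, hz, mul_one, Complex.norm_real, Real.norm_of_nonneg hr0] at this

lemma nrm_ub {r : ℝ} (hr0 : 0 ≤ r) {z : ℂ} (hz : ‖z‖ = 1) : ‖1 - r * z‖ ≤ 1 + r := by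
  have := norm_sub_le (1:ℂ) (r * z)
  rwa [norm_one, norm_mul, hz, mul_one, Complex.norm_real, Real.norm_of_nonneg hr0] at this

lemma uC_circleAverage {E : Type*} [NormedAddCommGroup E] [NormedSpace ℝ E] (g : ℂ → E)
    (hg : AEStronglyMeasurable g uC) : ∫ z, g z ∂uC = Real.circleAverage g 0 1 := by
  rw [uC_integral g hg, Real.circleAverage_def]
  have := intervalIntegral.integral_comp_mul_left (a := 0) (b := 1) (fun θ => g (circleMap 0 1 θ)) (c := 2 * π) (by positivity)
  simp only [mul_zero, mul_one] at this
  rw [← this]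
  congr 1
  funext θ
  congr 1
  simp only [eC, circleMap]
  push_cast
  simp

lemma uC_poisson {r : ℝ} (hr0 : 0 ≤ r) (hr : r^2 ≤ 1/2) (g : ℂ → ℂ) (hm : Measurable g)
    (hg : DiffContOnCl ℂ g (Metric.ball 0 1)) :
    ∫ z, wP r z • g z ∂uC = g r := by
  have h := hg.circleAverage_poissonKernel_smul' (w := (r:ℂ)) (by
    simp [abs_of_nonneg hr0]; linarith [r_lt hr0 hr])
  rw [← h, ← uC_circleAverage _ (by fun_prop)]
  refine integral_congr_ae ?_
  filter_upwards [uC_norm] with z hz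
  congr 1
  unfold wP
  simp only [sub_zero, hz, Complex.norm_real, Real.norm_of_nonneg hr0]
  congr 2
  · norm_num
  · have : z - r = z * (1 - r * (starRingEnd ℂ) z) := by
      have : z * (starRingEnd ℂ) z = 1 := by rw [Complex.mul_conj, Complex.normSq_eq_norm_sq, hz]; simp
      linear_combination (r:ℂ) * this
    rw [this, norm_mul, hz, one_mul, ← Complex.norm_conj]
    simp

lemma wP_nonneg {r : ℝ} (hr : r^2 ≤ 1/2) (z : ℂ) : 0 ≤ wP r z := by
  unfold wP; exact div_nonneg (by linarith) (by positivity)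

lemma wP_bd {r : ℝ} (hr0 : 0 ≤ r) (hr : r^2 ≤ 1/2) : ∀ᵐ z ∂uC, ‖wP r z‖ ≤ 16 := by
  filter_upwards [uC_norm] with z hz
  rw [Real.norm_of_nonneg (wP_nonneg hr z)]
  have h1 := nrm_lb hr0 hz
  have h2 := r_lt hr0 hr
  unfold wP
  rw [div_le_iff₀ (by have : 0 < ‖1 - r * z‖ := by linarith
                      positivity)]
  nlinarith

lemma wP_int {r : ℝ} (hr0 : 0 ≤ r) (hr : r^2 ≤ 1/2) : Integrable (wP r) uC :=
  Integrable.of_bound (wP_meas r).aestronglyMeasurable 16 (wP_bd hr0 hr)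

lemma wP_one {r : ℝ} (hr0 : 0 ≤ r) (hr : r^2 ≤ 1/2) : ∫ z, wP r z ∂uC = 1 := by
  have := uC_poisson hr0 hr (fun _ => 1) measurable_const diffContOnCl_const
  simp only [Complex.real_smul, mul_one] at this
  rw [integral_complex_ofReal] at this
  exact_mod_cast this

lemma xP_bd {r : ℝ} (hr0 : 0 ≤ r) (hr : r^2 ≤ 1/2) {z : ℂ} (hz : ‖z‖ = 1) : |xP r z| ≤ 2 ∧ xP r z ≤ 1 := by
  have h1 := nrm_lb hr0 hz
  have h3 := nrm_ub hr0 hz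
  have h2 := r_lt hr0 hr
  have hp : 0 < ‖1 - r * z‖ := by linarith
  have u1 : (1 - r^2) / ‖1 - r * z‖ ≤ 1 + r := by
    rw [div_le_iff₀ hp]; nlinarith
  have l1 : 1 - r ≤ (1 - r^2) / ‖1 - r * z‖ := by
    rw [le_div_iff₀ hp]; nlinarith
  have h4 : xP r z ≤ r := by
    unfold xP
    have := Real.log_le_sub_one_of_pos (show 0 < (1 - r^2) / ‖1 - r * z‖ by linarith)
    linarith
  have h5 : -2 ≤ xP r z := by
    unfold xP
    have a1 := Real.one_sub_inv_le_log_of_pos (show (0:ℝ) < 1/2 by norm_num)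
    have : Real.log ((1/2)*(1/2)) ≤ Real.log ((1 - r^2) / ‖1 - r * z‖) := Real.log_le_log (by norm_num) (by linarith)
    rw [Real.log_mul (by norm_num) (by norm_num)] at this
    norm_num at a1 this
    linarith
  exact ⟨abs_le.2 ⟨h5, by linarith⟩, by linarith⟩

lemma xP_eq {r : ℝ} (hr0 : 0 ≤ r) (hr : r^2 ≤ 1/2) {z : ℂ} (hz : ‖z‖ = 1) :
    xP r z = Real.log (1 - r^2) - Real.log ‖1 - r * z‖ := by
  have h1 := nrm_lb hr0 hz
  have h2 := r_lt hr0 hr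
  unfold xP
  rw [Real.log_div (by nlinarith) (by linarith)]

lemma wx_zero {r : ℝ} (hr0 : 0 ≤ r) (hr : r^2 ≤ 1/2) : ∫ z, wP r z * xP r z ∂uC = 0 := by
  have h2 := r_lt hr0 hr
  have hd : DiffContOnCl ℂ (fun z : ℂ => Complex.log (1 - r * z)) (Metric.ball 0 1) := by
    apply DifferentiableOn.diffContOnCl
    rw [closure_ball _ one_ne_zero]
    intro z hz
    have hz : ‖z‖ ≤ 1 := by simpa using hz
    have : DifferentiableAt ℂ (fun z : ℂ => Complex.log (1 - r * z)) z := by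
      refine DifferentiableAt.clog (by fun_prop) ?_
      left
      simp only [Complex.sub_re, Complex.one_re, Complex.mul_re, Complex.ofReal_re, Complex.ofReal_im, zero_mul, sub_zero]
      have := Complex.abs_re_le_norm z
      have := abs_le.1 (this.trans hz)
      nlinarith
    exact this.differentiableWithinAt
  have h := uC_poisson hr0 hr (fun z => Complex.log (1 - r * z)) (by fun_prop) hd
  have hb : ∀ᵐ z ∂uC, wP r z * xP r z = wP r z * Real.log (1 - r^2) - (wP r z • Complex.log (1 - r * z)).re := by
    filter_upwards [uC_norm] with z hz
    rw [xP_eq hr0 hr hz]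
    simp only [Complex.real_smul, Complex.re_ofReal_mul, Complex.log_re]
    ring
  have hi : Integrable (fun z => wP r z • Complex.log (1 - r * z)) uC := by
    by_contra hc
    rw [integral_undef hc] at h
    -- bounded anyway
    have : Complex.log (1 - r * r) = ((Real.log (1 - r^2) : ℝ) : ℂ) := by
      rw [Complex.ofReal_log (by linarith)]; push_cast; ring_nf
    apply hc
    refine Integrable.of_bound (C := 16 * (2 + 4)) ?_ ?_
    · exact ((wP_meas r).smul (by fun_prop)).aestronglyMeasurable
    · filter_upwards [uC_norm, wP_bd hr0 hr] with z hz hw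
      rw [norm_smul]
      refine mul_le_mul hw ?_ (norm_nonneg _) (by norm_num)
      have e1 := xP_bd hr0 hr hz
      have l1 := nrm_lb hr0 hz
      have l2 := nrm_ub hr0 hz
      refine (Complex.norm_le_abs_re_add_abs_im _).trans (add_le_add ?_ ?_)
      · rw [Complex.log_re]
        refine abs_le.2 ⟨?_, ?_⟩
        · have a1 := Real.one_sub_inv_le_log_of_pos (show (0:ℝ) < 1/2 by norm_num)
          have : Real.log ((1/2)*(1/2)) ≤ Real.log ‖1 - r * z‖ := Real.log_le_log (by norm_num) (by linarith)
          rw [Real.log_mul (by norm_num) (by norm_num)] at this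
          norm_num at a1 this
          linarith
        · have := Real.log_le_sub_one_of_pos (show 0 < ‖1 - r * z‖ by linarith)
          linarith
      · rw [Complex.log_im]
        exact (Complex.abs_arg_le_pi _).trans Real.pi_le_four
  have hi2 : Integrable (fun z => (wP r z • Complex.log (1 - r * z)).re) uC := hi.re
  rw [integral_congr_ae hb, integral_sub ((wP_int hr0 hr).mul_const _) hi2, integral_mul_const, wP_one hr0 hr]
  have e : ∫ z, (wP r z • Complex.log (1 - r * z)).re ∂uC = (∫ z, wP r z • Complex.log (1 - r * z) ∂uC).re :=
    integral_re hi
  rw [e, h, Complex.log_re, one_mul]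
  have : ‖(1:ℂ) - r * r‖ = 1 - r^2 := by
    rw [show (1:ℂ) - r * r = ((1 - r^2 : ℝ):ℂ) by push_cast; ring, Complex.norm_real, Real.norm_of_nonneg (by linarith)]
  rw [this, sub_self]

lemma uC_re : ∫ z, z.re ∂uC = 0 := by
  have hi : Integrable (fun z : ℂ => z) uC :=
    Integrable.of_bound (C := 1) measurable_id.aestronglyMeasurable (by filter_upwards [uC_norm] with z hz using hz.le)
  have := uC_pow_conj 1 0 (by norm_num)
  simp only [pow_one, pow_zero, mul_one] at this
  rw [show ∫ z, z.re ∂uC = (∫ z, z ∂uC).re from integral_re hi, this]; rfl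

lemma uC_re_int : Integrable (fun z : ℂ => z.re) uC := 
  Integrable.of_bound (C := 1) (by fun_prop) (by filter_upwards [uC_norm] with z hz using (Complex.abs_re_le_norm z).trans hz.le)

lemma uC_re_sq_int : Integrable (fun z : ℂ => z.re^2) uC := 
  Integrable.of_bound (C := 1) (by fun_prop) (by
    filter_upwards [uC_norm] with z hz
    rw [norm_pow]
    have := (Complex.abs_re_le_norm z).trans hz.le
    exact pow_le_one₀ (norm_nonneg _) this)

lemma uC_re_sq : ∫ z, z.re^2 ∂uC = 1/2 := by
  have h1 : ∫ z, z.re^2 ∂uC = ∫ z, z.im^2 ∂uC := by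
    conv_lhs => rw [← uC_rot Complex.I (by simp)]
    rw [integral_map (by fun_prop) (by fun_prop)]
    simp
  have i2 : Integrable (fun z : ℂ => z.im^2) uC := Integrable.of_bound (C := 1) (by fun_prop) (by
    filter_upwards [uC_norm] with z hz
    rw [norm_pow]
    have := (Complex.abs_im_le_norm z).trans hz.le
    exact pow_le_one₀ (norm_nonneg _) this)
  have h2 : ∫ z, (z.re^2 + z.im^2) ∂uC = 1 := by
    have : ∀ᵐ z ∂uC, z.re^2 + z.im^2 = 1 := by
      filter_upwards [uC_norm] with z hz
      have := Complex.sq_norm z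
      rw [hz, Complex.normSq_apply] at this
      linarith
    rw [integral_congr_ae this]; simp
  rw [integral_add uC_re_sq_int i2] at h2
  linarith

/-- variance lower bound -/
lemma wx2 {r : ℝ} (hr0 : 0 ≤ r) (hr : r^2 ≤ 1/2) : Real.exp (-8) / 14 * r^2 ≤ ∫ z, wP r z * xP r z ^ 2 ∂uC := by
  have h2 := r_lt hr0 hr
  set A := (1 + r^2) / (1-r^2)^2 - 1
  set B := 2 * r / (1-r^2)^2
  have hB : 2 * r ≤ B := by
    rw [le_div_iff₀ (by nlinarith)]
    have : (1-r^2)^2 ≤ 1 := by nlinarith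
    nlinarith
  have key : ∀ᵐ z ∂uC, (1/7) * (Real.exp (-8)/4 * (A^2 - 2 * A * B * z.re + B^2 * z.re^2)) ≤ wP r z * xP r z ^ 2 := by
    filter_upwards [uC_norm] with z hz
    have l1 := nrm_lb hr0 hz
    have l2 := nrm_ub hr0 hz
    have hp : 0 < ‖1 - r * z‖ := by linarith
    have w1 : 1/7 ≤ wP r z := by
      unfold wP
      rw [le_div_iff₀ (by positivity)]
      nlinarith
    have e1 := xP_bd hr0 hr hz
    have e2 : Real.exp (-2 * xP r z) - 1 = A - B * z.re := by
      have : Real.exp (-2 * xP r z) = ‖1 - r * z‖^2 / (1 - r^2)^2 := by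
        have hq : 0 < (1 - r^2) / ‖1 - r * z‖ := by apply div_pos <;> linarith
        rw [show -2 * xP r z = -((2:ℕ) * xP r z) by push_cast; ring, Real.exp_neg, Real.exp_nat_mul]
        unfold xP
        rw [Real.exp_log hq, div_pow, inv_div]
      rw [this]
      have n2 : ‖1 - r * z‖^2 = 1 + r^2 - 2 * r * z.re := by
        have h3 := Complex.sq_norm z
        rw [hz, Complex.normSq_apply] at h3
        rw [Complex.sq_norm, Complex.normSq_apply]
        simp
        linear_combination (-r^2) * h3
      rw [n2]
      simp only [A, B]
      have : (1 - r^2) ≠ 0 := by linarith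
      field_simp
      ring
    have e3 : |Real.exp (-2 * xP r z) - 1| ≤ Real.exp 4 * (2 * |xP r z|) := by
      have a1 : |(-2 * xP r z)| ≤ 4 := by rw [abs_mul]; norm_num; linarith [e1.1]
      set u := -2 * xP r z
      have a2 : 2 * |xP r z| = |u| := by simp only [u]; rw [abs_mul]; norm_num
      rw [a2]
      have hu := abs_le.1 a1
      have h4 : 1 ≤ Real.exp 4 := Real.one_le_exp (by norm_num)
      have b1 := Real.add_one_le_exp u
      have b2 : Real.exp u - 1 ≤ Real.exp u * u := by
        have := Real.add_one_le_exp (-u)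
        have h5 : Real.exp u * Real.exp (-u) = 1 := by rw [← Real.exp_add]; simp
        nlinarith [Real.exp_pos u]
      refine abs_le.2 ⟨?_, ?_⟩
      · have : -|u| ≤ u := neg_abs_le u
        nlinarith [abs_nonneg u]
      · refine b2.trans ?_
        have : Real.exp u ≤ Real.exp 4 := Real.exp_le_exp.2 hu.2
        calc Real.exp u * u ≤ Real.exp u * |u| := by gcongr; exact le_abs_self u
          _ ≤ _ := by gcongr
    rw [e2] at e3
    have e4 : (A - B * z.re)^2 ≤ Real.exp 8 * (4 * xP r z ^2) := by
      rw [← sq_abs]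
      have := pow_le_pow_left₀ (abs_nonneg _) e3 2
      refine this.trans (le_of_eq ?_)
      rw [mul_pow, mul_pow, sq_abs, ← Real.exp_nat_mul]; norm_num
    have e5 : Real.exp (-8)/4 * (A^2 - 2 * A * B * z.re + B^2 * z.re^2) ≤ xP r z ^2 := by
      have : A^2 - 2 * A * B * z.re + B^2 * z.re^2 = (A - B * z.re)^2 := by ring
      rw [this]
      calc _ ≤ Real.exp (-8)/4 * (Real.exp 8 * (4 * xP r z ^2)) := by gcongr
        _ = (Real.exp (-8) * Real.exp 8) * xP r z^2 := by ring
        _ = _ := by rw [← Real.exp_add]; simp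
    exact mul_le_mul w1 e5 (by
      have : A^2 - 2 * A * B * z.re + B^2 * z.re^2 = (A - B * z.re)^2 := by ring
      rw [this]; positivity) (wP_nonneg hr z)
  have i3 : Integrable (fun z => wP r z * xP r z ^ 2) uC := by
    refine (wP_int hr0 hr).mul_bdd (c := 4) ((xP_meas r).pow_const 2).aestronglyMeasurable ?_
    filter_upwards [uC_norm] with z hz
    rw [norm_pow]
    have := pow_le_pow_left₀ (abs_nonneg _) (xP_bd hr0 hr hz).1 2
    rw [Real.norm_eq_abs]
    linarith
  have i4 : Integrable (fun z : ℂ => A^2 - 2 * A * B * z.re + B^2 * z.re^2) uC :=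
    ((integrable_const _).sub (uC_re_int.const_mul _)).add (uC_re_sq_int.const_mul _)
  have := integral_mono_ae ((i4.const_mul _).const_mul _) i3 key
  refine le_trans ?_ this
  have i5 : Integrable (fun z : ℂ => A^2 - 2 * A * B * z.re) uC := (integrable_const _).sub (uC_re_int.const_mul _)
  rw [integral_const_mul, integral_const_mul, integral_add i5 (uC_re_sq_int.const_mul _),
    integral_sub (integrable_const _) (uC_re_int.const_mul _), integral_const_mul, integral_const_mul, uC_re, uC_re_sq]
  simp only [integral_const, probReal_univ, one_smul, mul_zero, sub_zero]
  have : 4 * r^2 ≤ B^2 := by nlinarith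
  have h8 := Real.exp_pos (-8)
  nlinarith [sq_nonneg A]

end step

section conn
variable {Ω : Type*} [mΩ : MeasurableSpace Ω] {μ : Measure Ω} [IsProbabilityMeasure μ]
  {f : Ω → ℕ → ℂ}

lemma lintegral_step' (hf : IsSteinhausRMF μ f) {N : ℕ} (hN : N.Prime) {E : Type*} [mE : MeasurableSpace E]
    (V : Ω → E) (hV : Measurable[Past f N] V) (g : E × ℂ → ENNReal) (hg : Measurable g) :
    ∫⁻ ω, g (V ω, f ω N) ∂μ = ∫⁻ ω, ∫⁻ z, g (V ω, z) ∂uC ∂μ := by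
  refine lintegral_step hf hN (fun ω z => g (V ω, z)) ?_
  refine hg.comp ?_
  exact @Measurable.prodMk _ (@Prod.instMeasurableSpace Ω ℂ (Past f N) _) E ℂ mE _ _ _
    (@Measurable.comp _ _ _ (@Prod.instMeasurableSpace Ω ℂ (Past f N) _) (Past f N) mE _ _ hV (@measurable_fst Ω ℂ (Past f N) _))
    (@measurable_snd Ω ℂ (Past f N) _)

def rN (N : ℕ) : ℝ := (√(N:ℝ))⁻¹

lemma rN_nonneg (N : ℕ) : 0 ≤ rN N := by unfold rN; positivity
lemma rN_sq (N : ℕ) : rN N ^ 2 = (N:ℝ)⁻¹ := by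
  unfold rN; rw [inv_pow, Real.sq_sqrt (by positivity)]
lemma rN_sq_le {N : ℕ} (h : N.Prime) : rN N ^ 2 ≤ 1/2 := by
  rw [rN_sq]
  have : (2:ℝ) ≤ N := by exact_mod_cast h.two_le
  rw [inv_le_comm₀ (by linarith) (by norm_num)]; norm_num; exact h.two_le

def nuN (N : ℕ) : Measure ℝ :=
  if N.Prime then (uC.withDensity (fun z => ENNReal.ofReal (wP (rN N) z))).map (xP (rN N)) else Measure.dirac 0

lemma nuN_lint {N : ℕ} (h : N.Prime) (g : ℝ → ENNReal) (hg : Measurable g) :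
    ∫⁻ x, g x ∂(nuN N) = ∫⁻ z, ENNReal.ofReal (wP (rN N) z) * g (xP (rN N) z) ∂uC := by
  rw [nuN, if_pos h, lintegral_map hg (xP_meas _), lintegral_withDensity_eq_lintegral_mul _ (wP_meas _).ennreal_ofReal
    (show Measurable fun z => g (xP (rN N) z) from hg.comp (xP_meas _))]
  rfl

lemma nuN_int {N : ℕ} (h : N.Prime) (g : ℝ → ℝ) (hg : Measurable g) :
    ∫ x, g x ∂(nuN N) = ∫ z, wP (rN N) z * g (xP (rN N) z) ∂uC := by
  rw [nuN, if_pos h, integral_map (xP_meas _).aemeasurable hg.aestronglyMeasurable,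
    integral_withDensity_eq_integral_toReal_smul (wP_meas _).ennreal_ofReal (by simp)]
  congr 1
  funext z
  rw [ENNReal.toReal_ofReal (wP_nonneg (rN_sq_le h) z)]; rfl

lemma bd_meas : MeasurableSet {x : ℝ | |x| ≤ 2 ∧ x ≤ 1} :=
  (measurableSet_le (by fun_prop : Measurable fun x : ℝ => |x|) measurable_const).inter
    (measurableSet_le (by fun_prop : Measurable fun x : ℝ => x) measurable_const)

lemma stepLaw_nuN : StepLaw nuN := by
  refine ⟨fun k => ?_, fun k => ?_, fun k => ?_⟩
  · by_cases h : k.Prime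
    · constructor
      have := nuN_lint h (fun _ => 1) measurable_const
      simp only [lintegral_one, mul_one] at this
      rw [this, ← ofReal_integral_eq_lintegral_ofReal (wP_int (rN_nonneg k) (rN_sq_le h))
        (ae_of_all _ fun z => wP_nonneg (rN_sq_le h) z), wP_one (rN_nonneg k) (rN_sq_le h)]
      simp
    · rw [nuN, if_neg h]; infer_instance
  · by_cases h : k.Prime
    · rw [nuN, if_pos h]
      rw [ae_map_iff (xP_meas _).aemeasurable bd_meas]
      refine (withDensity_absolutelyContinuous _ _).ae_le ?_
      filter_upwards [uC_norm] with z hz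
      exact xP_bd (rN_nonneg k) (rN_sq_le h) hz
    · rw [nuN, if_neg h, ae_dirac_iff bd_meas]
      norm_num
  · by_cases h : k.Prime
    · rw [nuN_int h (fun x => x) measurable_id]
      exact wx_zero (rN_nonneg k) (rN_sq_le h)
    · rw [nuN, if_neg h]; simp

lemma vv_nuN {N : ℕ} (h : N.Prime) : Real.exp (-8)/14 * (N:ℝ)⁻¹ ≤ vv nuN N := by
  unfold vv
  rw [nuN_int h _ (by fun_prop), ← rN_sq]
  exact wx2 (rN_nonneg N) (rN_sq_le h)

lemma vv_sum (N : ℕ) : Real.exp (-8)/28 * Real.log (LN N) ≤ ∑ j ∈ Finset.range N, vv nuN j := by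
  have h1 : ∑ p ∈ N.primesBelow, Real.exp (-8)/14 * (p:ℝ)⁻¹ ≤ ∑ j ∈ Finset.range N, vv nuN j := by
    refine (Finset.sum_le_sum fun p hp => vv_nuN (Nat.prime_of_mem_primesBelow hp)).trans ?_
    refine Finset.sum_le_sum_of_subset_of_nonneg (Finset.filter_subset _ _) fun j _ _ => ?_
    exact integral_nonneg fun x => sq_nonneg x
  rw [← Finset.mul_sum] at h1
  have h2 := log_LN_le N
  have := Real.exp_pos (-8)
  nlinarith

/-- Euler product -/
def FN (f : Ω → ℕ → ℂ) (N : ℕ) (ω : Ω) : ℂ := ∏ p ∈ N.primesBelow, (1 - rN p * f ω p)⁻¹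

lemma primesBelow_succ' (N : ℕ) : (N+1).primesBelow = if N.Prime then insert N N.primesBelow else N.primesBelow :=
  Nat.primesBelow_succ N

lemma FN_succ (N : ℕ) (ω : Ω) : FN f (N+1) ω = if N.Prime then FN f N ω * (1 - rN N * f ω N)⁻¹ else FN f N ω := by
  unfold FN
  rw [Nat.primesBelow_succ]
  split_ifs with h
  · rw [Finset.prod_insert (by simp [Nat.primesBelow]), mul_comm]
  · rfl

lemma FN_meas (hf : IsSteinhausRMF μ f) (N : ℕ) : Measurable[Past f N] (FN f N) := by
  unfold FN
  refine Finset.measurable_fun_prod _ fun p hp => ?_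
  have h1 : Measurable[Past f N] (fun ω => f ω p) :=
    Past_meas_lt hf p (Nat.prime_of_mem_primesBelow hp).one_lt.le (Nat.lt_of_mem_primesBelow hp)
  exact Measurable.inv (Measurable.const_sub (Measurable.const_mul h1 _) _)

lemma den_ne (hf : SRMF μ f) {p : ℕ} (hp : p.Prime) (ω : Ω) : (1 - rN p * f ω p) ≠ 0 := by
  have h1 := nrm_lb (rN_nonneg p) (hf.norm_one ω p hp.one_lt.le)
  have := r_lt (rN_nonneg p) (rN_sq_le hp)
  intro h
  rw [h, norm_zero] at h1
  linarith

lemma FN_ne (hf : SRMF μ f) (N : ℕ) (ω : Ω) : FN f N ω ≠ 0 := by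
  unfold FN
  exact Finset.prod_ne_zero_iff.2 fun p hp => inv_ne_zero (den_ne hf (Nat.prime_of_mem_primesBelow hp) ω)

def YN (f : Ω → ℕ → ℂ) (N : ℕ) (ω : Ω) : ℝ := ‖FN f N ω‖^2 / LN N
def SN (f : Ω → ℕ → ℂ) (N : ℕ) (ω : Ω) : ℝ := Real.log (‖FN f N ω‖ / LN N)

lemma YN_nonneg (N : ℕ) (ω : Ω) : 0 ≤ YN f N ω := div_nonneg (by positivity) (LN_pos N).le

lemma YN_meas (hf : IsSteinhausRMF μ f) (N : ℕ) : Measurable[Past f N] (YN f N) := by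
  exact (show Measurable (fun z : ℂ => ‖z‖^2 / LN N) by fun_prop).comp (FN_meas hf N)
lemma SN_meas (hf : IsSteinhausRMF μ f) (N : ℕ) : Measurable[Past f N] (SN f N) := by
  exact (show Measurable (fun z : ℂ => Real.log (‖z‖ / LN N)) by fun_prop).comp (FN_meas hf N)

lemma YN_succ (N : ℕ) (ω : Ω) : YN f (N+1) ω = if N.Prime then YN f N ω * wP (rN N) (f ω N) else YN f N ω := by
  unfold YN
  rw [FN_succ, LN_succ]
  split_ifs with h
  · unfold wP
    rw [norm_mul, norm_inv, rN_sq]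
    simp only [div_eq_mul_inv, mul_inv, inv_inv, mul_pow, inv_pow]
    ring
  · rfl

lemma SN_succ (hf : SRMF μ f) (N : ℕ) (ω : Ω) :
    SN f (N+1) ω = if N.Prime then SN f N ω + xP (rN N) (f ω N) else SN f N ω := by
  unfold SN
  rw [FN_succ, LN_succ]
  split_ifs with h
  · unfold xP
    have h1 := nrm_lb (rN_nonneg N) (hf.norm_one ω N h.one_lt.le)
    have h2 := r_lt (rN_nonneg N) (rN_sq_le h)
    have h3 := rN_sq_le h
    have h4 := norm_pos_iff.2 (FN_ne hf N ω)
    have h5 := LN_pos N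
    rw [← Real.log_mul (by positivity) (div_ne_zero (by linarith) (by linarith)), rN_sq, norm_mul, norm_inv]
    simp only [div_eq_mul_inv, mul_inv, inv_inv]
    ring_nf
  · rfl

open Classical in
lemma connect (hf : SRMF μ f) (B : ℝ) (m k : ℕ) (G : Set Ω) (hG : MeasurableSet[Past f k] G) :
    ∫⁻ ω in G ∩ {ω | ∀ j < m, SN f (k+1+j) ω ≤ B}, ENNReal.ofReal (YN f (k+m) ω) ∂μ
      = ∫⁻ ω in G, ENNReal.ofReal (YN f k ω) * ENNReal.ofReal (stayP B nuN m k (SN f k ω)) ∂μ := by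
  induction m generalizing k G with
  | zero => simp [stayP]
  | succ m ih =>
    set G' := G ∩ {ω | SN f (k+1) ω ≤ B}
    have hG'1 : MeasurableSet[Past f (k+1)] {ω | SN f (k+1) ω ≤ B} :=
      measurableSet_le (SN_meas hf.toIsSteinhausRMF (k+1)) (@measurable_const _ _ _ (Past f (k+1)) _)
    have hG' : MeasurableSet[Past f (k+1)] G' :=
      @MeasurableSet.inter _ (Past f (k+1)) _ _ (Past_mono f (Nat.le_succ k) _ hG) hG'1
    have e1 : G ∩ {ω | ∀ j < m+1, SN f (k+1+j) ω ≤ B} = G' ∩ {ω | ∀ j < m, SN f (k+1+1+j) ω ≤ B} := by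
      ext ω
      simp only [G', Set.mem_inter_iff, Set.mem_setOf_eq, and_assoc]
      refine and_congr_right fun _ => ⟨fun h => ⟨by simpa using h 0 (by omega), fun j hj => by
        have := h (j+1) (by omega); rwa [show k+1+(j+1) = k+1+1+j by ring] at this⟩, fun h j hj => ?_⟩
      rcases j with _ | j
      · exact h.1
      · have := h.2 j (by omega); rwa [show k+1+(j+1) = k+1+1+j by ring]
    rw [e1, show k + (m+1) = k+1+m by ring, ih (k+1) G' hG']
    have mst : ∀ m k, Measurable (stayP B nuN m k) := fun m k => (nice_stay B stepLaw_nuN m k).anti.measurable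
    -- write as indicator
    have hGm := Past_le hf.toIsSteinhausRMF k _ hG
    have hG'm := Past_le hf.toIsSteinhausRMF (k+1) _ hG'1
    simp only [G']
    rw [Set.inter_comm, ← Measure.restrict_restrict hG'm, ← lintegral_indicator hG'm, ← lintegral_indicator hGm,
      ← lintegral_indicator hGm]
    by_cases hp : k.Prime
    · set V : Ω → ENNReal × ENNReal × ℝ := fun ω => (G.indicator (fun _ => 1) ω, ENNReal.ofReal (YN f k ω), SN f k ω)
      have hV : Measurable[Past f k] V :=
        Measurable.prodMk ((measurable_indicator_const_iff (m := Past f k) (1:ENNReal)).2 hG)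
          (Measurable.prodMk (YN_meas hf.toIsSteinhausRMF k).ennreal_ofReal (SN_meas hf.toIsSteinhausRMF k))
      set g : (ENNReal × ENNReal × ℝ) × ℂ → ENNReal := fun q => q.1.1 * (q.1.2.1 * (ENNReal.ofReal (wP (rN k) q.2) *
        ENNReal.ofReal (if q.1.2.2 + xP (rN k) q.2 ≤ B then stayP B nuN m (k+1) (q.1.2.2 + xP (rN k) q.2) else 0)))
      have hg : Measurable g := by
        have q1 : Measurable (fun q : (ENNReal × ENNReal × ℝ) × ℂ => q.1.2.2 + xP (rN k) q.2) :=
          (by fun_prop : Measurable (fun q : (ENNReal × ENNReal × ℝ) × ℂ => q.1.2.2)).add ((xP_meas _).comp measurable_snd)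
        have q2 : Measurable (fun s => if s ≤ B then stayP B nuN m (k+1) s else 0) :=
          ((nice_stay B stepLaw_nuN m (k+1)).cut B).anti.measurable
        have q3 := (q2.comp q1).ennreal_ofReal
        have q4 : Measurable (fun q : (ENNReal × ENNReal × ℝ) × ℂ => ENNReal.ofReal (wP (rN k) q.2)) :=
          ((wP_meas _).comp measurable_snd).ennreal_ofReal
        exact (by fun_prop : Measurable (fun q : (ENNReal × ENNReal × ℝ) × ℂ => q.1.1)).mul
          ((by fun_prop : Measurable (fun q : (ENNReal × ENNReal × ℝ) × ℂ => q.1.2.1)).mul (q4.mul q3))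
      have st := lintegral_step' hf.toIsSteinhausRMF hp V hV g hg
      have l1 : ∀ ω, G.indicator ({ω | SN f (k+1) ω ≤ B}.indicator fun ω => ENNReal.ofReal (YN f (k+1) ω) * ENNReal.ofReal (stayP B nuN m (k+1) (SN f (k+1) ω))) ω = g (V ω, f ω k) := by
        intro ω
        simp only [g, V, Set.indicator_apply, Set.mem_setOf_eq, Pi.one_apply]
        rw [SN_succ hf, YN_succ, if_pos hp, if_pos hp, ENNReal.ofReal_mul (YN_nonneg k ω)]
        split_ifs <;> simp [mul_assoc]
      have l2 : ∀ ω, G.indicator (fun ω => ENNReal.ofReal (YN f k ω) * ENNReal.ofReal (stayP B nuN (m+1) k (SN f k ω))) ω = ∫⁻ z, g (V ω, z) ∂uC := by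
        intro ω
        simp only [g, V]
        have q2 : Measurable (fun s => if s ≤ B then stayP B nuN m (k+1) s else 0) :=
          ((nice_stay B stepLaw_nuN m (k+1)).cut B).anti.measurable
        have q3 : Measurable (fun x => ENNReal.ofReal (if SN f k ω + x ≤ B then stayP B nuN m (k+1) (SN f k ω + x) else 0)) :=
          (q2.comp (measurable_const_add (SN f k ω))).ennreal_ofReal
        rw [lintegral_const_mul' _ _ (by rw [Set.indicator_apply]; split_ifs <;> simp), lintegral_const_mul' _ _ (by simp)]
        have n1 := nuN_lint hp _ q3
        have := stepLaw_nuN.prob k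
        have n2 := ofReal_integral_eq_lintegral_ofReal (((nice_stay B stepLaw_nuN m (k+1)).cut B).bdd (stepLaw_nuN.bd k) (SN f k ω))
          (ae_of_all _ fun x => ((nice_stay B stepLaw_nuN m (k+1)).cut B).nonneg _)
        rw [← n1, ← n2]
        simp only [Set.indicator_apply, Pi.one_apply]
        split_ifs
        · rw [one_mul]; rfl
        · simp
      simp_rw [l1, l2]
      exact st
    · congr 1
      funext ω
      simp only [Set.indicator_apply, Set.mem_setOf_eq]
      rw [SN_succ hf, YN_succ, if_neg hp, if_neg hp]
      have : stayP B nuN (m+1) k (SN f k ω) = if SN f k ω ≤ B then stayP B nuN m (k+1) (SN f k ω) else 0 := by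
        show ∫ x, _ ∂(nuN k) = _
        rw [nuN, if_neg hp, integral_dirac]; simp
      rw [this]
      split_ifs <;> simp

lemma FN_zero (ω : Ω) : FN f 0 ω = 1 := by simp [FN, Nat.primesBelow]
lemma LN_zero : LN 0 = 1 := by simp [LN, Nat.primesBelow]

lemma barrier_bound (hf : SRMF μ f) (B : ℝ) (hB : 0 ≤ B) (N : ℕ) (hN : 1 ≤ Real.exp (-8)/28 * Real.log (LN N)) :
    ∫⁻ ω in {ω | ∀ M ≤ N, ‖FN f M ω‖ ≤ Real.exp B * LN M}, ENNReal.ofReal (‖FN f N ω‖^2 / LN N) ∂μ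
      ≤ ENNReal.ofReal (24 * (B + 1) / √(Real.exp (-8)/28 * Real.log (LN N))) := by
  have h1 := connect hf B N 0 Set.univ MeasurableSet.univ
  have h2 := vv_sum N
  have h3 := ballot B hB stepLaw_nuN N 0 (by simpa using hN.trans h2)
  have h4 : ∫⁻ ω in {ω | ∀ M ≤ N, ‖FN f M ω‖ ≤ Real.exp B * LN M}, ENNReal.ofReal (‖FN f N ω‖^2 / LN N) ∂μ ≤
      ∫⁻ ω in Set.univ ∩ {ω | ∀ j < N, SN f (0+1+j) ω ≤ B}, ENNReal.ofReal (YN f (0+N) ω) ∂μ := by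
    rw [zero_add N]
    refine lintegral_mono_set (f := fun ω => ENNReal.ofReal (‖FN f N ω‖^2 / LN N)) ?_
    intro ω hω
    refine ⟨trivial, fun j hj => ?_⟩
    have := hω (0+1+j) (by omega)
    unfold SN
    have h4 := norm_pos_iff.2 (FN_ne hf (0+1+j) ω)
    have h5 := LN_pos (0+1+j)
    rw [Real.log_le_iff_le_exp (by positivity), div_le_iff₀ h5]
    exact this
  refine h4.trans ?_
  rw [h1]
  have e1 : ∀ ω, YN f 0 ω = 1 := fun ω => by simp [YN, FN_zero, LN_zero]
  have e2 : ∀ ω, SN f 0 ω = 0 := fun ω => by simp [SN, FN_zero, LN_zero]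
  simp only [e1, e2, ENNReal.ofReal_one, one_mul, lintegral_const, Measure.restrict_univ, measure_univ, mul_one]
  refine ENNReal.ofReal_le_ofReal (h3.trans ?_)
  simp only [zero_add]
  gcongr

end conn

section doob
variable {Ω : Type*} [mΩ : MeasurableSpace Ω] {μ : Measure Ω} [IsProbabilityMeasure μ]
  {f : Ω → ℕ → ℂ}

lemma doob (hf : IsSteinhausRMF μ f) (Y : ℕ → Ω → ENNReal) (N0 : ℕ) (hY : ∀ N, Measurable[Past f N] (Y N))
    (hsub : ∀ N ≥ N0, ∀ A, MeasurableSet[Past f N] A → ∫⁻ ω in A, Y N ω ∂μ ≤ ∫⁻ ω in A, Y (N+1) ω ∂μ)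
    (G : Set Ω) (hG : MeasurableSet[Past f N0] G) (l : ENNReal) (K : ℕ) (hK : N0 ≤ K) :
    l * μ (G ∩ {ω | ∃ N, N0 ≤ N ∧ N ≤ K ∧ l ≤ Y N ω}) ≤ ∫⁻ ω in G, Y K ω ∂μ := by
  have hm : ∀ K, N0 ≤ K → MeasurableSet[Past f K] (G ∩ {ω | ∃ N, N0 ≤ N ∧ N ≤ K ∧ l ≤ Y N ω}) := by
    intro K hK
    refine @MeasurableSet.inter _ (Past f K) _ _ (Past_mono f hK _ hG) ?_
    have : {ω | ∃ N, N0 ≤ N ∧ N ≤ K ∧ l ≤ Y N ω} = ⋃ N ∈ Finset.Icc N0 K, {ω | l ≤ Y N ω} := by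
      ext ω; simp [and_assoc]
    rw [this]
    refine @Finset.measurableSet_biUnion _ _ (Past f K) _ _ fun N hN => ?_
    refine Past_mono f (Finset.mem_Icc.1 hN).2 _ ?_
    exact measurableSet_le (@measurable_const _ _ _ (Past f N) _) (hY N)
  have key : l * μ (G ∩ {ω | ∃ N, N0 ≤ N ∧ N ≤ K ∧ l ≤ Y N ω}) ≤
      ∫⁻ ω in G ∩ {ω | ∃ N, N0 ≤ N ∧ N ≤ K ∧ l ≤ Y N ω}, Y K ω ∂μ := by
    have aux : ∀ (A : Set Ω), MeasurableSet A → ∀ N, (∀ ω ∈ A, l ≤ Y N ω) → l * μ A ≤ ∫⁻ ω in A, Y N ω ∂μ := by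
      intro A hA N h
      rw [← setLIntegral_const]
      exact setLIntegral_mono' hA h
    induction K, hK using Nat.le_induction with
    | base =>
      refine aux _ (Past_le hf N0 _ (hm N0 le_rfl)) _ ?_
      rintro ω ⟨_, N, h1, h2, h3⟩
      rwa [le_antisymm h2 h1] at h3
    | succ K hK ih =>
      set A := G ∩ {ω | ∃ N, N0 ≤ N ∧ N ≤ K ∧ l ≤ Y N ω} with hA
      set A' := G ∩ {ω | ∃ N, N0 ≤ N ∧ N ≤ K+1 ∧ l ≤ Y N ω} with hA'
      have mA := Past_le hf K _ (hm K hK)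
      have mA' := Past_le hf (K+1) _ (hm (K+1) (by omega))
      have hss : A ⊆ A' := by
        rintro ω ⟨h0, N, h1, h2, h3⟩; exact ⟨h0, N, h1, by omega, h3⟩
      have e : A' = A ∪ (A' \ A) := (Set.union_diff_cancel hss).symm
      rw [e, lintegral_union (mA'.diff mA) Set.disjoint_sdiff_right, measure_union Set.disjoint_sdiff_right (mA'.diff mA), mul_add]
      refine add_le_add (ih.trans (hsub K hK _ (hm K hK))) ?_
      refine aux _ (mA'.diff mA) _ ?_
      rintro ω ⟨⟨h0, N, h1, h2, h3⟩, h4⟩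
      rcases Nat.lt_or_ge N (K+1) with h | h
      · exact absurd ⟨h0, N, h1, by omega, h3⟩ h4
      · rwa [le_antisymm h2 h] at h3
  exact key.trans (lintegral_mono_set Set.inter_subset_left)

/-- functionals of sequences -/
def FE (N : ℕ) (a : ℕ → ℂ) : ℂ := ∏ p ∈ N.primesBelow, (1 - rN p * a p)⁻¹
def SE (N : ℕ) (a : ℕ → ℂ) : ℂ := ∑ p ∈ N.primesBelow, (Real.log p : ℂ) * (rN p * a p) * (1 - rN p * a p)⁻¹
def KE (N : ℕ) (a : ℕ → ℂ) : ℂ := FE N a * SE N a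
def twa (a : ℕ → ℂ) (t : ℝ) : ℕ → ℂ := fun n => a n * (n : ℂ) ^ (-(t * Complex.I))
def cutN (N : ℕ) (a : ℕ → ℂ) : ℕ → ℂ := fun n => if n.Prime ∧ n < N then a n else 1

lemma FN_eq (N : ℕ) (ω : Ω) : FN f N ω = FE N (f ω) := rfl
lemma tw_eq (t : ℝ) (ω : Ω) : tw f t ω = twa (f ω) t := rfl

lemma twa_meas : Measurable (fun q : (ℕ → ℂ) × ℝ => twa q.1 q.2) := by
  refine measurable_pi_lambda _ fun n => ?_
  unfold twa
  refine Measurable.mul (by fun_prop) ?_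
  have : Measurable (fun t : ℝ => (n:ℂ) ^ (-(t * Complex.I))) := by fun_prop
  exact this.comp measurable_snd

lemma FE_meas (N : ℕ) : Measurable (FE N) := by unfold FE; fun_prop
lemma SE_meas (N : ℕ) : Measurable (SE N) := by unfold SE; fun_prop
lemma KE_meas (N : ℕ) : Measurable (KE N) := (FE_meas N).mul (SE_meas N)

lemma cut_prime {N : ℕ} {a : ℕ → ℂ} {p : ℕ} (hp : p ∈ N.primesBelow) : cutN N a p = a p := by
  unfold cutN; rw [if_pos ⟨Nat.prime_of_mem_primesBelow hp, Nat.lt_of_mem_primesBelow hp⟩]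

lemma FE_cut (N : ℕ) (a : ℕ → ℂ) (t : ℝ) : FE N (twa (cutN N a) t) = FE N (twa a t) := by
  unfold FE twa
  exact Finset.prod_congr rfl fun p hp => by rw [cut_prime hp]
lemma SE_cut (N : ℕ) (a : ℕ → ℂ) (t : ℝ) : SE N (twa (cutN N a) t) = SE N (twa a t) := by
  unfold SE twa
  exact Finset.sum_congr rfl fun p hp => by rw [cut_prime hp]
lemma KE_cut (N : ℕ) (a : ℕ → ℂ) (t : ℝ) : KE N (twa (cutN N a) t) = KE N (twa a t) := by
  unfold KE; rw [FE_cut, SE_cut]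

lemma past_cut (f : Ω → ℕ → ℂ) (N : ℕ) : Measurable[Past f N] (fun ω => cutN N (f ω)) := by
  refine @measurable_pi_lambda _ _ _ (Past f N) _ _ fun n => ?_
  unfold cutN
  by_cases h : n.Prime ∧ n < N
  · simp only [h, and_self, if_true]
    exact sig_meas_prime f ⟨n, h.1⟩ h.2
  · simp only [h, if_false]
    exact measurable_const

lemma past_fun (f : Ω → ℕ → ℂ) (N : ℕ) {E : Type*} [MeasurableSpace E] (Ψ : (ℕ → ℂ) → E) (h : Measurable Ψ)
    (hc : ∀ a, Ψ (cutN N a) = Ψ a) : Measurable[Past f N] (fun ω => Ψ (f ω)) := by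
  have := h.comp (past_cut f N)
  have e : (fun ω => Ψ (f ω)) = Ψ ∘ (fun ω => cutN N (f ω)) := by
    funext ω; exact (hc (f ω)).symm
  rw [e]; exact this

lemma seq_meas (hf : IsSteinhausRMF μ f) : Measurable f := measurable_pi_lambda _ hf.meas

/-- integrated functionals: measurability and submartingale property -/
lemma sub_int (hf : IsSteinhausRMF μ f) (ρ : Measure ℝ) [SFinite ρ] (Ψ Φ : (ℕ → ℂ) × ℝ → ENNReal) (hΨ : Measurable Ψ) (hΦ : Measurable Φ)
    (A : Set Ω) (h : ∀ t, ∫⁻ ω in A, Ψ (f ω, t) ∂μ ≤ ∫⁻ ω in A, Φ (f ω, t) ∂μ) :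
    ∫⁻ ω in A, ∫⁻ t, Ψ (f ω, t) ∂ρ ∂μ ≤ ∫⁻ ω in A, ∫⁻ t, Φ (f ω, t) ∂ρ ∂μ := by
  have hm : Measurable (fun q : Ω × ℝ => (f q.1, q.2)) :=
    ((seq_meas hf).comp measurable_fst).prodMk measurable_snd
  rw [lintegral_lintegral_swap (f := fun ω t => Ψ (f ω, t)) (hΨ.comp hm).aemeasurable,
    lintegral_lintegral_swap (f := fun ω t => Φ (f ω, t)) (hΦ.comp hm).aemeasurable]
  exact lintegral_mono h

lemma swap_int (hf : IsSteinhausRMF μ f) (ρ : Measure ℝ) [SFinite ρ] (Ψ : (ℕ → ℂ) × ℝ → ENNReal) (hΨ : Measurable Ψ)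
    (A : Set Ω) :
    ∫⁻ ω in A, ∫⁻ t, Ψ (f ω, t) ∂ρ ∂μ = ∫⁻ t, ∫⁻ ω in A, Ψ (f ω, t) ∂μ ∂ρ := by
  have hm : Measurable (fun q : Ω × ℝ => (f q.1, q.2)) :=
    ((seq_meas hf).comp measurable_fst).prodMk measurable_snd
  rw [lintegral_lintegral_swap (f := fun ω t => Ψ (f ω, t)) (hΨ.comp hm).aemeasurable]

lemma Past_tw_eq (hf : SRMF μ f) (t : ℝ) (N : ℕ) : Past (tw f t) N = Past f N := by
  refine le_antisymm (Past_tw hf t N) ?_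
  have h1 := Past_tw (tw_SRMF hf t) (-t) N
  refine le_trans (le_of_eq ?_) h1
  unfold Past sig
  congr 1; funext p; congr 1; funext _
  congr 1
  funext ω
  unfold tw
  have hp : ((p:ℕ):ℂ) ≠ 0 := by exact_mod_cast p.2.ne_zero
  rw [mul_assoc, ← Complex.cpow_add _ _ hp]
  simp

lemma FE_succ (N : ℕ) (a : ℕ → ℂ) : FE (N+1) a = if N.Prime then FE N a * (1 - rN N * a N)⁻¹ else FE N a := by
  unfold FE
  rw [Nat.primesBelow_succ]
  split_ifs with h
  · rw [Finset.prod_insert (by simp [Nat.primesBelow]), mul_comm]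
  · rfl

lemma SE_succ (N : ℕ) (a : ℕ → ℂ) : SE (N+1) a = if N.Prime then SE N a + Real.log N * (rN N * a N) * (1 - rN N * a N)⁻¹ else SE N a := by
  unfold SE
  rw [Nat.primesBelow_succ]
  split_ifs with h
  · rw [Finset.sum_insert (by simp [Nat.primesBelow]), add_comm]
  · rfl

lemma KE_succ (N : ℕ) (a : ℕ → ℂ) : KE (N+1) a = if N.Prime then KE N a * (1 - rN N * a N)⁻¹ +
    FE N a * (Real.log N * (rN N * a N) * (1 - rN N * a N)⁻¹ ^ 2) else KE N a := by
  unfold KE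
  rw [FE_succ, SE_succ]
  split_ifs with h
  · ring
  · rfl

lemma uC_mean (g : ℂ → ℂ) (hm : Measurable g) (hg : DiffContOnCl ℂ g (Metric.ball 0 1)) :
    ∫ z, g z ∂uC = g 0 := by
  have := uC_poisson (r := 0) le_rfl (by norm_num) g hm hg
  simpa [wP] using this

lemma hk_diff {r : ℝ} (hr0 : 0 ≤ r) (hr : r^2 ≤ 1/2) (α β : ℂ) :
    DiffContOnCl ℂ (fun z : ℂ => α * (1 - r * z)⁻¹ + β * ((r * z) * (1 - r * z)⁻¹^2)) (Metric.ball 0 1) := by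
  have h2 := r_lt hr0 hr
  apply DifferentiableOn.diffContOnCl
  rw [closure_ball _ one_ne_zero]
  intro z hz
  have hz : ‖z‖ ≤ 1 := by simpa using hz
  have hne : (1 - r * z) ≠ 0 := by
    intro h
    have h3 : (r:ℂ) * z = 1 := by linear_combination -h
    have h4 : ‖(r:ℂ) * z‖ = 1 := by rw [h3]; simp
    rw [norm_mul, Complex.norm_real, Real.norm_of_nonneg hr0] at h4
    nlinarith [norm_nonneg z]
  have : DifferentiableAt ℂ (fun z : ℂ => α * (1 - r * z)⁻¹ + β * ((r * z) * (1 - r * z)⁻¹^2)) z := by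
    fun_prop (disch := exact hne)
  exact this.differentiableWithinAt

lemma uC_ne {r : ℝ} (hr0 : 0 ≤ r) (hr : r^2 ≤ 1/2) {z : ℂ} (hz : ‖z‖ = 1) : ‖(1 - r * z)⁻¹‖ ≤ 4 := by
  have h2 := r_lt hr0 hr
  have := nrm_lb hr0 hz
  rw [norm_inv, inv_le_comm₀ (by linarith) (by norm_num)]
  linarith

lemma jensen_sq (g : ℂ → ℂ) (hg : Measurable g) (C : ℝ) (hb : ∀ᵐ z ∂uC, ‖g z‖ ≤ C) :
    ENNReal.ofReal (‖∫ z, g z ∂uC‖^2) ≤ ∫⁻ z, ENNReal.ofReal (‖g z‖^2) ∂uC := by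
  set c := ∫ z, g z ∂uC with hc
  have ig : Integrable g uC := Integrable.of_bound hg.aestronglyMeasurable C hb
  have ig2 : Integrable (fun z => ‖g z‖^2) uC := by
    refine Integrable.of_bound (hg.norm.pow_const 2).aestronglyMeasurable (C^2) ?_
    filter_upwards [hb] with z hz
    rw [norm_pow, norm_norm]; exact pow_le_pow_left₀ (norm_nonneg _) hz 2
  rw [← ofReal_integral_eq_lintegral_ofReal ig2 (ae_of_all _ fun z => by positivity)]
  refine ENNReal.ofReal_le_ofReal ?_
  have i3 : Integrable (fun z => 2 * ((starRingEnd ℂ) c * g z).re - ‖c‖^2) uC := 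
    ((ig.const_mul _).re.const_mul 2).sub (integrable_const _)
  have h1 : ∀ z, 2 * ((starRingEnd ℂ) c * g z).re - ‖c‖^2 ≤ ‖g z‖^2 := by
    intro z
    have : 0 ≤ ‖g z - c‖^2 := by positivity
    rw [Complex.sq_norm, Complex.normSq_sub] at this
    rw [Complex.sq_norm, Complex.sq_norm]
    have e : (g z * (starRingEnd ℂ) c).re = ((starRingEnd ℂ) c * g z).re := by rw [mul_comm]
    rw [e] at this
    linarith
  have h2 := integral_mono i3 ig2 h1
  refine le_trans (le_of_eq ?_) h2
  have i4 : Integrable (fun z => 2 * ((starRingEnd ℂ) c * g z).re) uC := ((ig.const_mul _).re.const_mul 2)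
  rw [integral_sub i4 (integrable_const _), integral_const_mul,
    show ∫ z, ((starRingEnd ℂ) c * g z).re ∂uC = (∫ z, (starRingEnd ℂ) c * g z ∂uC).re from integral_re (ig.const_mul _),
    integral_const_mul, ← hc]
  have : ((starRingEnd ℂ) c * c).re = ‖c‖^2 := by
    rw [mul_comm, Complex.mul_conj, Complex.normSq_eq_norm_sq, Complex.ofReal_re]
  rw [this]; simp; ring

lemma jensen_hk {r : ℝ} (hr0 : 0 ≤ r) (hr : r^2 ≤ 1/2) (α β : ℂ) :
    ENNReal.ofReal (‖α‖^2) ≤ ∫⁻ z, ENNReal.ofReal (‖α * (1 - r * z)⁻¹ + β * ((r * z) * (1 - r * z)⁻¹^2)‖^2) ∂uC := by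
  have h := uC_mean _ (by fun_prop) (hk_diff hr0 hr α β)
  have h2 := jensen_sq (hg := by fun_prop) (C := ‖α‖ * 4 + ‖β‖ * ((3/4 * 1) * 4^2)) (g := fun z : ℂ => α * (1 - r * z)⁻¹ + β * ((r * z) * (1 - r * z)⁻¹^2)) (hb := by
    filter_upwards [uC_norm] with z hz
    refine (norm_add_le _ _).trans ?_
    rw [norm_mul, norm_mul, norm_mul, norm_mul, norm_pow, Complex.norm_real, Real.norm_of_nonneg hr0, hz]
    have := uC_ne hr0 hr hz
    have := r_lt hr0 hr
    gcongr)
  rw [h] at h2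
  simpa using h2

/-- the basic conditional step -/
lemma set_step (hf : IsSteinhausRMF μ f) {N : ℕ} (hN : N.Prime) {E : Type*} [mE : MeasurableSpace E]
    (V : Ω → E) (hV : Measurable[Past f N] V) (g : E × ℂ → ENNReal) (hg : Measurable g) (A : Set Ω)
    (hA : MeasurableSet[Past f N] A) :
    ∫⁻ ω in A, g (V ω, f ω N) ∂μ = ∫⁻ ω in A, ∫⁻ z, g (V ω, z) ∂uC ∂μ := by
  classical
  have hAm := Past_le hf N _ hA
  rw [← lintegral_indicator hAm, ← lintegral_indicator hAm]
  have hV2 : Measurable[Past f N] (fun ω => (A.indicator (fun _ => (1:ENNReal)) ω, V ω)) :=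
    Measurable.prodMk ((measurable_indicator_const_iff (m := Past f N) (1:ENNReal)).2 hA) hV
  have := lintegral_step' hf hN _ hV2 (fun q => q.1.1 * g (q.1.2, q.2)) (by
    exact (by fun_prop : Measurable fun q : (ENNReal × E) × ℂ => q.1.1).mul
      (hg.comp (by fun_prop : Measurable fun q : (ENNReal × E) × ℂ => (q.1.2, q.2))))
  convert this using 2
  · funext ω; simp only [Set.indicator_apply]; split_ifs <;> simp
  · funext ω; simp only [Set.indicator_apply]; split_ifs <;> simp

lemma sub_K (hf : SRMF μ f) (N : ℕ) (A : Set Ω) (hA : MeasurableSet[Past f N] A) :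
    ∫⁻ ω in A, ENNReal.ofReal (‖KE N (f ω)‖^2) ∂μ ≤ ∫⁻ ω in A, ENNReal.ofReal (‖KE (N+1) (f ω)‖^2) ∂μ := by
  by_cases hp : N.Prime
  · have hV : Measurable[Past f N] (fun ω => (KE N (f ω), FE N (f ω))) := by
      refine past_fun f N (fun a => (KE N a, FE N a)) ((KE_meas N).prodMk (FE_meas N)) fun a => ?_
      have h1 := FE_cut N a 0
      have h2 := KE_cut N a 0
      have e : ∀ b : ℕ → ℂ, twa b 0 = b := fun b => by funext n; simp [twa]
      rw [e, e] at h1 h2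
      rw [h1, h2]
    have := set_step hf.toIsSteinhausRMF hp _ hV (fun q => ENNReal.ofReal (‖q.1.1 * (1 - rN N * q.2)⁻¹ + q.1.2 *
      (Real.log N * (rN N * q.2) * (1 - rN N * q.2)⁻¹ ^ 2)‖^2)) (by fun_prop) A hA
    simp only [KE_succ, if_pos hp]
    rw [this]
    refine lintegral_mono fun ω => ?_
    refine (jensen_hk (rN_nonneg N) (rN_sq_le hp) (KE N (f ω)) (FE N (f ω) * Real.log N)).trans (le_of_eq ?_)
    congr 1; funext z; congr 3; ring
  · simp only [KE_succ, if_neg hp]; exact le_rfl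

lemma sub_F (hf : SRMF μ f) (N : ℕ) (A : Set Ω) (hA : MeasurableSet[Past f N] A) :
    ∫⁻ ω in A, ENNReal.ofReal (‖FE N (f ω)‖^2) ∂μ ≤ ∫⁻ ω in A, ENNReal.ofReal (‖FE (N+1) (f ω)‖^2) ∂μ := by
  by_cases hp : N.Prime
  · have hV : Measurable[Past f N] (fun ω => FE N (f ω)) := FN_meas hf.toIsSteinhausRMF N
    have := set_step hf.toIsSteinhausRMF hp _ hV (fun q => ENNReal.ofReal (‖q.1 * (1 - rN N * q.2)⁻¹‖^2)) (by fun_prop) A hA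
    simp only [FE_succ, if_pos hp]
    rw [this]
    refine lintegral_mono fun ω => ?_
    refine (jensen_hk (rN_nonneg N) (rN_sq_le hp) (FE N (f ω)) 0).trans (le_of_eq ?_)
    congr 1; funext z; congr 3; ring
  · simp only [FE_succ, if_neg hp]; exact le_rfl

/-- the normalized square is a martingale -/
lemma mart_Y (hf : SRMF μ f) (N : ℕ) (A : Set Ω) (hA : MeasurableSet[Past f N] A) :
    ∫⁻ ω in A, ENNReal.ofReal (YN f N ω) ∂μ = ∫⁻ ω in A, ENNReal.ofReal (YN f (N+1) ω) ∂μ := by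
  by_cases hp : N.Prime
  · have := set_step hf.toIsSteinhausRMF hp _ (YN_meas hf.toIsSteinhausRMF N)
      (fun q => ENNReal.ofReal q.1 * ENNReal.ofReal (wP (rN N) q.2))
      ((by fun_prop : Measurable fun q : ℝ × ℂ => ENNReal.ofReal q.1).mul ((wP_meas _).comp measurable_snd).ennreal_ofReal) A hA
    simp only [YN_succ, if_pos hp]
    simp_rw [ENNReal.ofReal_mul (YN_nonneg N _)]
    rw [this]
    congr 1; funext ω
    dsimp only
    rw [lintegral_const_mul' _ _ (by simp), ← ofReal_integral_eq_lintegral_ofReal (wP_int (rN_nonneg N) (rN_sq_le hp))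
        (ae_of_all _ fun z => wP_nonneg (rN_sq_le hp) z), wP_one (rN_nonneg N) (rN_sq_le hp)]
    simp
  · simp only [YN_succ, if_neg hp]

lemma YN_exp (hf : SRMF μ f) (N : ℕ) : ∫⁻ ω, ENNReal.ofReal (YN f N ω) ∂μ = 1 := by
  induction N with
  | zero => simp [YN, FN_zero, LN_zero]
  | succ N ih =>
    have := mart_Y hf N Set.univ MeasurableSet.univ
    simp only [Measure.restrict_univ] at this
    rw [← this, ih]

end doob

section barrier
variable {Ω : Type*} [mΩ : MeasurableSpace Ω] {μ : Measure Ω} [IsProbabilityMeasure μ]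
  {f : Ω → ℕ → ℂ}

lemma K_step {N : ℕ} (hp : N.Prime) (a : ℝ) (ha : 0 < a) (hl : Real.log N ≤ a) (s : ℂ) :
    ∫⁻ z, ENNReal.ofReal (wP (rN N) z * ‖s + Real.log N * (rN N * z) * (1 - rN N * z)⁻¹‖^2) ∂uC ≤
      ENNReal.ofReal (‖s‖^2 * (1 + 2 * (Real.log N / N) / a) + 18 * a * (Real.log N / N)) := by
  set r := rN N with hr_def
  have hr0 : 0 ≤ r := rN_nonneg N
  have hr : r^2 ≤ 1/2 := rN_sq_le hp
  have hrN : r^2 = (N:ℝ)⁻¹ := rN_sq N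
  set L := Real.log N
  have hL : 0 ≤ L := Real.log_natCast_nonneg N
  have h34 := r_lt hr0 hr
  set D : ℂ → ℂ := fun z => L * (r * z) * (1 - r * z)⁻¹
  have hD : Measurable D := by fun_prop
  have hDb : ∀ᵐ z ∂uC, ‖D z‖ ≤ L * r * 4 := by
    filter_upwards [uC_norm] with z hz
    simp only [D]
    rw [norm_mul, norm_mul, norm_mul, Complex.norm_real, Complex.norm_real, Real.norm_of_nonneg hr0, Real.norm_of_nonneg hL, hz, mul_one]
    exact mul_le_mul_of_nonneg_left (uC_ne hr0 hr hz) (by positivity)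
  have hdiff : DiffContOnCl ℂ D (Metric.ball 0 1) := by
    apply DifferentiableOn.diffContOnCl
    rw [closure_ball _ one_ne_zero]
    intro z hz
    have hz : ‖z‖ ≤ 1 := by simpa using hz
    have hne : (1 - r * z) ≠ 0 := by
      intro h
      have h3 : (r:ℂ) * z = 1 := by linear_combination -h
      have h4 : ‖(r:ℂ) * z‖ = 1 := by rw [h3]; simp
      rw [norm_mul, Complex.norm_real, Real.norm_of_nonneg hr0] at h4
      nlinarith [norm_nonneg z]
    have : DifferentiableAt ℂ D z := by
      simp only [D]
      fun_prop (disch := exact hne)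
    exact this.differentiableWithinAt
  have hmean := uC_poisson hr0 hr D hD hdiff
  have iD : Integrable (fun z => wP r z • D z) uC := by
    refine Integrable.of_bound ((wP_meas r).smul hD).aestronglyMeasurable (16 * (L * r * 4)) ?_
    filter_upwards [hDb, wP_bd hr0 hr] with z h1 h2
    rw [norm_smul]; gcongr
  have key : ∀ᵐ z ∂uC, wP r z * ‖s + D z‖^2 ≤ wP r z * (‖s‖^2 + 16 * L^2 * r^2) + 2 * ((starRingEnd ℂ) s * (wP r z • D z)).re := by
    filter_upwards [hDb] with z hz
    have h1 : ‖s + D z‖^2 = ‖s‖^2 + ‖D z‖^2 + 2 * ((starRingEnd ℂ) s * D z).re := by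
      rw [Complex.sq_norm, Complex.normSq_add, Complex.sq_norm, Complex.sq_norm]
      simp
    have h2 : ‖D z‖^2 ≤ 16 * L^2 * r^2 := by
      refine (pow_le_pow_left₀ (norm_nonneg _) hz 2).trans (le_of_eq (by ring))
    have h3 : ((starRingEnd ℂ) s * (wP r z • D z)).re = wP r z * ((starRingEnd ℂ) s * D z).re := by
      rw [Complex.real_smul, mul_left_comm, Complex.re_ofReal_mul]
    rw [h3, h1]
    have := wP_nonneg hr z
    nlinarith
  have i2 : Integrable (fun z => 2 * ((starRingEnd ℂ) s * (wP r z • D z)).re) uC := (iD.const_mul _).re.const_mul 2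
  have i1 : Integrable (fun z => wP r z * (‖s‖^2 + 16 * L^2 * r^2)) uC := (wP_int hr0 hr).mul_const _
  have i12 : Integrable (fun z => wP r z * (‖s‖^2 + 16 * L^2 * r^2) + 2 * ((starRingEnd ℂ) s * (wP r z • D z)).re) uC := i1.add i2
  calc _ ≤ ∫⁻ z, ENNReal.ofReal (wP r z * (‖s‖^2 + 16 * L^2 * r^2) + 2 * ((starRingEnd ℂ) s * (wP r z • D z)).re) ∂uC := by
        refine lintegral_mono_ae ?_
        filter_upwards [key] with z hz
        exact ENNReal.ofReal_le_ofReal hz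
    _ = ENNReal.ofReal (∫ z, (wP r z * (‖s‖^2 + 16 * L^2 * r^2) + 2 * ((starRingEnd ℂ) s * (wP r z • D z)).re) ∂uC) := by
        rw [ofReal_integral_eq_lintegral_ofReal i12]
        filter_upwards [key] with z hz
        exact le_trans (mul_nonneg (wP_nonneg hr z) (by positivity)) hz
    _ ≤ _ := by
        refine ENNReal.ofReal_le_ofReal ?_
        rw [integral_add i1 i2, integral_mul_const, wP_one hr0 hr, integral_const_mul,
          show ∫ z, ((starRingEnd ℂ) s * (wP r z • D z)).re ∂uC = (∫ z, (starRingEnd ℂ) s * (wP r z • D z) ∂uC).re from integral_re (iD.const_mul _),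
          integral_const_mul, hmean]
        have hDr : ‖D r‖ ≤ 2 * (L / N) := by
          simp only [D]
          have : ((L:ℝ):ℂ) * ((r:ℂ) * (r:ℂ)) * (1 - (r:ℂ) * (r:ℂ))⁻¹ = ((L * r^2 * (1 - r^2)⁻¹ : ℝ) : ℂ) := by push_cast; ring
          rw [this, Complex.norm_real, Real.norm_of_nonneg (by
            have : 0 < 1 - r^2 := by linarith
            positivity)]
          have h5 : (1 - r^2)⁻¹ ≤ 2 := by
            rw [inv_le_comm₀ (by linarith) (by norm_num)]; linarith
          calc L * r^2 * (1 - r^2)⁻¹ ≤ L * r^2 * 2 := by gcongr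
            _ = _ := by rw [hrN]; ring
        have h6 : ((starRingEnd ℂ) s * D r).re ≤ ‖s‖ * (2 * (L/N)) := by
          refine (Complex.re_le_norm _).trans ?_
          rw [norm_mul, Complex.norm_conj]; gcongr
        set δ := L / N with hδ
        have hδ0 : 0 ≤ δ := by positivity
        have h7 : L^2 * r^2 ≤ a * δ := by
          rw [hrN, hδ]
          have : L^2 * (N:ℝ)⁻¹ = L * (L / N) := by ring
          rw [this]; gcongr
        have h8 : ‖s‖ * (2 * δ) ≤ δ * (‖s‖^2 / a + a) := by
          have : 2 * ‖s‖ ≤ ‖s‖^2 / a + a := by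
            rw [← sub_nonneg]
            have : ‖s‖^2 / a + a - 2 * ‖s‖ = (‖s‖ - a)^2 / a := by field_simp; ring
            rw [this]; positivity
          nlinarith
        have h9 : ‖s‖^2 * (1 + 2 * δ / a) = ‖s‖^2 + 2 * δ * (‖s‖^2 / a) := by ring
        rw [h9]
        nlinarith

lemma E_K (hf : SRMF μ f) (a : ℝ) (ha : 0 < a) (N : ℕ) (hN : Real.log N ≤ a) :
    ∫⁻ ω, ENNReal.ofReal (YN f N ω * ‖SE N (f ω)‖^2) ∂μ ≤
      ENNReal.ofReal (Real.exp (2 * (∑ p ∈ N.primesBelow, Real.log p / p) / a) * (18 * a * ∑ p ∈ N.primesBelow, Real.log p / p)) := by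
  induction N with
  | zero => simp [SE, Nat.primesBelow]
  | succ N ih =>
    have hN' : Real.log N ≤ a := by
      refine le_trans ?_ hN
      rcases Nat.eq_zero_or_pos N with h | h
      · subst h; simp
      · exact Real.log_le_log (by exact_mod_cast h) (by push_cast; linarith)
    have ih := ih hN'
    by_cases hp : N.Prime
    · set sg := ∑ p ∈ N.primesBelow, Real.log p / p with hS
      have hS0 : 0 ≤ sg := Finset.sum_nonneg fun p _ => div_nonneg (Real.log_natCast_nonneg p) (by positivity)
      have e1 : ∑ p ∈ (N+1).primesBelow, Real.log p / p = sg + Real.log N / N := by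
        rw [Nat.primesBelow_succ, if_pos hp, Finset.sum_insert (by simp [Nat.primesBelow]), add_comm]
      rw [e1]
      set δ := Real.log N / N
      have hδ0 : 0 ≤ δ := div_nonneg (Real.log_natCast_nonneg N) (by positivity)
      have hV : Measurable[Past f N] (fun ω => (YN f N ω, SE N (f ω))) := by
        refine Measurable.prodMk (YN_meas hf.toIsSteinhausRMF N) ?_
        refine past_fun f N (SE N) (SE_meas N) fun a => ?_
        have h1 := SE_cut N a 0
        have e : ∀ b : ℕ → ℂ, twa b 0 = b := fun b => by funext n; simp [twa]
        rwa [e, e] at h1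
      have st := lintegral_step' hf.toIsSteinhausRMF hp _ hV (fun q => ENNReal.ofReal q.1.1 * ENNReal.ofReal
        (wP (rN N) q.2 * ‖q.1.2 + Real.log N * (rN N * q.2) * (1 - rN N * q.2)⁻¹‖^2)) (by
          refine Measurable.mul (by fun_prop) (Measurable.ennreal_ofReal ?_)
          exact ((wP_meas _).comp measurable_snd).mul (by fun_prop))
      have e2 : ∀ ω, ENNReal.ofReal (YN f (N+1) ω * ‖SE (N+1) (f ω)‖^2) = ENNReal.ofReal (YN f N ω) * ENNReal.ofReal
        (wP (rN N) (f ω N) * ‖SE N (f ω) + Real.log N * (rN N * f ω N) * (1 - rN N * f ω N)⁻¹‖^2) := by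
        intro ω
        rw [YN_succ, SE_succ, if_pos hp, if_pos hp, mul_assoc, ENNReal.ofReal_mul (YN_nonneg N ω)]
      simp_rw [e2]
      refine (le_of_eq st).trans ?_
      have e3 : ∀ ω, ∫⁻ z, ENNReal.ofReal (YN f N ω) * ENNReal.ofReal
        (wP (rN N) z * ‖SE N (f ω) + Real.log N * (rN N * z) * (1 - rN N * z)⁻¹‖^2) ∂uC ≤
        ENNReal.ofReal (1 + 2 * δ / a) * ENNReal.ofReal (YN f N ω * ‖SE N (f ω)‖^2) + ENNReal.ofReal (18 * a * δ) * ENNReal.ofReal (YN f N ω) := by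
        intro ω
        rw [lintegral_const_mul' _ _ (by simp)]
        refine (mul_le_mul_right (K_step hp a ha hN' (SE N (f ω))) _).trans (le_of_eq ?_)
        have hy := YN_nonneg (f := f) N ω
        rw [← ENNReal.ofReal_mul hy, ← ENNReal.ofReal_mul (by positivity), ← ENNReal.ofReal_mul (by positivity),
          ← ENNReal.ofReal_add (by positivity) (by positivity)]
        congr 1
        simp only [δ]; ring
      refine (lintegral_mono e3).trans ?_
      have m1 : Measurable (fun ω => ENNReal.ofReal (YN f N ω)) :=
        ((YN_meas hf.toIsSteinhausRMF N).mono (Past_le hf.toIsSteinhausRMF N) le_rfl).ennreal_ofReal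
      rw [lintegral_add_right _ (m1.const_mul _), lintegral_const_mul' _ _ (by simp), lintegral_const_mul' _ _ (by simp), YN_exp hf, mul_one]
      refine (add_le_add (mul_le_mul_right ih _) le_rfl).trans ?_
      rw [← ENNReal.ofReal_mul (by positivity), ← ENNReal.ofReal_add (by positivity) (by positivity)]
      refine ENNReal.ofReal_le_ofReal ?_
      have h1 : Real.exp (2 * (sg + δ) / a) = Real.exp (2 * δ / a) * Real.exp (2 * sg / a) := by
        rw [← Real.exp_add]; congr 1; ring
      have h2 := Real.add_one_le_exp (2 * δ / a)
      have h3 : 1 ≤ Real.exp (2 * (sg + δ) / a) := Real.one_le_exp (by positivity)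
      have h4 : Real.exp (2 * (sg + δ) / a) * (18 * a * (sg + δ)) = Real.exp (2 * δ / a) * (Real.exp (2 * sg / a) * (18 * a * sg))
        + Real.exp (2 * (sg + δ) / a) * (18 * a * δ) := by
        rw [mul_add (18 * a), mul_add]; congr 1; rw [h1]; ring
      rw [h4]
      refine add_le_add ?_ ?_
      · refine mul_le_mul_of_nonneg_right (by linarith) (by positivity)
      · have : 0 ≤ 18 * a * δ := by positivity
        nlinarith
    · have e1 : (N+1).primesBelow = N.primesBelow := by rw [Nat.primesBelow_succ, if_neg hp]
      simp only [YN_succ, SE_succ, if_neg hp, e1]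
      exact ih

lemma E_K' (hf : SRMF μ f) (a : ℝ) (ha : 1 ≤ a) (N : ℕ) (h1N : 1 ≤ N) (hN : Real.log N ≤ a) :
    ∫⁻ ω, ENNReal.ofReal (‖KE N (f ω)‖^2) ∂μ ≤ ENNReal.ofReal (LN N * (54 * Real.exp 6 * a^2)) := by
  have h := E_K hf a (by linarith) N hN
  have hs := sum_log_prime_div N h1N
  set sg := ∑ p ∈ N.primesBelow, Real.log p / p with hS
  have hS0 : 0 ≤ sg := Finset.sum_nonneg fun p _ => div_nonneg (Real.log_natCast_nonneg p) (by positivity)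
  have hL := LN_pos N
  have e : ∀ ω, ENNReal.ofReal (‖KE N (f ω)‖^2) = ENNReal.ofReal (LN N) * ENNReal.ofReal (YN f N ω * ‖SE N (f ω)‖^2) := by
    intro ω
    rw [← ENNReal.ofReal_mul hL.le]
    congr 1
    unfold YN KE
    rw [FN_eq, norm_mul]
    field_simp
  simp_rw [e]
  rw [lintegral_const_mul' _ _ (by simp), ENNReal.ofReal_mul hL.le]
  refine mul_le_mul_right (h.trans (ENNReal.ofReal_le_ofReal ?_)) _
  have h3 : sg ≤ 3 * a := by linarith
  have h4 : 2 * sg / a ≤ 6 := by rw [div_le_iff₀ (by linarith)]; linarith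
  calc _ ≤ Real.exp 6 * (18 * a * (3 * a)) := by gcongr
    _ = _ := by ring

lemma E_F (hf : SRMF μ f) (N : ℕ) : ∫⁻ ω, ENNReal.ofReal (‖FE N (f ω)‖^2) ∂μ = ENNReal.ofReal (LN N) := by
  have hL := LN_pos N
  have e : ∀ ω, ENNReal.ofReal (‖FE N (f ω)‖^2) = ENNReal.ofReal (LN N) * ENNReal.ofReal (YN f N ω) := by
    intro ω
    rw [← ENNReal.ofReal_mul hL.le]
    congr 1
    unfold YN
    rw [FN_eq]; field_simp
  simp_rw [e]
  rw [lintegral_const_mul' _ _ (by simp), YN_exp hf, mul_one]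

/-- Sobolev -/
lemma sobolev (F F' : ℝ → ℂ) (hF : ∀ t, HasDerivAt F (F' t) t) (hc : Continuous F') (A T : ℝ) (hA : 0 < A) (hT : 1/2 ≤ T)
    (t : ℝ) (ht : t ∈ Set.Icc (-T) T) :
    ‖F t‖^2 ≤ ∫ s in (-T)..T, ((1 + A) * ‖F s‖^2 + ‖F' s‖^2 / A) := by
  have cF : Continuous F := continuous_iff_continuousAt.2 fun t => (hF t).continuousAt
  set φ : ℝ → ℝ := fun s => A * ‖F s‖^2 + ‖F' s‖^2 / A
  have cφ : Continuous φ := by fun_prop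
  have hφ : ∀ s, 0 ≤ φ s := fun s => by positivity
  set g' : ℝ → ℝ := fun s => 2 * inner ℝ (F s) (F' s)
  have hg : ∀ s, HasDerivAt (fun s => ‖F s‖^2) (g' s) s := fun s => (hF s).norm_sq
  have cg' : Continuous g' := by fun_prop
  have hgφ : ∀ s, |g' s| ≤ φ s := by
    intro s
    simp only [g', φ]
    rw [abs_mul, abs_two]
    have h1 := abs_real_inner_le_norm (F s) (F' s)
    have : 2 * (‖F s‖ * ‖F' s‖) ≤ A * ‖F s‖^2 + ‖F' s‖^2 / A := by
      rw [← sub_nonneg]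
      have : A * ‖F s‖^2 + ‖F' s‖^2 / A - 2 * (‖F s‖ * ‖F' s‖) = (A * ‖F s‖ - ‖F' s‖)^2 / A := by field_simp; ring
      rw [this]; positivity
    linarith
  set Φ := ∫ s in (-T)..T, φ s
  have hΦ : 0 ≤ Φ := intervalIntegral.integral_nonneg (by linarith) fun s _ => hφ s
  have step : ∀ s ∈ Set.Icc (-T) T, ‖F t‖^2 ≤ ‖F s‖^2 + Φ := by
    intro s hs
    have h1 := intervalIntegral.integral_eq_sub_of_hasDerivAt (a := s) (b := t) (fun x _ => hg x) (cg'.intervalIntegrable _ _)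
    have h2 : |∫ x in s..t, g' x| ≤ Φ := by
      calc |∫ x in s..t, g' x| ≤ abs (∫ x in s..t, abs (g' x)) := intervalIntegral.norm_integral_le_abs_integral_norm (f := g')
        _ ≤ abs (∫ x in (-T)..T, abs (g' x)) := by
            refine intervalIntegral.abs_integral_mono_interval ?_ (ae_of_all _ fun x => abs_nonneg _) (cg'.abs.intervalIntegrable _ _)
            rw [Set.uIoc, Set.uIoc]
            refine Set.Ioc_subset_Ioc ?_ ?_
            · rw [min_eq_left (by linarith : -T ≤ T)]; exact le_min hs.1 ht.1
            · rw [max_eq_right (by linarith : -T ≤ T)]; exact max_le hs.2 ht.2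
        _ = ∫ x in (-T)..T, |g' x| := abs_of_nonneg (intervalIntegral.integral_nonneg (by linarith) fun s _ => abs_nonneg _)
        _ ≤ Φ := intervalIntegral.integral_mono_on (by linarith) (cg'.abs.intervalIntegrable _ _) (cφ.intervalIntegrable _ _) fun s _ => hgφ s
    have := le_abs_self (∫ x in s..t, g' x)
    linarith
  have c1 : IntervalIntegrable (fun s => ‖F s‖^2) volume (-T) T := (by fun_prop : Continuous fun s => ‖F s‖^2).intervalIntegrable _ _
  have c2 : IntervalIntegrable (fun s : ℝ => Φ) volume (-T) T := continuous_const.intervalIntegrable _ _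
  have c3 : IntervalIntegrable (fun s : ℝ => ‖F t‖^2) volume (-T) T := continuous_const.intervalIntegrable _ _
  have h3 : ∫ s in (-T)..T, ‖F t‖^2 ≤ ∫ s in (-T)..T, (‖F s‖^2 + Φ) := intervalIntegral.integral_mono_on (by linarith) c3 (c1.add c2) step
  rw [intervalIntegral.integral_const, intervalIntegral.integral_add c1 c2, intervalIntegral.integral_const] at h3
  have h4 : ∫ s in (-T)..T, ((1 + A) * ‖F s‖^2 + ‖F' s‖^2 / A) = (∫ s in (-T)..T, ‖F s‖^2) + Φ := by
    rw [← intervalIntegral.integral_add c1 (cφ.intervalIntegrable _ _)]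
    congr 1; funext s; simp only [φ]; ring
  rw [h4]
  have h5 : 0 ≤ ∫ s in (-T)..T, ‖F s‖^2 := intervalIntegral.integral_nonneg (by linarith) fun s _ => by positivity
  simp only [smul_eq_mul] at h3
  set J := ∫ s in (-T)..T, ‖F s‖^2
  have h6 : (2 * T) * (‖F t‖^2 - Φ) ≤ J := by linarith
  by_contra hcon
  push Not at hcon
  nlinarith

end barrier

section barrier
variable {Ω : Type*} [mΩ : MeasurableSpace Ω] {μ : Measure Ω} [IsProbabilityMeasure μ]
  {f : Ω → ℕ → ℂ}

/-- unimodular at primes -/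
def Uni (a : ℕ → ℂ) : Prop := ∀ p, p.Prime → ‖a p‖ = 1

lemma twa_norm {a : ℕ → ℂ} (ha : Uni a) (t : ℝ) {p : ℕ} (hp : p.Prime) : ‖twa a t p‖ = 1 := by
  unfold twa
  rw [norm_mul, ha p hp, one_mul, Complex.norm_natCast_cpow_of_pos hp.pos]
  simp

lemma twa_den {a : ℕ → ℂ} (ha : Uni a) (t : ℝ) {p : ℕ} (hp : p.Prime) : (1 - (rN p : ℂ) * twa a t p) ≠ 0 := by
  intro h
  have h1 := nrm_lb (rN_nonneg p) (twa_norm ha t hp)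
  have h2 := r_lt (rN_nonneg p) (rN_sq_le hp)
  rw [h, norm_zero] at h1
  linarith

lemma twa_deriv (a : ℕ → ℂ) (t : ℝ) {p : ℕ} (hp : p.Prime) :
    HasDerivAt (fun t : ℝ => twa a t p) (-Complex.I * (Real.log p * twa a t p)) t := by
  unfold twa
  have h0 : (p:ℂ) ≠ 0 := by exact_mod_cast hp.ne_zero
  have h1 : HasDerivAt (fun t : ℂ => -(t * Complex.I)) (-(1 * Complex.I)) (t:ℂ) :=
    ((hasDerivAt_id (t:ℂ)).mul_const Complex.I).neg
  have h2 := ((h1.const_cpow (c := (p:ℂ)) (Or.inl h0)).const_mul (a p)).comp_ofReal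
  convert h2 using 1
  rw [Complex.natCast_log]
  ring

lemma FE_deriv {a : ℕ → ℂ} (ha : Uni a) (N : ℕ) (t : ℝ) :
    HasDerivAt (fun t : ℝ => FE N (twa a t)) (-Complex.I * KE N (twa a t)) t := by
  induction N with
  | zero => 
    have e : ∀ b, KE 0 b = 0 := by intro b; simp [KE, SE, Nat.primesBelow]
    have e2 : ∀ b, FE 0 b = 1 := by intro b; simp [FE, Nat.primesBelow]
    simp only [e, e2, mul_zero]
    exact hasDerivAt_const _ _
  | succ N ih =>
    by_cases hp : N.Prime
    · simp only [FE_succ, KE_succ, if_pos hp]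
      have h1 := (((twa_deriv a t hp).const_mul (rN N : ℂ)).const_sub 1).inv (twa_den ha t hp)
      have h2 := ih.mul h1
      refine HasDerivAt.congr_deriv h2 ?_
      have := twa_den ha t hp
      simp only [Pi.inv_apply]
      field_simp
      ring
    · simp only [FE_succ, KE_succ, if_neg hp]
      exact ih

lemma twa_cont (a : ℕ → ℂ) {p : ℕ} (hp : p.Prime) : Continuous (fun t : ℝ => twa a t p) :=
  continuous_iff_continuousAt.2 fun t => (twa_deriv a t hp).continuousAt

lemma FE_cont {a : ℕ → ℂ} (ha : Uni a) (N : ℕ) : Continuous (fun t : ℝ => FE N (twa a t)) :=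
  continuous_iff_continuousAt.2 fun t => (FE_deriv ha N t).continuousAt

lemma KE_cont {a : ℕ → ℂ} (ha : Uni a) (N : ℕ) : Continuous (fun t : ℝ => KE N (twa a t)) := by
  unfold KE
  refine (FE_cont ha N).mul ?_
  unfold SE
  refine continuous_finset_sum _ fun p hp => ?_
  have hp := Nat.prime_of_mem_primesBelow hp
  have h1 := twa_cont a hp
  refine Continuous.mul (by fun_prop) (Continuous.inv₀ (by fun_prop) fun t => twa_den ha t hp)

def HI (A T : ℝ) (N : ℕ) (a : ℕ → ℂ) : ENNReal :=
  ∫⁻ t in Set.Icc (-T) T, ENNReal.ofReal ((1 + A) * ‖FE N (twa a t)‖^2 + ‖KE N (twa a t)‖^2 / A)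

lemma HI_sup {A T : ℝ} (hA : 0 < A) (hT : 1/2 ≤ T) (N : ℕ) {a : ℕ → ℂ} (ha : Uni a) (t : ℝ) (ht : t ∈ Set.Icc (-T) T) :
    ENNReal.ofReal (‖FE N (twa a t)‖^2) ≤ HI A T N a := by
  have cF := FE_cont ha N
  have cK := KE_cont ha N
  have h := sobolev (fun t => FE N (twa a t)) (fun t => -Complex.I * KE N (twa a t)) (FE_deriv ha N) (by fun_prop) A T hA hT t ht
  refine (ENNReal.ofReal_le_ofReal h).trans ?_
  simp only [norm_mul, norm_neg, Complex.norm_I, one_mul]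
  rw [intervalIntegral.integral_of_le (by linarith), ofReal_integral_eq_lintegral_ofReal]
  · exact lintegral_mono_set Set.Ioc_subset_Icc_self
  · have c : Continuous fun x => (1 + A) * ‖FE N (twa a x)‖ ^ 2 + ‖KE N (twa a x)‖ ^ 2 / A := by fun_prop
    exact (c.integrableOn_Icc).mono_set Set.Ioc_subset_Icc_self
  · exact ae_of_all _ fun x => by positivity

lemma HIpair_meas (A : ℝ) (N : ℕ) : Measurable (fun q : (ℕ → ℂ) × ℝ => ENNReal.ofReal ((1 + A) * ‖FE N (twa q.1 q.2)‖^2 + ‖KE N (twa q.1 q.2)‖^2 / A)) := by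
  have h1 := (FE_meas N).comp twa_meas
  have h2 := (KE_meas N).comp twa_meas
  simp only [Function.comp_def] at h1 h2
  fun_prop

lemma HI_meas (A T : ℝ) (N : ℕ) : Measurable (HI A T N) := by
  unfold HI
  exact Measurable.lintegral_prod_right' (HIpair_meas A N)

lemma HI_past (hf : SRMF μ f) (A T : ℝ) (N : ℕ) : Measurable[Past f N] (fun ω => HI A T N (f ω)) := by
  refine past_fun f N (HI A T N) (HI_meas A T N) fun a => ?_
  unfold HI
  simp only [FE_cut, KE_cut]

lemma uni_f (hf : SRMF μ f) (ω : Ω) : Uni (f ω) := fun p hp => hf.norm_one ω p hp.one_le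

lemma sub_Ft (hf : SRMF μ f) (t : ℝ) (N : ℕ) (A : Set Ω) (hA : MeasurableSet[Past f N] A) :
    ∫⁻ ω in A, ENNReal.ofReal (‖FE N (twa (f ω) t)‖^2) ∂μ ≤ ∫⁻ ω in A, ENNReal.ofReal (‖FE (N+1) (twa (f ω) t)‖^2) ∂μ :=
  sub_F (tw_SRMF hf t) N A (by rwa [Past_tw_eq hf t N])

lemma sub_Kt (hf : SRMF μ f) (t : ℝ) (N : ℕ) (A : Set Ω) (hA : MeasurableSet[Past f N] A) :
    ∫⁻ ω in A, ENNReal.ofReal (‖KE N (twa (f ω) t)‖^2) ∂μ ≤ ∫⁻ ω in A, ENNReal.ofReal (‖KE (N+1) (twa (f ω) t)‖^2) ∂μ :=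
  sub_K (tw_SRMF hf t) N A (by rwa [Past_tw_eq hf t N])

lemma FEt_meas (hf : SRMF μ f) (N : ℕ) (t : ℝ) : Measurable (fun ω => FE N (twa (f ω) t)) :=
  (FE_meas N).comp (twa_meas.comp ((seq_meas hf.toIsSteinhausRMF).prodMk measurable_const))

lemma KEt_meas (hf : SRMF μ f) (N : ℕ) (t : ℝ) : Measurable (fun ω => KE N (twa (f ω) t)) :=
  (KE_meas N).comp (twa_meas.comp ((seq_meas hf.toIsSteinhausRMF).prodMk measurable_const))

lemma HI_split (hf : SRMF μ f) {A : ℝ} (hA : 0 < A) (N : ℕ) (t : ℝ) (S : Set Ω) :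
    ∫⁻ ω in S, ENNReal.ofReal ((1 + A) * ‖FE N (twa (f ω) t)‖^2 + ‖KE N (twa (f ω) t)‖^2 / A) ∂μ =
     ENNReal.ofReal (1+A) * ∫⁻ ω in S, ENNReal.ofReal (‖FE N (twa (f ω) t)‖^2) ∂μ + 
     ENNReal.ofReal (A⁻¹) * ∫⁻ ω in S, ENNReal.ofReal (‖KE N (twa (f ω) t)‖^2) ∂μ := by
  have m1 := FEt_meas hf N t
  have m2 := KEt_meas hf N t
  rw [← lintegral_const_mul' _ _ (by simp), ← lintegral_const_mul' _ _ (by simp), ← lintegral_add_left (by fun_prop)]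
  congr 1; funext ω
  rw [ENNReal.ofReal_add (by positivity) (by positivity), ENNReal.ofReal_mul (by positivity), div_eq_inv_mul, ENNReal.ofReal_mul (by positivity)]

lemma HI_sub (hf : SRMF μ f) {A : ℝ} (hA : 0 < A) (T : ℝ) (N : ℕ) (S : Set Ω) (hS : MeasurableSet[Past f N] S) :
    ∫⁻ ω in S, HI A T N (f ω) ∂μ ≤ ∫⁻ ω in S, HI A T (N+1) (f ω) ∂μ := by
  refine sub_int hf.toIsSteinhausRMF _ _ _ (HIpair_meas A N) (HIpair_meas A (N+1)) S fun t => ?_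
  simp only
  rw [HI_split hf hA, HI_split hf hA]
  exact add_le_add (mul_le_mul_right (sub_Ft hf t N S hS) _) (mul_le_mul_right (sub_Kt hf t N S hS) _)

lemma HI_exp (hf : SRMF μ f) {A : ℝ} (hA : 1 ≤ A) {T : ℝ} (hT : 0 ≤ T) {N : ℕ} (hN : 1 ≤ N) (hNA : Real.log N ≤ A) :
    ∫⁻ ω, HI A T N (f ω) ∂μ ≤ ENNReal.ofReal (2 * T * (LN N * A * (2 + 54 * Real.exp 6))) := by
  have h := swap_int hf.toIsSteinhausRMF (volume.restrict (Set.Icc (-T) T)) _ (HIpair_meas A N) Set.univ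
  simp only [Measure.restrict_univ] at h
  unfold HI
  rw [h]
  have hL := LN_pos N
  have key : ∀ t : ℝ, ∫⁻ ω, ENNReal.ofReal ((1 + A) * ‖FE N (twa (f ω) t)‖^2 + ‖KE N (twa (f ω) t)‖^2 / A) ∂μ ≤ ENNReal.ofReal (LN N * A * (2 + 54 * Real.exp 6)) := by
    intro t
    have h1 := HI_split hf (by linarith : 0 < A) N t Set.univ
    simp only [Measure.restrict_univ] at h1
    rw [h1]
    have e1 : ∫⁻ ω, ENNReal.ofReal (‖FE N (twa (f ω) t)‖^2) ∂μ = _ := E_F (tw_SRMF hf t) N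
    have e2 : ∫⁻ ω, ENNReal.ofReal (‖KE N (twa (f ω) t)‖^2) ∂μ ≤ _ := E_K' (tw_SRMF hf t) A hA N hN hNA
    rw [e1]
    refine (add_le_add le_rfl (mul_le_mul_right e2 _)).trans ?_
    rw [← ENNReal.ofReal_mul (by positivity), ← ENNReal.ofReal_mul (by positivity), ← ENNReal.ofReal_add (by positivity) (by positivity)]
    refine ENNReal.ofReal_le_ofReal ?_
    have : A⁻¹ * (LN N * (54 * Real.exp 6 * A^2)) = LN N * A * (54 * Real.exp 6) := by field_simp
    rw [this]
    nlinarith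
  refine (lintegral_mono key).trans ?_
  rw [lintegral_const, Measure.restrict_apply_univ, Real.volume_Icc, mul_comm, ← ENNReal.ofReal_mul (by linarith)]
  refine ENNReal.ofReal_le_ofReal (le_of_eq (by ring))

end barrier

section barrier
variable {Ω : Type*} [mΩ : MeasurableSpace Ω] {μ : Measure Ω} [IsProbabilityMeasure μ]
  {f : Ω → ℕ → ℂ}

lemma ofReal_div_bd {a b : ℝ} (ha : 0 < a) {m : ENNReal} (h : ENNReal.ofReal a * m ≤ ENNReal.ofReal b) : m ≤ ENNReal.ofReal (b / a) := by
  rw [ENNReal.ofReal_div_of_pos ha]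
  rw [ENNReal.le_div_iff_mul_le (Or.inl (by simpa using ha)) (Or.inl (by simp)), mul_comm]
  exact h

def Nk (k : ℕ) : ℕ := 2^(2^k)

lemma Nk_log (k : ℕ) : Real.log (Nk k) = 2^k * Real.log 2 := by
  unfold Nk; push_cast; rw [Real.log_pow]; push_cast; rfl

lemma Nk_mono {j k : ℕ} (h : j ≤ k) : Nk j ≤ Nk k :=
  Nat.pow_le_pow_right (by norm_num) (Nat.pow_le_pow_right (by norm_num) h)

lemma Nk_zero : Nk 0 = 2 := rfl

lemma Nk_two (k : ℕ) : 2 ≤ Nk k := Nk_mono (Nat.zero_le k)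

lemma Nk_block (K M : ℕ) (h2 : 2 ≤ M) (hM : M ≤ Nk K) (hK : 1 ≤ K) : ∃ k < K, Nk k ≤ M ∧ M ≤ Nk (k+1) := by
  induction K with
  | zero => omega
  | succ K ih =>
    by_cases h : M ≤ Nk K
    · rcases Nat.eq_zero_or_pos K with h0 | h0
      · subst h0; rw [Nk_zero] at h
        have : M = 2 := by omega
        subst this
        exact ⟨0, by omega, le_refl _, Nk_two 1⟩
      · obtain ⟨k, hk, h1⟩ := ih h h0
        exact ⟨k, by omega, h1⟩
    · exact ⟨K, by omega, by omega, hM⟩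

def BadK (f : Ω → ℕ → ℂ) (T B : ℝ) (k : ℕ) : Set Ω :=
  {ω | ∃ N, Nk k ≤ N ∧ N ≤ Nk (k+1) ∧ ENNReal.ofReal (Real.exp (2*B) * (Real.log (Nk k))^2) ≤ HI (Real.log (Nk (k+1))) T N (f ω)}

lemma BadK_meas (hf : SRMF μ f) (T B : ℝ) (k : ℕ) : MeasurableSet[Past f (Nk (k+1))] (BadK f T B k) := by
  have e : BadK f T B k = ⋃ N, ⋃ (_ : Nk k ≤ N), ⋃ (_ : N ≤ Nk (k+1)), {ω | ENNReal.ofReal (Real.exp (2*B) * (Real.log (Nk k))^2) ≤ HI (Real.log (Nk (k+1))) T N (f ω)} := by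
    ext ω; simp only [BadK, Set.mem_setOf_eq, Set.mem_iUnion, exists_prop]
  rw [e]
  refine MeasurableSet.iUnion fun N => MeasurableSet.iUnion fun _ => MeasurableSet.iUnion fun h2 => ?_
  refine Past_mono f h2 _ ?_
  exact (HI_past hf _ T N) measurableSet_Ici

lemma BadK_prob (hf : SRMF μ f) : ∃ C : ℝ, 0 < C ∧ ∀ (T B : ℝ) (k : ℕ), 0 ≤ T → μ (BadK f T B k) ≤ ENNReal.ofReal (C * T * Real.exp (-(2*B))) := by
  obtain ⟨C, hC, hLN⟩ := LN_le
  refine ⟨8 * C * (2 + 54 * Real.exp 6), by positivity, fun T B k hT => ?_⟩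
  have l2 : 0 < Real.log 2 := Real.log_pos (by norm_num)
  set a := Real.log (Nk k) with ha
  have ha0 : 0 < a := by rw [ha, Nk_log]; positivity
  have haa : Real.log (Nk (k+1)) = 2 * a := by rw [ha, Nk_log, Nk_log]; ring
  have h1 : 1 ≤ Real.log (Nk (k+1)) := by
    rw [Nk_log]
    have : (2:ℝ) ≤ 2^(k+1) := by
      calc (2:ℝ) = 2^1 := by norm_num
        _ ≤ _ := pow_le_pow_right₀ (by norm_num) (by omega)
    nlinarith [Real.log_two_gt_d9]
  have hd := doob hf.toIsSteinhausRMF (fun N ω => HI (Real.log (Nk (k+1))) T N (f ω)) (Nk k) (fun N => HI_past hf _ T N)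
    (fun N _ S hS => HI_sub hf (by linarith) T N S hS) Set.univ MeasurableSet.univ (ENNReal.ofReal (Real.exp (2*B) * a^2)) (Nk (k+1)) (Nk_mono (by omega))
  rw [Set.univ_inter, Measure.restrict_univ] at hd
  have hd2 := hd.trans (HI_exp hf h1 hT (le_trans (by norm_num) (Nk_two (k+1))) le_rfl)
  have hd3 := ofReal_div_bd (by positivity) hd2
  refine hd3.trans (ENNReal.ofReal_le_ofReal ?_)
  rw [div_le_iff₀ (by positivity)]
  have h3 := hLN (Nk (k+1)) (Nk_two _)
  rw [haa] at h3 ⊢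
  have e : Real.exp (-(2*B)) * Real.exp (2*B) = 1 := by rw [← Real.exp_add]; simp
  calc 2 * T * (LN (Nk (k+1)) * (2*a) * (2 + 54 * Real.exp 6)) ≤ 2 * T * ((C * (2*a)) * (2*a) * (2 + 54 * Real.exp 6)) := by gcongr
    _ = 8 * C * (2 + 54 * Real.exp 6) * T * (Real.exp (-(2*B)) * Real.exp (2*B)) * a^2 := by rw [e]; ring
    _ = _ := by ring

def GoodK (f : Ω → ℕ → ℂ) (T B : ℝ) (K : ℕ) : Set Ω := (⋃ k ∈ Finset.range K, BadK f T B k)ᶜ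

lemma GoodK_meas (hf : SRMF μ f) (T B : ℝ) (K : ℕ) : MeasurableSet[Past f (Nk K)] (GoodK f T B K) := by
  unfold GoodK
  refine MeasurableSet.compl (Finset.measurableSet_biUnion _ fun k hk => ?_)
  have : k < K := by simpa using hk
  exact Past_mono f (Nk_mono (by omega)) _ (BadK_meas hf T B k)

lemma GoodK_prob (hf : SRMF μ f) : ∃ C : ℝ, 0 < C ∧ ∀ (T B : ℝ) (K : ℕ), 0 ≤ T → μ (GoodK f T B K)ᶜ ≤ ENNReal.ofReal (K * (C * T * Real.exp (-(2*B)))) := by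
  obtain ⟨C, hC, h⟩ := BadK_prob hf
  refine ⟨C, hC, fun T B K hT => ?_⟩
  unfold GoodK
  rw [compl_compl]
  refine (measure_biUnion_finset_le _ _).trans ?_
  refine (Finset.sum_le_sum fun k _ => h T B k hT).trans ?_
  rw [Finset.sum_const, Finset.card_range, nsmul_eq_mul, ← ENNReal.ofReal_natCast, ← ENNReal.ofReal_mul (by positivity)]

lemma FE_two (M : ℕ) (hM : M ≤ 2) (a : ℕ → ℂ) : FE M a = 1 := by
  unfold FE
  refine Finset.prod_eq_one fun p hp => ?_
  have := (Nat.prime_of_mem_primesBelow hp).two_le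
  have := Nat.lt_of_mem_primesBelow hp
  omega

lemma GoodK_bd (hf : SRMF μ f) {T B : ℝ} (hT : 1/2 ≤ T) (hB : 0 ≤ B) {K : ℕ} (hK : 1 ≤ K) {ω : Ω} (hω : ω ∈ GoodK f T B K) (M : ℕ)
    (hM : M ≤ Nk K) (t : ℝ) (ht : t ∈ Set.Icc (-T) T) : ‖FE M (twa (f ω) t)‖ ≤ Real.exp B * LN M := by
  by_cases h2 : M ≤ 2
  · rw [FE_two M h2, norm_one]
    have := one_le_LN M
    have := Real.one_le_exp hB
    nlinarith
  push Not at h2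
  obtain ⟨k, hk, h3, h4⟩ := Nk_block K M (by omega) hM hK
  have l2 : 0 < Real.log 2 := Real.log_pos (by norm_num)
  have hnb : ω ∉ BadK f T B k := by
    intro hb
    apply hω
    simp only [Set.mem_iUnion]
    exact ⟨k, by simpa using hk, hb⟩
  have h5 : HI (Real.log (Nk (k+1))) T M (f ω) < ENNReal.ofReal (Real.exp (2*B) * (Real.log (Nk k))^2) := by
    by_contra hc
    push Not at hc
    exact hnb ⟨M, h3, h4, hc⟩
  have h6 := (HI_sup (A := Real.log (Nk (k+1))) (by rw [Nk_log]; positivity) hT M (uni_f hf ω) t ht).trans_lt h5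
  have h7 := (ENNReal.ofReal_lt_ofReal_iff (by rw [Nk_log]; positivity)).1 h6
  have h8 : Real.log (Nk k) ≤ LN M := by
    refine le_trans ?_ (log_le_LN M (by omega))
    exact Real.log_le_log (by have := Nk_two k; positivity) (by exact_mod_cast h3)
  have h9 : 0 ≤ Real.log (Nk k) := Real.log_natCast_nonneg _
  refine abs_le_of_sq_le_sq' ?_ (by have := LN_pos M; positivity) |>.2
  calc _ ≤ Real.exp (2*B) * (Real.log (Nk k))^2 := h7.le
    _ ≤ Real.exp (2*B) * (LN M)^2 := by gcongr
    _ = _ := by rw [mul_pow, ← Real.exp_nat_mul]; norm_num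

/-- weight -/
def wt (t : ℝ) : ℝ := (1/4 + t^2)⁻¹

def WN (N : ℕ) (a : ℕ → ℂ) : ENNReal := ∫⁻ t : ℝ, ENNReal.ofReal (wt t) * ENNReal.ofReal (‖FE N (twa a t)‖^2 / LN N)

lemma wt_meas : Measurable wt := by unfold wt; fun_prop

lemma wt_pos (t : ℝ) : 0 < wt t := by unfold wt; positivity

lemma WNpair_meas (N : ℕ) : Measurable (fun q : (ℕ → ℂ) × ℝ => ENNReal.ofReal (wt q.2) * ENNReal.ofReal (‖FE N (twa q.1 q.2)‖^2 / LN N)) := by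
  have h1 := (FE_meas N).comp twa_meas
  have h2 := wt_meas
  simp only [Function.comp_def] at h1
  fun_prop

lemma WN_past (hf : SRMF μ f) (N : ℕ) : Measurable[Past f N] (fun ω => WN N (f ω)) := by
  refine past_fun f N (WN N) ?_ fun a => ?_
  · unfold WN; exact Measurable.lintegral_prod_right' (WNpair_meas N)
  · unfold WN
    simp only [FE_cut]

lemma mart_Yt (hf : SRMF μ f) (t : ℝ) (N : ℕ) (A : Set Ω) (hA : MeasurableSet[Past f N] A) :
    ∫⁻ ω in A, ENNReal.ofReal (wt t) * ENNReal.ofReal (‖FE N (twa (f ω) t)‖^2 / LN N) ∂μ = ∫⁻ ω in A, ENNReal.ofReal (wt t) * ENNReal.ofReal (‖FE (N+1) (twa (f ω) t)‖^2 / LN (N+1)) ∂μ := by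
  rw [lintegral_const_mul' _ _ (by simp), lintegral_const_mul' _ _ (by simp)]
  congr 1
  exact mart_Y (tw_SRMF hf t) N A (by rwa [Past_tw_eq hf t N])

lemma WN_mart (hf : SRMF μ f) (N : ℕ) (S : Set Ω) (hS : MeasurableSet[Past f N] S) :
    ∫⁻ ω in S, WN N (f ω) ∂μ = ∫⁻ ω in S, WN (N+1) (f ω) ∂μ := by
  refine le_antisymm ?_ ?_
  · exact sub_int hf.toIsSteinhausRMF volume _ _ (WNpair_meas N) (WNpair_meas (N+1)) S fun t => (mart_Yt hf t N S hS).le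
  · exact sub_int hf.toIsSteinhausRMF volume _ _ (WNpair_meas (N+1)) (WNpair_meas N) S fun t => (mart_Yt hf t N S hS).ge

lemma WN_mart' (hf : SRMF μ f) (N M : ℕ) (hNM : N ≤ M) (S : Set Ω) (hS : MeasurableSet[Past f N] S) :
    ∫⁻ ω in S, WN N (f ω) ∂μ = ∫⁻ ω in S, WN M (f ω) ∂μ := by
  induction M, hNM using Nat.le_induction with
  | base => rfl
  | succ M h ih => rw [ih]; exact WN_mart hf M S (Past_mono f h _ hS)

end barrier

section barrier
variable {Ω : Type*} [mΩ : MeasurableSpace Ω] {μ : Measure Ω} [IsProbabilityMeasure μ]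
  {f : Ω → ℕ → ℂ}

lemma wt_le (t : ℝ) : wt t ≤ 4 * (1 + t^2)⁻¹ := by
  unfold wt
  rw [← div_eq_mul_inv, le_div_iff₀ (by positivity), inv_mul_le_iff₀ (by positivity)]
  nlinarith [sq_nonneg t]

lemma wt_lint (S : Set ℝ) : ∫⁻ t in S, ENNReal.ofReal (wt t) ≤ ENNReal.ofReal (∫ t in S, 4 * (1 + t^2)⁻¹) := by
  rw [ofReal_integral_eq_lintegral_ofReal]
  · exact lintegral_mono fun t => ENNReal.ofReal_le_ofReal (wt_le t)
  · exact (integrable_inv_one_add_sq.const_mul 4).restrict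
  · exact ae_of_all _ fun t => by positivity

lemma wt_total : ∫⁻ t, ENNReal.ofReal (wt t) ≤ ENNReal.ofReal 16 := by
  have h := wt_lint Set.univ
  simp only [Measure.restrict_univ] at h
  refine h.trans (ENNReal.ofReal_le_ofReal ?_)
  rw [integral_const_mul, integral_univ_inv_one_add_sq]
  linarith [Real.pi_le_four]

lemma arctan_le_me {x : ℝ} (hx : 0 ≤ x) : Real.arctan x ≤ x := by
  by_contra h
  push Not at h
  have h1 := Real.lt_tan (x := Real.arctan x) (lt_of_le_of_lt hx h) (Real.arctan_lt_pi_div_two x)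
  rw [Real.tan_arctan] at h1
  linarith

lemma wt_tail {T : ℝ} (hT : 0 < T) : ∫⁻ t in (Set.Icc (-T) T)ᶜ, ENNReal.ofReal (wt t) ≤ ENNReal.ofReal (8 / T) := by
  have e : (Set.Icc (-T) T)ᶜ ⊆ Set.Iic (-T) ∪ Set.Ioi T := by
    intro t ht
    simp only [Set.mem_compl_iff, Set.mem_Icc, not_and_or, not_le] at ht
    rcases ht with h | h
    · exact Or.inl h.le
    · exact Or.inr h
  refine (lintegral_mono_set e).trans ((lintegral_union_le _ _ _).trans ?_)
  refine (add_le_add (wt_lint _) (wt_lint _)).trans ?_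
  rw [← ENNReal.ofReal_add (integral_nonneg fun t => by positivity) (integral_nonneg fun t => by positivity)]
  refine ENNReal.ofReal_le_ofReal ?_
  rw [integral_const_mul, integral_const_mul, integral_Iic_inv_one_add_sq, integral_Ioi_inv_one_add_sq, Real.arctan_neg]
  have h1 := Real.arctan_inv_of_pos hT
  have h2 := arctan_le_me (inv_nonneg.2 hT.le)
  rw [div_eq_mul_inv 8 T]
  linarith

lemma WN_good (hf : SRMF μ f) {T B : ℝ} (hT : 1/2 ≤ T) (hB : 0 ≤ B) {K : ℕ} (hK : 1 ≤ K)
    (hc : 1 ≤ Real.exp (-8)/28 * Real.log (LN (Nk K))) :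
    ∫⁻ ω in GoodK f T B K, WN (Nk K) (f ω) ∂μ ≤ ENNReal.ofReal (16 * (24 * (B + 1) / √(Real.exp (-8)/28 * Real.log (LN (Nk K)))) + 8 / T) := by
  have h := swap_int hf.toIsSteinhausRMF volume _ (WNpair_meas (Nk K)) (GoodK f T B K)
  unfold WN
  rw [h]
  set b := 24 * (B + 1) / √(Real.exp (-8)/28 * Real.log (LN (Nk K))) with hb
  have hb0 : 0 ≤ b := by positivity
  set R : ℝ → ENNReal := fun t => ∫⁻ ω in GoodK f T B K, ENNReal.ofReal (wt t) * ENNReal.ofReal (‖FE (Nk K) (twa (f ω) t)‖^2 / LN (Nk K)) ∂μ with hR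
  have e0 : ∀ t, R t = ENNReal.ofReal (wt t) * ∫⁻ ω in GoodK f T B K, ENNReal.ofReal (‖FE (Nk K) (twa (f ω) t)‖^2 / LN (Nk K)) ∂μ := by
    intro t; simp only [hR]; rw [lintegral_const_mul' _ _ (by simp)]
  have h1 : ∀ t ∈ Set.Icc (-T) T, R t ≤ ENNReal.ofReal (wt t) * ENNReal.ofReal b := by
    intro t ht
    rw [e0]
    refine mul_le_mul_right ?_ _
    refine le_trans ?_ (barrier_bound (tw_SRMF hf t) B hB (Nk K) hc)
    refine lintegral_mono_set ?_
    intro ω hω M hM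
    exact GoodK_bd hf hT hB hK hω M hM t ht
  have h2 : ∀ t, R t ≤ ENNReal.ofReal (wt t) := by
    intro t
    rw [e0]
    refine le_trans (mul_le_mul_right ?_ _) (mul_one _).le
    refine (setLIntegral_le_lintegral _ _).trans ?_
    exact (YN_exp (tw_SRMF hf t) (Nk K)).le
  have h3 : ∫⁻ t, R t = (∫⁻ t in Set.Icc (-T) T, R t) + ∫⁻ t in (Set.Icc (-T) T)ᶜ, R t := (lintegral_add_compl _ measurableSet_Icc).symm
  change ∫⁻ t, R t ≤ _
  rw [h3, ENNReal.ofReal_add (by positivity) (by positivity)]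
  refine add_le_add ?_ ?_
  · refine (setLIntegral_mono' measurableSet_Icc h1).trans ?_
    rw [lintegral_mul_const' _ _ (by simp), ENNReal.ofReal_mul (by norm_num)]
    refine mul_le_mul_left ?_ _
    exact (setLIntegral_le_lintegral _ _).trans wt_total
  · exact (lintegral_mono fun t => h2 t).trans (wt_tail (by linarith))

/-- per scale estimate -/
lemma W_scale (hf : SRMF μ f) : ∃ C : ℝ, 0 < C ∧ ∃ K0 : ℕ, ∀ K ≥ K0, ∀ l : ℝ, 0 < l →
    μ {ω | ∃ N, Nk K ≤ N ∧ N ≤ Nk (2*K) ∧ ENNReal.ofReal l ≤ WN N (f ω)} ≤ ENNReal.ofReal (C * ((K:ℝ)^2)⁻¹ + C * (Real.log K + 1) * (√K)⁻¹ / l) := by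
  obtain ⟨C, hC, hG⟩ := GoodK_prob hf
  set c := Real.exp (-8)/28 with hc
  have hc0 : 0 < c := by positivity
  refine ⟨C + 16 * 48 / √(c/4) + 8, by positivity, ⌈4/c⌉₊ + 2, fun K hK l hl => ?_⟩
  have hK2 : 2 ≤ K := by omega
  have hK2' : (2:ℝ) ≤ K := by exact_mod_cast hK2
  have hKc : 4/c ≤ K := (Nat.le_ceil _).trans (by exact_mod_cast (by omega : ⌈4/c⌉₊ ≤ K))
  have hlogK : 0 ≤ Real.log K := Real.log_natCast_nonneg _
  have hLN : (K:ℝ)/4 ≤ Real.log (LN (Nk K)) := by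
    have h1 : Real.log (Real.log (Nk K)) ≤ Real.log (LN (Nk K)) := by
      refine Real.log_le_log ?_ (log_le_LN _ (le_trans (by norm_num) (Nk_two K)))
      rw [Nk_log]; have := Real.log_pos (by norm_num : (1:ℝ) < 2); positivity
    refine le_trans ?_ h1
    rw [Nk_log, Real.log_mul (by positivity) (Real.log_pos (by norm_num)).ne', Real.log_pow]
    have h2 : -Real.log (Real.log 2) ≤ 1/2 := by
      rw [← Real.log_inv]
      have h3 : (Real.log 2)⁻¹ ≤ 3/2 := by
        rw [inv_le_comm₀ (Real.log_pos (by norm_num)) (by norm_num)]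
        have := Real.log_two_gt_d9; norm_num; linarith
      have h4 := Real.log_le_sub_one_of_pos (x := (Real.log 2)⁻¹) (by have := Real.log_pos (by norm_num : (1:ℝ) < 2); positivity)
      linarith
    nlinarith [Real.log_two_gt_d9]
  have hcond : 1 ≤ c * Real.log (LN (Nk K)) := by
    rw [div_le_iff₀ hc0] at hKc
    nlinarith
  set B := 2 * Real.log K with hB
  have hgood := WN_good hf (T := K) (B := B) (by linarith) (by positivity) (by omega : 1 ≤ K) hcond
  have hd := doob hf.toIsSteinhausRMF (fun N ω => WN N (f ω)) (Nk K) (fun N => WN_past hf N)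
    (fun N _ S hS => (WN_mart hf N S hS).le) (GoodK f K B K) (GoodK_meas hf _ _ _) (ENNReal.ofReal l) (Nk (2*K)) (Nk_mono (by omega))
  rw [← WN_mart' hf (Nk K) (Nk (2*K)) (Nk_mono (by omega)) _ (GoodK_meas hf _ _ _)] at hd
  have hd2 := ofReal_div_bd hl (hd.trans hgood)
  set E := {ω | ∃ N, Nk K ≤ N ∧ N ≤ Nk (2*K) ∧ ENNReal.ofReal l ≤ WN N (f ω)} with hE
  have hsub : E ⊆ (GoodK f K B K)ᶜ ∪ (GoodK f K B K ∩ E) := by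
    intro ω hω
    by_cases h : ω ∈ GoodK f K B K
    · exact Or.inr ⟨h, hω⟩
    · exact Or.inl h
  refine (measure_mono hsub).trans ((measure_union_le _ _).trans ?_)
  refine (add_le_add (hG K B K (by positivity)) hd2).trans ?_
  rw [← ENNReal.ofReal_add (by positivity) (by positivity)]
  refine ENNReal.ofReal_le_ofReal ?_
  have hKp : (0:ℝ) < K := by linarith
  have e1 : Real.exp (-(2*B)) = ((K:ℝ)^4)⁻¹ := by
    rw [hB, Real.exp_neg, show 2 * (2 * Real.log (K:ℝ)) = ((4:ℕ):ℝ) * Real.log K by push_cast; ring, Real.exp_nat_mul, Real.exp_log hKp]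
  have e2 : (K:ℝ) * (C * K * Real.exp (-(2*B))) = C * ((K:ℝ)^2)⁻¹ := by rw [e1]; field_simp
  have hsq : 0 < √(c/4) := by positivity
  have hsK : 0 < √(K:ℝ) := by positivity
  have h5 : √(c/4) * √K ≤ √(c * Real.log (LN (Nk K))) := by
    rw [← Real.sqrt_mul (by positivity)]
    exact Real.sqrt_le_sqrt (by nlinarith)
  have h6 : 16 * (24 * (B + 1) / √(c * Real.log (LN (Nk K)))) ≤ (16 * 48 / √(c/4)) * (Real.log K + 1) * (√K)⁻¹ := by
    calc 16 * (24 * (B + 1) / √(c * Real.log (LN (Nk K)))) ≤ 16 * (24 * (2 * (Real.log K + 1)) / (√(c/4) * √K)) := by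
          gcongr
          rw [hB]; linarith
      _ = _ := by field_simp; norm_num
  have h7 : 8 / (K:ℝ) ≤ 8 * (Real.log K + 1) * (√K)⁻¹ := by
    have : √(K:ℝ) ≤ K := by
      rw [Real.sqrt_le_left hKp.le]; nlinarith
    have h8 : (K:ℝ)⁻¹ ≤ (√K)⁻¹ := by gcongr
    rw [div_eq_mul_inv]
    have : 0 ≤ (√(K:ℝ))⁻¹ := by positivity
    nlinarith
  rw [e2]
  refine add_le_add ?_ ?_
  · gcongr
    have : 0 ≤ 16 * 48 / √(c/4) := by positivity
    linarith
  · gcongr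
    have : 0 ≤ C * (Real.log K + 1) * (√K)⁻¹ := by positivity
    nlinarith

end barrier

section barrier
variable {Ω : Type*} [mΩ : MeasurableSpace Ω] {μ : Measure Ω} [IsProbabilityMeasure μ]
  {f : Ω → ℕ → ℂ}

lemma BC (E : ℕ → Set Ω) (b : ℕ → ℝ) (hb : Summable b) (n0 : ℕ) (h : ∀ n ≥ n0, μ (E n) ≤ ENNReal.ofReal (b n)) :
    ∀ᵐ ω ∂μ, ∀ᶠ n in atTop, ω ∉ E n := by
  have h1 : Summable (fun n => |b (n + n0)|) := ((summable_nat_add_iff n0).2 hb).abs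
  have h2 : ∑' n, μ (E (n + n0)) ≠ ⊤ := by
    refine ne_top_of_le_ne_top h1.tsum_ofReal_ne_top (ENNReal.tsum_le_tsum fun n => ?_)
    exact (h (n+n0) (by omega)).trans (ENNReal.ofReal_le_ofReal (le_abs_self _))
  filter_upwards [ae_eventually_notMem h2] with ω hω
  rw [eventually_atTop] at hω ⊢
  obtain ⟨n1, hn1⟩ := hω
  refine ⟨n1 + n0, fun n hn => ?_⟩
  have := hn1 (n - n0) (by omega)
  rwa [Nat.sub_add_cancel (by omega)] at this

lemma Nk_scale (l0 N : ℕ) (hN : Nk (2^l0) ≤ N) : ∃ l ≥ l0, Nk (2^l) ≤ N ∧ N ≤ Nk (2 * 2^l) := by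
  have hex : ∃ l, N < Nk (2^l) := by
    refine ⟨N, ?_⟩
    unfold Nk
    exact lt_of_lt_of_le Nat.lt_two_pow_self (Nat.pow_le_pow_right (by norm_num) (Nat.lt_two_pow_self.le.trans (Nat.pow_le_pow_right (by norm_num) Nat.lt_two_pow_self.le)))
  classical
  set m := Nat.find hex with hm
  have h1 : N < Nk (2^m) := Nat.find_spec hex
  have h2 : l0 < m := by
    by_contra hc
    push Not at hc
    have := Nk_mono (Nat.pow_le_pow_right (by norm_num : 0 < 2) hc)
    omega
  refine ⟨m - 1, by omega, ?_, ?_⟩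
  · have := Nat.find_min hex (m := m - 1) (by omega)
    omega
  · rw [← pow_succ', Nat.sub_add_cancel (by omega)]
    exact h1.le

theorem W_bound (hf : SRMF μ f) (η : ℝ) (h0 : 0 < η) (h1 : η < 1/2) :
    ∀ᵐ ω ∂μ, ∃ N1 : ℕ, ∀ N ≥ N1, WN N (f ω) ≤ ENNReal.ofReal (Real.log (Real.log N) ^ (-(1/2) + η)) := by
  obtain ⟨C, hC, K0, hS⟩ := W_scale hf
  set lv : ℕ → ℝ := fun l => (2 * (2:ℝ)^l) ^ (-(1/2) + η) with hlv
  have hlvp : ∀ l, 0 < lv l := fun l => by positivity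
  have hb := BC (μ := μ) (fun l => {ω | ∃ N, Nk (2^l) ≤ N ∧ N ≤ Nk (2*2^l) ∧ ENNReal.ofReal (lv l) ≤ WN N (f ω)})
    (fun l => C * (1/4)^l + C * 2 * (((l:ℝ)^1 * ((2:ℝ)^(-η))^l) + ((2:ℝ)^(-η))^l)) ?_ K0 ?_
  · filter_upwards [hb] with ω hω
    rw [eventually_atTop] at hω
    obtain ⟨l0, hl0⟩ := hω
    refine ⟨Nk (2^l0), fun N hN => ?_⟩
    obtain ⟨l, hl, hN1, hN2⟩ := Nk_scale l0 N hN
    have h3 : ¬ (ENNReal.ofReal (lv l) ≤ WN N (f ω)) := fun hc => hl0 l hl ⟨N, hN1, hN2, hc⟩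
    push Not at h3
    refine h3.le.trans (ENNReal.ofReal_le_ofReal ?_)
    have hK1 : 1 ≤ 2^l := Nat.one_le_two_pow
    have h4 : 1 < Real.log N := by
      have h5 : (4:ℝ) ≤ N := by
        have := Nk_mono hK1
        have e : Nk 1 = 4 := rfl
        exact_mod_cast (by omega : 4 ≤ N)
      have h6 : Real.log 4 ≤ Real.log N := Real.log_le_log (by norm_num) h5
      have h7 : Real.log 4 = 2 * Real.log 2 := by rw [show (4:ℝ) = 2^2 by norm_num, Real.log_pow]; norm_num
      linarith [Real.log_two_gt_d9]
    have h5 : 0 < Real.log (Real.log N) := Real.log_pos h4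
    have hN0 : 0 < N := lt_of_lt_of_le (by have := Nk_two (2^l); omega) hN1
    have h6 : Real.log (Real.log N) ≤ 2 * (2:ℝ)^l := by
      have h7 : Real.log N ≤ Real.log (Nk (2 * 2^l)) := Real.log_le_log (by exact_mod_cast hN0) (by exact_mod_cast hN2)
      rw [Nk_log] at h7
      have h8 : Real.log N ≤ 2^(2*2^l) := by
        refine h7.trans ?_
        have : (0:ℝ) < 2^(2*2^l) := by positivity
        nlinarith [Real.log_two_lt_d9]
      refine (Real.log_le_log (by linarith) h8).trans ?_
      rw [Real.log_pow]
      push_cast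
      have : (0:ℝ) < 2 * 2^l := by positivity
      nlinarith [Real.log_two_lt_d9]
    exact Real.rpow_le_rpow_of_nonpos h5 h6 (by linarith)
  · have hr : ‖(2:ℝ)^(-η)‖ < 1 := by
      rw [Real.norm_of_nonneg (by positivity)]
      exact Real.rpow_lt_one_of_one_lt_of_neg (by norm_num) (by linarith)
    refine ((summable_geometric_of_lt_one (by norm_num) (by norm_num)).mul_left C).add ?_
    exact ((summable_pow_mul_geometric_of_norm_lt_one 1 hr).add (summable_geometric_of_norm_lt_one hr)).mul_left _
  · intro l hl
    have hK : K0 ≤ 2^l := le_trans hl Nat.lt_two_pow_self.le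
    refine (hS (2^l) hK (lv l) (hlvp l)).trans (ENNReal.ofReal_le_ofReal ?_)
    push_cast
    have e1 : (((2:ℝ)^l)^2)⁻¹ = (1/4)^l := by
      rw [← pow_mul, mul_comm, pow_mul, ← inv_pow]; norm_num
    rw [e1]
    refine add_le_add le_rfl ?_
    have e2 : (√((2:ℝ)^l))⁻¹ / lv l = (2:ℝ)^(1/2 - η) * ((2:ℝ)^(-η))^l := by
      have h2 : (2:ℝ)^l = (2:ℝ)^(l:ℝ) := (Real.rpow_natCast 2 l).symm
      rw [hlv, Real.sqrt_eq_rpow]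
      simp only
      rw [Real.mul_rpow (by norm_num) (by positivity), h2, ← Real.rpow_natCast ((2:ℝ)^(-η)), ← Real.rpow_mul (by norm_num), ← Real.rpow_mul (by norm_num),
        ← Real.rpow_mul (by norm_num), ← Real.rpow_neg (by norm_num), ← Real.rpow_add (by norm_num), ← Real.rpow_sub (by norm_num), ← Real.rpow_add (by norm_num)]
      congr 1; ring
    have e3 : (2:ℝ)^(1/2 - η) ≤ 2 := by
      calc (2:ℝ)^(1/2 - η) ≤ (2:ℝ)^(1:ℝ) := Real.rpow_le_rpow_of_exponent_le (by norm_num) (by linarith)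
        _ = 2 := by norm_num
    have e4 : Real.log ((2:ℝ)^l) ≤ l := by
      rw [Real.log_pow]
      have : (0:ℝ) ≤ l := by positivity
      nlinarith [Real.log_two_lt_d9]
    have h9 : 0 ≤ ((2:ℝ)^(-η))^l := by positivity
    calc C * (Real.log ((2:ℝ)^l) + 1) * (√((2:ℝ)^l))⁻¹ / lv l = C * (Real.log ((2:ℝ)^l) + 1) * ((√((2:ℝ)^l))⁻¹ / lv l) := by ring
      _ ≤ C * (l + 1) * (2 * ((2:ℝ)^(-η))^l) := by
          rw [e2]; gcongr
      _ = _ := by ring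

end barrier

section planch
open FourierTransform

lemma wt_integrable : Integrable wt := by
  refine (integrable_inv_one_add_sq.const_mul 4).mono' wt_meas.aestronglyMeasurable (ae_of_all _ fun t => ?_)
  rw [Real.norm_of_nonneg (wt_pos t).le]; exact wt_le t

lemma four_g (ξ : ℝ) : 𝓕 (fun v : ℝ => ((Real.exp (-(π * |v|)) : ℝ) : ℂ)) ξ = ((wt ξ / (2 * π) : ℝ) : ℂ) := by
  rw [Real.fourier_real_eq_integral_exp_smul]
  set a : ℂ := -π - 2 * π * ξ * Complex.I
  set b : ℂ := π - 2 * π * ξ * Complex.I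
  have ha : a.re < 0 := by simp [a, Real.pi_pos]
  have hb : 0 < b.re := by simp [b, Real.pi_pos]
  set h : ℝ → ℂ := fun v => Complex.exp (↑(-2 * π * v * ξ) * Complex.I) • ((Real.exp (-(π * |v|)) : ℝ) : ℂ)
  have e1 : Set.EqOn h (fun v : ℝ => Complex.exp (a * v)) (Set.Ioi 0) := by
    intro v hv
    have hv : 0 < v := hv
    simp only [h, a, smul_eq_mul, abs_of_pos hv, Complex.ofReal_exp, ← Complex.exp_add]
    congr 1; push_cast; ring
  have e2 : Set.EqOn h (fun v : ℝ => Complex.exp (b * v)) (Set.Iic 0) := by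
    intro v hv
    have hv : v ≤ 0 := hv
    simp only [h, b, smul_eq_mul, abs_of_nonpos hv, Complex.ofReal_exp, ← Complex.exp_add]
    congr 1; push_cast; ring
  have i1 : IntegrableOn h (Set.Ioi 0) := (integrableOn_exp_mul_complex_Ioi ha 0).congr_fun e1.symm measurableSet_Ioi
  have i2 : IntegrableOn h (Set.Iic 0) := (integrableOn_exp_mul_complex_Iic hb 0).congr_fun e2.symm measurableSet_Iic
  have h3 := intervalIntegral.integral_Iic_add_Ioi i2 i1
  rw [← h3, setIntegral_congr_fun measurableSet_Iic e2, setIntegral_congr_fun measurableSet_Ioi e1,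
    integral_exp_mul_complex_Iic hb, integral_exp_mul_complex_Ioi ha]
  have ha0 : a ≠ 0 := by intro h; rw [h] at ha; simp at ha
  have hb0 : b ≠ 0 := by intro h; rw [h] at hb; simp at hb
  have hab : a * b = -(4 * π^2 * (1/4 + ξ^2)) := by
    simp only [a, b]
    linear_combination (4 * π^2 * ξ^2 : ℂ) * Complex.I_sq
  have hpi : (π:ℂ) ≠ 0 := by exact_mod_cast Real.pi_ne_zero
  have hx : (1/4 + (ξ:ℂ)^2) ≠ 0 := by
    have : (0:ℝ) < 1/4 + ξ^2 := by positivity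
    have e : (1/4 + (ξ:ℂ)^2) = ((1/4 + ξ^2 : ℝ) : ℂ) := by push_cast; ring
    rw [e]; exact Complex.ofReal_ne_zero.2 this.ne'
  have e5 : Complex.exp (b * (0:ℝ)) / b + -Complex.exp (a * (0:ℝ)) / a = (a - b) / (a * b) := by
    simp only [Complex.ofReal_zero, mul_zero, Complex.exp_zero]
    field_simp; ring
  rw [e5, hab]
  unfold wt
  push_cast
  have : a - b = -2 * π := by simp only [a, b]; ring
  rw [this]
  field_simp
  norm_num

lemma kern (u : ℝ) : ∫ ξ : ℝ, Complex.exp (((ξ * u : ℝ) : ℂ) * Complex.I) * (wt ξ : ℂ) = ((2 * π * Real.exp (-(|u|/2)) : ℝ) : ℂ) := by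
  set g : ℝ → ℂ := fun v : ℝ => ((Real.exp (-(π * |v|)) : ℝ) : ℂ)
  have hF : 𝓕 g = fun ξ => ((wt ξ / (2 * π) : ℝ) : ℂ) := funext four_g
  have hgc : Continuous g := by fun_prop
  have hgi : Integrable g := by
    have i0 : Integrable (fun v : ℝ => Real.exp (-(π * |v|))) := by
      have h1 : IntegrableOn (fun v : ℝ => Real.exp (-(π * |v|))) (Set.Ioi 0) :=
        (integrableOn_exp_mul_Ioi (a := -π) (by linarith [Real.pi_pos]) 0).congr_fun (fun v hv => by
          have hv : 0 < v := hv
          simp only [abs_of_pos hv]; congr 1; ring) measurableSet_Ioi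
      have h2 : IntegrableOn (fun v : ℝ => Real.exp (-(π * |v|))) (Set.Iic 0) :=
        (integrableOn_exp_mul_Iic (a := π) Real.pi_pos 0).congr_fun (fun v hv => by
          have hv : v ≤ 0 := hv
          simp only [abs_of_nonpos hv]; congr 1; ring) measurableSet_Iic
      rw [← integrableOn_univ, ← Set.Iic_union_Ioi (a := (0:ℝ))]
      exact h2.union h1
    exact i0.ofReal
  have hFi : Integrable (𝓕 g) := by
    rw [hF]; exact (wt_integrable.div_const _).ofReal
  have h := congrFun (hgc.fourierInv_fourier_eq hgi hFi) (u / (2*π))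
  rw [Real.fourierInv_eq', hF] at h
  have hpi : (π:ℂ) ≠ 0 := by exact_mod_cast Real.pi_ne_zero
  have e : ∀ v : ℝ, Complex.exp (((v * u : ℝ) : ℂ) * Complex.I) * (wt v : ℂ) =
     (2 * π) * (Complex.exp (↑(2 * π * inner ℝ v (u / (2 * π))) * Complex.I) • ((wt v / (2 * π) : ℝ) : ℂ)) := by
    intro v
    have : 2 * π * inner ℝ v (u / (2 * π)) = v * u := by
      have := Real.pi_ne_zero
      simp; field_simp
    rw [this, smul_eq_mul]
    push_cast; field_simp
  simp_rw [e]
  rw [integral_const_mul, h]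
  simp only [g]
  push_cast
  congr 2
  rw [abs_div, abs_of_pos (by positivity : 0 < 2 * π)]
  push_cast; field_simp

lemma kern_mn (m n : ℕ) (hm : 1 ≤ m) (hn : 1 ≤ n) :
    (rN m : ℂ) * rN n * ∫ t : ℝ, ((m:ℂ)^(-(t * Complex.I))) * (starRingEnd ℂ) ((n:ℂ)^(-(t * Complex.I))) * (wt t : ℂ) = ((2 * π * ((max m n : ℕ) : ℝ)⁻¹ : ℝ) : ℂ) := by
  have hm0 : (0:ℝ) < m := by exact_mod_cast hm
  have hn0 : (0:ℝ) < n := by exact_mod_cast hn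
  have hmc : (m:ℂ) ≠ 0 := by exact_mod_cast hm0.ne'
  have hnc : (n:ℂ) ≠ 0 := by exact_mod_cast hn0.ne'
  have e : ∀ t : ℝ, ((m:ℂ)^(-(t * Complex.I))) * (starRingEnd ℂ) ((n:ℂ)^(-(t * Complex.I))) * (wt t : ℂ) =
     Complex.exp (((t * (Real.log n - Real.log m) : ℝ) : ℂ) * Complex.I) * (wt t : ℂ) := by
    intro t
    congr 1
    rw [Complex.cpow_def_of_ne_zero hmc, Complex.cpow_def_of_ne_zero hnc, ← Complex.exp_conj, ← Complex.exp_add, ← Complex.natCast_log, ← Complex.natCast_log]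
    congr 1
    simp only [map_mul, map_neg, Complex.conj_ofReal, Complex.conj_I]
    push_cast; ring
  simp_rw [e]
  rw [kern, ← Complex.ofReal_mul, ← Complex.ofReal_mul]
  congr 1
  have key : ∀ a b : ℝ, 0 < a → a ≤ b → (√a)⁻¹ * (√b)⁻¹ * Real.exp (-(|Real.log b - Real.log a|/2)) = b⁻¹ := by
    intro a b ha hab
    have hb : 0 < b := by linarith
    rw [abs_of_nonneg (sub_nonneg.2 (Real.log_le_log ha hab))]
    have h1 : ∀ c : ℝ, 0 < c → (√c)⁻¹ = Real.exp (-(Real.log c / 2)) := by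
      intro c hc
      rw [Real.exp_neg, Real.sqrt_eq_rpow, Real.rpow_def_of_pos hc]; congr 2; ring
    rw [h1 a ha, h1 b hb, ← Real.exp_add, ← Real.exp_add]
    rw [show -(Real.log a / 2) + -(Real.log b / 2) + -((Real.log b - Real.log a)/2) = -Real.log b by ring, Real.exp_neg, Real.exp_log hb]
  unfold rN
  rcases le_total m n with h | h
  · rw [max_eq_right h, ← key m n hm0 (by exact_mod_cast h)]; ring
  · rw [max_eq_left h, ← key n m hn0 (by exact_mod_cast h), abs_sub_comm]; ring

end planch

section planch

def QF (F : Finset ℕ) (c : ℕ → ℂ) : ℂ := ∑ m ∈ F, ∑ n ∈ F, c m * (starRingEnd ℂ) (c n) * (((max m n : ℕ) : ℝ)⁻¹ : ℝ)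

lemma normsq_sum (F : Finset ℕ) (g : ℕ → ℂ) : ((‖∑ n ∈ F, g n‖^2 : ℝ) : ℂ) = ∑ m ∈ F, ∑ n ∈ F, g m * (starRingEnd ℂ) (g n) := by
  push_cast
  rw [← Complex.mul_conj', map_sum, Finset.sum_mul_sum]

lemma planch_freq (F : Finset ℕ) (hF : ∀ n ∈ F, 1 ≤ n) (c : ℕ → ℂ) :
    ((∫ t : ℝ, wt t * ‖∑ n ∈ F, (rN n : ℂ) * (c n * (n:ℂ)^(-(t * Complex.I)))‖^2 : ℝ) : ℂ) = 2 * π * QF F c := by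
  rw [← integral_complex_ofReal]
  have e : ∀ t : ℝ, ((wt t * ‖∑ n ∈ F, (rN n : ℂ) * (c n * (n:ℂ)^(-(t * Complex.I)))‖^2 : ℝ) : ℂ) =
     ∑ m ∈ F, ∑ n ∈ F, c m * (starRingEnd ℂ) (c n) * ((rN m : ℂ) * rN n * (((m:ℂ)^(-(t * Complex.I))) * (starRingEnd ℂ) ((n:ℂ)^(-(t * Complex.I))) * (wt t : ℂ))) := by
    intro t
    rw [Complex.ofReal_mul, normsq_sum, Finset.mul_sum]
    refine Finset.sum_congr rfl fun m _ => ?_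
    rw [Finset.mul_sum]
    refine Finset.sum_congr rfl fun n _ => ?_
    simp only [map_mul, Complex.conj_ofReal]
    ring
  have hi : ∀ m ∈ F, ∀ n ∈ F, Integrable (fun t : ℝ => c m * (starRingEnd ℂ) (c n) * ((rN m : ℂ) * rN n * (((m:ℂ)^(-(t * Complex.I))) * (starRingEnd ℂ) ((n:ℂ)^(-(t * Complex.I))) * (wt t : ℂ)))) := by
    intro m hm n hn
    refine Integrable.const_mul (Integrable.const_mul ?_ _) _
    refine wt_integrable.mono' ?_ (ae_of_all _ fun t => ?_)
    · have := wt_meas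
      have h1 : ∀ k : ℕ, Measurable (fun t : ℝ => (k:ℂ) ^ (-(t * Complex.I))) := by intro k; fun_prop
      exact (((h1 m).mul (Complex.continuous_conj.measurable.comp (h1 n))).mul (by fun_prop)).aestronglyMeasurable
    · rw [norm_mul, norm_mul, Complex.norm_conj, Complex.norm_natCast_cpow_of_pos (hF m hm), Complex.norm_natCast_cpow_of_pos (hF n hn), Complex.norm_real,
        Real.norm_of_nonneg (wt_pos t).le]
      simp
  simp_rw [e]
  rw [integral_finset_sum _ (fun m hm => integrable_finset_sum _ (fun n hn => hi m hm n hn))]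
  unfold QF
  rw [Finset.mul_sum]
  refine Finset.sum_congr rfl fun m hm => ?_
  rw [integral_finset_sum _ (hi m hm), Finset.mul_sum]
  refine Finset.sum_congr rfl fun n hn => ?_
  rw [integral_const_mul, integral_const_mul, kern_mn m n (hF m hm) (hF n hn)]
  push_cast; ring

lemma planch_time (F : Finset ℕ) (hF : ∀ n ∈ F, 1 ≤ n) (c : ℕ → ℂ) (x : ℝ) (hx : 0 < x) :
    ((∫ t in Set.Ioi (0:ℝ), ‖∑ n ∈ F, if n * t ≤ x then c n else 0‖^2 : ℝ) : ℂ) = x * QF F c ∧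
     IntegrableOn (fun t : ℝ => ‖∑ n ∈ F, if n * t ≤ x then c n else 0‖^2) (Set.Ioi 0) := by
  have e : ∀ t : ℝ, ((‖∑ n ∈ F, if n * t ≤ x then c n else 0‖^2 : ℝ) : ℂ) =
     ∑ m ∈ F, ∑ n ∈ F, (Set.Iic (x / ((max m n : ℕ):ℝ))).indicator (fun _ => c m * (starRingEnd ℂ) (c n)) t := by
    intro t
    rw [normsq_sum]
    refine Finset.sum_congr rfl fun m hm => Finset.sum_congr rfl fun n hn => ?_
    have hm0 : (0:ℝ) < m := by exact_mod_cast hF m hm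
    have hn0 : (0:ℝ) < n := by exact_mod_cast hF n hn
    have : t ∈ Set.Iic (x / ((max m n : ℕ):ℝ)) ↔ m * t ≤ x ∧ n * t ≤ x := by
      rw [Set.mem_Iic]
      rcases le_total m n with h | h
      · rw [max_eq_right h, le_div_iff₀ hn0]
        have h' : (m:ℝ) ≤ n := by exact_mod_cast h
        constructor
        · intro h1
          refine ⟨?_, by linarith⟩
          rcases le_total 0 t with h2 | h2
          · nlinarith
          · nlinarith
        · rintro ⟨_, h1⟩; linarith
      · rw [max_eq_left h, le_div_iff₀ hm0]
        have h' : (n:ℝ) ≤ m := by exact_mod_cast h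
        constructor
        · intro h1
          refine ⟨by linarith, ?_⟩
          rcases le_total 0 t with h2 | h2
          · nlinarith
          · nlinarith
        · rintro ⟨h1, _⟩; linarith
    rw [Set.indicator_apply]
    by_cases h1 : m * t ≤ x <;> by_cases h2 : n * t ≤ x <;> simp only [this, h1, h2, and_self, and_true, and_false, false_and, true_and, if_true, if_false] <;> simp
  have hi : ∀ m ∈ F, ∀ n ∈ F, IntegrableOn ((Set.Iic (x / ((max m n : ℕ):ℝ))).indicator (fun _ => c m * (starRingEnd ℂ) (c n))) (Set.Ioi 0) := by
    intro m hm n hn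
    rw [IntegrableOn, integrable_indicator_iff measurableSet_Iic]
    rw [IntegrableOn, Measure.restrict_restrict measurableSet_Iic, Set.Iic_inter_Ioi]
    exact integrableOn_const (by simp)
  have hI : IntegrableOn (fun t : ℝ => ((‖∑ n ∈ F, if n * t ≤ x then c n else 0‖^2 : ℝ) : ℂ)) (Set.Ioi 0) := by
    simp_rw [e]
    exact integrable_finset_sum _ (fun m hm => integrable_finset_sum _ (fun n hn => hi m hm n hn))
  refine ⟨?_, ?_⟩
  · rw [← integral_complex_ofReal]
    simp_rw [e]
    rw [integral_finset_sum _ (fun m hm => integrable_finset_sum _ (fun n hn => hi m hm n hn))]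
    unfold QF
    rw [Finset.mul_sum]
    refine Finset.sum_congr rfl fun m hm => ?_
    rw [integral_finset_sum _ (hi m hm), Finset.mul_sum]
    refine Finset.sum_congr rfl fun n hn => ?_
    rw [integral_indicator measurableSet_Iic, Measure.restrict_restrict measurableSet_Iic, Set.Iic_inter_Ioi, setIntegral_const]
    rw [Real.volume_real_Ioc_of_le (by positivity)]
    simp only [sub_zero, Complex.real_smul]
    push_cast; ring
  · exact hI.re

end planch

section planch3

/-- unimodular completely multiplicative sequences -/
structure CMu (a : ℕ → ℂ) : Prop where
  one : a 1 = 1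
  mul : ∀ m n : ℕ, 1 ≤ m → 1 ≤ n → a (m * n) = a m * a n
  norm : ∀ n : ℕ, 1 ≤ n → ‖a n‖ = 1

def Ssum (a : ℕ → ℂ) (u : ℝ) : ℂ := ∑ n ∈ Finset.Icc 1 ⌊u⌋₊, a n

lemma CMu.uni {a : ℕ → ℂ} (ha : CMu a) : Uni a := fun p hp => ha.norm p hp.one_lt.le

lemma rN_zero : rN 0 = 0 := by simp [rN]
lemma rN_mul (m n : ℕ) : rN (m * n) = rN m * rN n := by
  unfold rN; push_cast; rw [Real.sqrt_mul (by positivity), mul_inv]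

def homT {a : ℕ → ℂ} (ha : CMu a) (t : ℝ) : ℕ →* ℂ where
  toFun n := (rN n : ℂ) * (a n * (n:ℂ)^(-(t * Complex.I)))
  map_one' := by simp [rN, ha.one]
  map_mul' m n := by
    rcases Nat.eq_zero_or_pos m with h | h
    · subst h; simp [rN_zero]
    rcases Nat.eq_zero_or_pos n with h' | h'
    · subst h'; simp [rN_zero]
    rw [rN_mul, ha.mul m n h h', Nat.cast_mul, Complex.natCast_mul_natCast_cpow]
    push_cast; ring

lemma homT_norm {a : ℕ → ℂ} (ha : CMu a) (t : ℝ) (n : ℕ) : ‖homT ha t n‖ = rN n := by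
  show ‖(rN n : ℂ) * (a n * (n:ℂ)^(-(t * Complex.I)))‖ = _
  rcases Nat.eq_zero_or_pos n with h | h
  · subst h; simp [rN_zero]
  · rw [norm_mul, norm_mul, ha.norm n h, Complex.norm_natCast_cpow_of_pos h, Complex.norm_real, Real.norm_of_nonneg (rN_nonneg n)]
    simp

lemma rN_prime_lt {p : ℕ} (hp : p.Prime) : rN p < 1 := by
  have h1 := rN_sq_le hp
  have h2 := rN_nonneg p
  nlinarith

open Classical in
def FM (N M : ℕ) : Finset ℕ := (Finset.range M).filter (fun n => n ∈ N.smoothNumbers)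

lemma FM_sum {E : Type*} [AddCommMonoid E] (N M : ℕ) (g : ℕ → E) : ∑ n ∈ FM N M, g n = ∑ n ∈ Finset.range M, (N.smoothNumbers).indicator g n := by
  classical
  unfold FM
  rw [Finset.sum_filter]
  refine Finset.sum_congr rfl fun n _ => ?_
  rw [Set.indicator_apply]

lemma FM_pos {N M n : ℕ} (h : n ∈ FM N M) : 1 ≤ n := by
  classical
  unfold FM at h
  exact Nat.one_le_iff_ne_zero.2 (Nat.ne_zero_of_mem_smoothNumbers (Finset.mem_filter.1 h).2)

lemma GM_tendsto {a : ℕ → ℂ} (ha : CMu a) (N : ℕ) (t : ℝ) :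
    Tendsto (fun M => ∑ n ∈ FM N M, (rN n : ℂ) * (a n * (n:ℂ)^(-(t * Complex.I)))) atTop (nhds (FE N (twa a t))) := by
  have h := (EulerProduct.summable_and_hasSum_smoothNumbers_prod_primesBelow_geometric (f := homT ha t) (fun {p} hp => by
    rw [homT_norm]; exact rN_prime_lt hp) N).2
  have h2 : HasSum ((N.smoothNumbers).indicator (fun n => homT ha t n)) (∏ p ∈ N.primesBelow, (1 - homT ha t p)⁻¹) := by
    rw [← hasSum_subtype_iff_indicator]; exact h
  have h3 := h2.tendsto_sum_nat
  simp_rw [← FM_sum] at h3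
  exact h3

lemma GM_bound {a : ℕ → ℂ} (ha : CMu a) (N : ℕ) : ∃ B : ℝ, 0 ≤ B ∧ ∀ (M : ℕ) (t : ℝ),
    ‖∑ n ∈ FM N M, (rN n : ℂ) * (a n * (n:ℂ)^(-(t * Complex.I)))‖ ≤ B := by
  have h := (EulerProduct.summable_and_hasSum_smoothNumbers_prod_primesBelow_geometric (f := homT ha 0) (fun {p} hp => by
    rw [homT_norm]; exact rN_prime_lt hp) N).1
  simp_rw [homT_norm] at h
  have h2 : Summable ((N.smoothNumbers).indicator (fun n => rN n)) := summable_subtype_iff_indicator.1 h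
  refine ⟨∑' n, (N.smoothNumbers).indicator (fun n => rN n) n, tsum_nonneg fun n => Set.indicator_nonneg (fun m _ => rN_nonneg m) n, fun M t => ?_⟩
  refine (norm_sum_le _ _).trans ?_
  have : ∀ n ∈ FM N M, ‖(rN n : ℂ) * (a n * (n:ℂ)^(-(t * Complex.I)))‖ = rN n := fun n _ => homT_norm ha t n
  rw [Finset.sum_congr rfl this, FM_sum]
  exact h2.sum_le_tsum _ fun n _ => Set.indicator_nonneg (fun m _ => rN_nonneg m) n

lemma Ssum_FM (a : ℕ → ℂ) (x : ℝ) (hx : 0 < x) (N M : ℕ) (hN : 1 ≤ N) (hM : N ≤ M) (t : ℝ) (ht : x / N < t) :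
    Ssum a (x / t) = ∑ n ∈ FM N M, if n * t ≤ x then a n else 0 := by
  classical
  have hN0 : (0:ℝ) < N := by exact_mod_cast hN
  have ht0 : 0 < t := lt_trans (by positivity) ht
  unfold Ssum
  rw [← Finset.sum_filter]
  refine Finset.sum_congr ?_ fun _ _ => rfl
  ext n
  unfold FM
  rw [Finset.mem_filter, Finset.mem_filter, Finset.mem_range, Finset.mem_Icc, Nat.le_floor_iff (by positivity), le_div_iff₀ ht0]
  constructor
  · rintro ⟨h1, h2⟩
    have h3 : n < N := by
      rw [div_lt_iff₀ hN0] at ht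
      have : (n:ℝ) < N := by
        by_contra h
        push Not at h
        nlinarith
      exact_mod_cast this
    exact ⟨⟨by omega, Nat.mem_smoothNumbers_of_lt h1 h3⟩, h2⟩
  · rintro ⟨⟨_, h1⟩, h2⟩
    exact ⟨Nat.one_le_iff_ne_zero.2 (Nat.ne_zero_of_mem_smoothNumbers h1), h2⟩

lemma planch_fin (a : ℕ → ℂ) (x : ℝ) (hx : 0 < x) (F : Finset ℕ) (hF : ∀ n ∈ F, 1 ≤ n) :
    ∫⁻ t in Set.Ioi (0:ℝ), ENNReal.ofReal (‖∑ n ∈ F, if n * t ≤ x then a n else 0‖^2) ≤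
     ENNReal.ofReal x * ∫⁻ t : ℝ, ENNReal.ofReal (wt t * ‖∑ n ∈ F, (rN n : ℂ) * (a n * (n:ℂ)^(-(t * Complex.I)))‖^2) := by
  obtain ⟨h1, h2⟩ := planch_time F hF a x hx
  have h3 := planch_freq F hF a
  rw [← ofReal_integral_eq_lintegral_ofReal h2 (ae_of_all _ fun t => by positivity)]
  set A := ∫ t in Set.Ioi (0:ℝ), ‖∑ n ∈ F, if n * t ≤ x then a n else 0‖^2
  set B := ∫ t : ℝ, wt t * ‖∑ n ∈ F, (rN n : ℂ) * (a n * (n:ℂ)^(-(t * Complex.I)))‖^2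
  have h4 : A * (2 * π) = x * B := by
    have : ((A * (2 * π) : ℝ) : ℂ) = ((x * B : ℝ) : ℂ) := by
      push_cast; rw [h1, h3]; ring
    exact_mod_cast this
  have hB : 0 ≤ B := integral_nonneg fun t => mul_nonneg (wt_pos t).le (by positivity)
  have hA : 0 ≤ A := integral_nonneg fun t => by positivity
  have h5 : A ≤ x * B := by nlinarith [pi_gt_three]
  refine (ENNReal.ofReal_le_ofReal h5).trans ?_
  rw [ENNReal.ofReal_mul hx.le]
  refine mul_le_mul_right ?_ _
  by_cases hi : Integrable (fun t : ℝ => wt t * ‖∑ n ∈ F, (rN n : ℂ) * (a n * (n:ℂ)^(-(t * Complex.I)))‖^2)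
  · exact (ofReal_integral_eq_lintegral_ofReal hi (ae_of_all _ fun t => mul_nonneg (wt_pos t).le (by positivity))).le
  · have : B = 0 := integral_undef hi
    rw [this]; simp
 
lemma planch_main {a : ℕ → ℂ} (ha : CMu a) (x : ℝ) (hx : 0 < x) (N : ℕ) (hN : 1 ≤ N) :
    ∫⁻ t in Set.Ioi (x / N), ENNReal.ofReal (‖Ssum a (x / t)‖^2) ≤ ENNReal.ofReal (x * LN N) * WN N a := by
  have hN0 : (0:ℝ) < N := by exact_mod_cast hN
  obtain ⟨B, hB0, hB⟩ := GM_bound ha N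
  have hL := LN_pos N
  have key : ∀ M ≥ N, ∫⁻ t in Set.Ioi (x / N), ENNReal.ofReal (‖Ssum a (x / t)‖^2) ≤
      ENNReal.ofReal x * ∫⁻ t : ℝ, ENNReal.ofReal (wt t * ‖∑ n ∈ FM N M, (rN n : ℂ) * (a n * (n:ℂ)^(-(t * Complex.I)))‖^2) := by
    intro M hM
    refine le_trans ?_ (planch_fin a x hx (FM N M) (fun n hn => FM_pos hn))
    calc _ = ∫⁻ t in Set.Ioi (x / N), ENNReal.ofReal (‖∑ n ∈ FM N M, if n * t ≤ x then a n else 0‖^2) := by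
          refine setLIntegral_congr_fun measurableSet_Ioi fun t ht => ?_
          show ENNReal.ofReal (‖Ssum a (x / t)‖^2) = _
          rw [Ssum_FM a x hx N M hN hM t ht]
      _ ≤ _ := lintegral_mono_set (Set.Ioi_subset_Ioi (by positivity))
  have hm := wt_meas
  have lim : Tendsto (fun M => ∫⁻ t : ℝ, ENNReal.ofReal (wt t * ‖∑ n ∈ FM N M, (rN n : ℂ) * (a n * (n:ℂ)^(-(t * Complex.I)))‖^2)) atTop
      (nhds (∫⁻ t : ℝ, ENNReal.ofReal (wt t * ‖FE N (twa a t)‖^2))) := by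
    refine tendsto_lintegral_of_dominated_convergence (fun t => ENNReal.ofReal (wt t * B^2)) ?_ ?_ ?_ ?_
    · intro M
      have h1 : ∀ k : ℕ, Measurable (fun t : ℝ => (k:ℂ) ^ (-(t * Complex.I))) := by intro k; fun_prop
      have : Measurable (fun t : ℝ => ∑ n ∈ FM N M, (rN n : ℂ) * (a n * (n:ℂ)^(-(t * Complex.I)))) :=
        Finset.measurable_sum _ fun n _ => ((h1 n).const_mul _).const_mul _
      exact ENNReal.measurable_ofReal.comp (hm.mul (this.norm.pow_const 2))
    · intro M
      refine ae_of_all _ fun t => ENNReal.ofReal_le_ofReal ?_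
      refine mul_le_mul_of_nonneg_left ?_ (wt_pos t).le
      exact pow_le_pow_left₀ (norm_nonneg _) (hB M t) 2
    · exact ((wt_integrable.mul_const (B^2)).lintegral_lt_top).ne
    · refine ae_of_all _ fun t => ?_
      exact ENNReal.tendsto_ofReal (((GM_tendsto ha N t).norm.pow 2).const_mul _)
  have h1 := ENNReal.Tendsto.const_mul lim (Or.inr (ENNReal.ofReal_ne_top (r := x)))
  have h2 : ENNReal.ofReal (x * LN N) * WN N a = ENNReal.ofReal x * ∫⁻ t : ℝ, ENNReal.ofReal (wt t * ‖FE N (twa a t)‖^2) := by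
    rw [ENNReal.ofReal_mul hx.le, mul_assoc]
    congr 1
    unfold WN
    rw [← lintegral_const_mul' _ _ ENNReal.ofReal_ne_top]
    refine lintegral_congr fun t => ?_
    rw [← ENNReal.ofReal_mul (wt_pos t).le, ← ENNReal.ofReal_mul hL.le]
    congr 1
    field_simp
  rw [h2]
  exact ge_of_tendsto h1 (eventually_atTop.2 ⟨N, key⟩)

lemma cmu_f {Ω : Type*} [MeasurableSpace Ω] {μ : Measure Ω} {f : Ω → ℕ → ℂ} (hf : SRMF μ f) (ω : Ω) : CMu (f ω) :=
  ⟨hf.map_one ω, hf.map_mul ω, hf.norm_one ω⟩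
end planch3

section variance

open Classical in
def PR (x : ℝ) : Finset ℕ := (Finset.Icc 1 ⌊x⌋₊).filter (fun p => p.Prime ∧ √x < p)

def Vx (a : ℕ → ℂ) (x : ℝ) : ℝ := ∑ p ∈ PR x, ‖Ssum a (x / p)‖^2

lemma mem_PR {x : ℝ} (hx : 0 ≤ x) {p : ℕ} : p ∈ PR x ↔ p.Prime ∧ √x < p ∧ (p:ℝ) ≤ x := by
  classical
  unfold PR
  rw [Finset.mem_filter, Finset.mem_Icc, Nat.le_floor_iff hx]
  constructor
  · rintro ⟨⟨_, h⟩, h1, h2⟩; exact ⟨h1, h2, h⟩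
  · rintro ⟨h1, h2, h⟩; exact ⟨⟨h1.one_lt.le, h⟩, h1, h2⟩

/-- short interval prime weight -/
lemma bt_weight (x : ℝ) (hx : (2:ℝ)^44 ≤ x) (δ : ℝ) (hδ : δ = 8 / √(√x)) (t : ℝ) (ht : √x < t) (F : Finset ℕ)
    (hF : ∀ p ∈ F, p.Prime ∧ (p:ℝ) ≤ t ∧ t < p * (1 + δ)) :
    ∑ p ∈ F, (1 / (p * δ)) ≤ 960 / Real.log x := by
  have hx0 : 0 < x := by linarith [show (0:ℝ) < 2^44 by positivity]
  have hs : (2:ℝ)^22 ≤ √x := by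
    apply Real.le_sqrt_of_sq_le; norm_num at hx ⊢; linarith
  have hss : (2:ℝ)^11 ≤ √(√x) := by
    apply Real.le_sqrt_of_sq_le; norm_num at hs ⊢; linarith
  have hss0 : 0 < √(√x) := by positivity
  have hδ0 : 0 < δ := by rw [hδ]; positivity
  have hδ1 : δ ≤ 1 := by
    rw [hδ, div_le_one hss0]; norm_num at hss ⊢; linarith
  have ht0 : 0 < t := lt_of_le_of_lt (Real.sqrt_nonneg _) ht
  have hst : √(√x) ≤ √t := Real.sqrt_le_sqrt ht.le
  have hst2 : √t ^ 2 = t := Real.sq_sqrt ht0.le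
  have htd : 8 * √t ≤ t * δ := by
    rw [hδ, mul_div_assoc', le_div_iff₀ hss0]
    nlinarith [Real.sqrt_nonneg t]
  have hst1 : 1 ≤ √t := by norm_num at hss; linarith
  set a := ⌊t / (1 + δ)⌋₊
  set b := ⌊t⌋₊
  have hb1 : (b:ℝ) ≤ t := Nat.floor_le ht0.le
  have hb2 : t < b + 1 := Nat.lt_floor_add_one t
  have ha1 : (a:ℝ) ≤ t / (1+δ) := Nat.floor_le (by positivity)
  have ha2 : t / (1+δ) < a + 1 := Nat.lt_floor_add_one _
  have hdiv1 : t / (1+δ) ≤ t - t * δ / 2 := by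
    rw [div_le_iff₀ (by positivity)]
    nlinarith [mul_nonneg ht0.le hδ0.le]
  have hdiv2 : t - t * δ ≤ t / (1+δ) := by
    rw [le_div_iff₀ (by positivity)]
    nlinarith [mul_nonneg ht0.le (sq_nonneg δ)]
  have hbt : √(b:ℝ) ≤ √t := Real.sqrt_le_sqrt hb1
  have hb0 : √x - 1 ≤ b := by linarith
  have hb20 : 2^20 ≤ b := by
    have : ((2^20 : ℕ):ℝ) ≤ b := by
      rw [show ((2^20:ℕ):ℝ) = 1048576 by norm_num]; norm_num at hs; linarith
    exact_mod_cast this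
  have hgap : √(b:ℝ) ≤ (b:ℝ) - a := by nlinarith
  have hab : a ≤ b := by
    have : (a:ℝ) ≤ b := by linarith [Real.sqrt_nonneg (b:ℝ)]
    exact_mod_cast this
  have h := BT a b hb20 hab hgap
  have hsub : F ⊆ (Finset.Ioc a b).filter Nat.Prime := by
    intro p hp
    obtain ⟨h1, h2, h3⟩ := hF p hp
    rw [Finset.mem_filter, Finset.mem_Ioc]
    refine ⟨⟨?_, Nat.le_floor h2⟩, h1⟩
    rw [Nat.floor_lt (by positivity), div_lt_iff₀ (by positivity)]; exact h3
  have hcard : (F.card : ℝ) ≤ 60 * ((b:ℝ) - a) / Real.log b :=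
    le_trans (by exact_mod_cast Finset.card_le_card hsub) h
  have hlx : 0 < Real.log x := Real.log_pos (by norm_num at hx; linarith)
  have hlb : Real.log x / 4 ≤ Real.log b := by
    have h1 : √(√x) ≤ b := by
      have : √(√x)^2 = √x := Real.sq_sqrt (Real.sqrt_nonneg _)
      norm_num at hss
      nlinarith
    have h2 := Real.log_le_log hss0 h1
    rw [Real.log_sqrt (Real.sqrt_nonneg _), Real.log_sqrt hx0.le] at h2
    linarith
  have hba : (b:ℝ) - a ≤ 2 * (t * δ) := by nlinarith
  have hcard2 : (F.card : ℝ) ≤ 480 * (t * δ) / Real.log x := by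
    refine hcard.trans ?_
    rw [div_le_div_iff₀ (by linarith) hlx]
    have : 0 < t * δ := by positivity
    have hba0 : 0 ≤ (b:ℝ) - a := le_trans (Real.sqrt_nonneg _) hgap
    nlinarith [mul_le_mul_of_nonneg_right hba hlx.le, mul_le_mul_of_nonneg_left hlb this.le]
  calc ∑ p ∈ F, (1 / (p * δ)) ≤ ∑ p ∈ F, (2 / (t * δ)) := by
        refine Finset.sum_le_sum fun p hp => ?_
        obtain ⟨h1, h2, h3⟩ := hF p hp
        have hp0 : (0:ℝ) < p := by exact_mod_cast h1.pos
        rw [div_le_div_iff₀ (by positivity) (by positivity)]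
        have : t ≤ 2 * p := by nlinarith
        nlinarith
    _ = F.card * (2 / (t * δ)) := by rw [Finset.sum_const, nsmul_eq_mul]
    _ ≤ (480 * (t * δ) / Real.log x) * (2 / (t * δ)) := by gcongr
    _ = _ := by field_simp; norm_num

lemma smooth_sum (x : ℝ) (hx : (2:ℝ)^44 ≤ x) (δ : ℝ) (hδ : δ = 8 / √(√x)) (g : ℝ → ENNReal) (hg : Measurable g) :
    ∑ p ∈ PR x, ENNReal.ofReal (1 / (p * δ)) * ∫⁻ t in Set.Ioo (p:ℝ) (p * (1 + δ)), g t ≤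
      ENNReal.ofReal (960 / Real.log x) * ∫⁻ t in Set.Ioi (√x), g t := by
  classical
  have hx0 : 0 < x := by linarith [show (0:ℝ) < 2^44 by positivity]
  have hδ0 : 0 < δ := by rw [hδ]; positivity
  calc _ = ∑ p ∈ PR x, ∫⁻ t in Set.Ioi (√x), (Set.Ioo (p:ℝ) (p * (1 + δ))).indicator (fun t => ENNReal.ofReal (1 / (p * δ)) * g t) t := by
        refine Finset.sum_congr rfl fun p hp => ?_
        rw [mem_PR hx0.le] at hp
        rw [lintegral_indicator measurableSet_Ioo, Measure.restrict_restrict measurableSet_Ioo, Set.inter_eq_left.2, lintegral_const_mul _ hg]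
        intro t ht
        exact lt_trans hp.2.1 ht.1
    _ = ∫⁻ t in Set.Ioi (√x), ∑ p ∈ PR x, (Set.Ioo (p:ℝ) (p * (1 + δ))).indicator (fun t => ENNReal.ofReal (1 / (p * δ)) * g t) t := by
        rw [lintegral_finset_sum]
        intro p _
        exact (hg.const_mul _).indicator measurableSet_Ioo
    _ ≤ ∫⁻ t in Set.Ioi (√x), ENNReal.ofReal (960 / Real.log x) * g t := by
        refine setLIntegral_mono' measurableSet_Ioi fun t ht => ?_
        have e : ∀ p ∈ PR x, (Set.Ioo (p:ℝ) (p * (1 + δ))).indicator (fun t => ENNReal.ofReal (1 / (p * δ)) * g t) t =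
           (if t ∈ Set.Ioo (p:ℝ) (p * (1 + δ)) then ENNReal.ofReal (1 / (p * δ)) else 0) * g t := by
          intro p _
          rw [Set.indicator_apply]
          split_ifs <;> simp
        rw [Finset.sum_congr rfl e, ← Finset.sum_mul]
        refine mul_le_mul_left ?_ _
        rw [← Finset.sum_filter, ← ENNReal.ofReal_sum_of_nonneg (fun p _ => by positivity)]
        refine ENNReal.ofReal_le_ofReal (bt_weight x hx δ hδ t ht _ fun p hp => ?_)
        rw [Finset.mem_filter, mem_PR hx0.le] at hp
        exact ⟨hp.1.1, hp.2.1.le, hp.2.2⟩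
    _ = _ := lintegral_const_mul _ hg
end variance

section variance2

lemma Ssum_diff {a : ℕ → ℂ} (ha : CMu a) (u v : ℝ) (hu : 0 ≤ u) (huv : u ≤ v) : ‖Ssum a v - Ssum a u‖ ≤ v - u + 1 := by
  have hfl : ⌊u⌋₊ ≤ ⌊v⌋₊ := Nat.floor_mono huv
  have e : Ssum a v - Ssum a u = ∑ n ∈ Finset.Ioc ⌊u⌋₊ ⌊v⌋₊, a n := by
    unfold Ssum
    rw [sub_eq_iff_eq_add', ← Finset.sum_union]
    · congr 1
      ext n
      simp only [Finset.mem_union, Finset.mem_Icc, Finset.mem_Ioc]; omega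
    · rw [Finset.disjoint_left]; intro n; simp only [Finset.mem_Icc, Finset.mem_Ioc]; omega
  rw [e]
  refine (norm_sum_le _ _).trans ?_
  rw [Finset.sum_congr rfl (fun n hn => ha.norm n (by have := Finset.mem_Ioc.1 hn; omega))]
  rw [Finset.sum_const, Nat.card_Ioc, nsmul_eq_mul, mul_one, Nat.cast_sub hfl]
  have h1 : (⌊v⌋₊:ℝ) ≤ v := Nat.floor_le (hu.trans huv)
  have h2 := Nat.lt_floor_add_one u
  linarith

lemma Ssum_meas (a : ℕ → ℂ) (x : ℝ) : Measurable (fun t : ℝ => Ssum a (x / t)) := by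
  have h1 : Measurable (fun k : ℕ => ∑ n ∈ Finset.Icc 1 k, a n) := measurable_of_countable _
  exact h1.comp (Nat.measurable_floor.comp (by fun_prop))

lemma inv_sq_int (c : ℝ) (hc : 0 < c) : ∫⁻ t in Set.Ioi c, ENNReal.ofReal (1 / t^2) = ENNReal.ofReal (1 / c) := by
  have h1 := integrableOn_Ioi_rpow_of_lt (show (-2:ℝ) < -1 by norm_num) hc
  have h2 := integral_Ioi_rpow_of_lt (show (-2:ℝ) < -1 by norm_num) hc
  have e : ∀ t ∈ Set.Ioi c, ENNReal.ofReal (1 / t^2) = ENNReal.ofReal (t ^ (-2:ℝ)) := by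
    intro t ht
    have : 0 < t := lt_trans hc ht
    rw [rpow_neg this.le, show (2:ℝ) = ((2:ℕ):ℝ) by norm_num, rpow_natCast, one_div]
  rw [setLIntegral_congr_fun measurableSet_Ioi e, ← ofReal_integral_eq_lintegral_ofReal h1 ((ae_restrict_iff' measurableSet_Ioi).2 (ae_of_all _ fun t ht => by
     have : 0 < t := lt_trans hc ht
     positivity)), h2]
  congr 1
  norm_num
  rw [rpow_neg_one]

lemma V_le {a : ℕ → ℂ} (ha : CMu a) (x : ℝ) (hx : (2:ℝ)^44 ≤ x) (N : ℕ) (hN : √x ≤ N) :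
    ENNReal.ofReal (Vx a x) ≤ ENNReal.ofReal (960 / Real.log x) * (2 * (ENNReal.ofReal (x * LN N) * WN N a) + ENNReal.ofReal (264 * x)) := by
  have hx0 : 0 < x := by linarith [show (0:ℝ) < 2^44 by positivity]
  have hs0 : 0 < √x := by positivity
  have hN0 : (0:ℝ) < N := by linarith
  have hN1 : 1 ≤ N := by exact_mod_cast hN0
  set δ := 8 / √(√x) with hδ
  have hs : (2:ℝ)^22 ≤ √x := by
    apply Real.le_sqrt_of_sq_le; norm_num at hx ⊢; linarith
  have hss : (2:ℝ)^11 ≤ √(√x) := by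
    apply Real.le_sqrt_of_sq_le; norm_num at hs ⊢; linarith
  have hss0 : 0 < √(√x) := by positivity
  have hδ0 : 0 < δ := by rw [hδ]; positivity
  have hδ1 : δ ≤ 1 := by
    rw [hδ, div_le_one hss0]; norm_num at hss ⊢; linarith
  set g : ℝ → ENNReal := fun t => 2 * ENNReal.ofReal (‖Ssum a (x/t)‖^2) + (ENNReal.ofReal (4 * x^2 * δ^2) * ENNReal.ofReal (1 / t^2) + (Set.Iio (2*x)).indicator (fun _ => 4) t) with hgdef
  have hS := Ssum_meas a x
  have hg : Measurable g := by
    have hm1 : Measurable (fun t => 2 * ENNReal.ofReal (‖Ssum a (x/t)‖^2)) := by fun_prop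
    have hm2 : Measurable (fun t : ℝ => ENNReal.ofReal (4 * x^2 * δ^2) * ENNReal.ofReal (1 / t^2)) := by fun_prop
    have hm3 : Measurable ((Set.Iio (2*x)).indicator (fun _ : ℝ => (4:ENNReal))) := measurable_const.indicator measurableSet_Iio
    exact hm1.add (hm2.add hm3)
  have h1 : ENNReal.ofReal (Vx a x) ≤ ∑ p ∈ PR x, ENNReal.ofReal (1 / (p * δ)) * ∫⁻ t in Set.Ioo (p:ℝ) (p * (1 + δ)), g t := by
    unfold Vx
    rw [ENNReal.ofReal_sum_of_nonneg (fun p _ => by positivity)]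
    refine Finset.sum_le_sum fun p hp => ?_
    rw [mem_PR hx0.le] at hp
    obtain ⟨hp1, hp2, hp3⟩ := hp
    have hp0 : (0:ℝ) < p := by exact_mod_cast hp1.pos
    have pw : ∀ t ∈ Set.Ioo (p:ℝ) (p * (1+δ)), ENNReal.ofReal (‖Ssum a (x/p)‖^2) ≤ g t := by
      rintro t ⟨ht1, ht2⟩
      have ht0 : 0 < t := hp0.trans ht1
      have ht3 : t < 2 * x := by nlinarith
      simp only [hgdef]
      rw [Set.indicator_of_mem (by exact ht3)]
      rw [show (2:ENNReal) = ENNReal.ofReal 2 by simp, show (4:ENNReal) = ENNReal.ofReal 4 by simp,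
       ← ENNReal.ofReal_mul (by positivity), ← ENNReal.ofReal_mul (by positivity), ← ENNReal.ofReal_add (by positivity) (by positivity), ← ENNReal.ofReal_add (by positivity) (by positivity)]
      refine ENNReal.ofReal_le_ofReal ?_
      have hd := Ssum_diff ha (x/t) (x/p) (by positivity) (by gcongr)
      have hd2 : x / p - x / t ≤ x * δ / t := by
        rw [div_sub_div _ _ hp0.ne' ht0.ne', div_le_div_iff₀ (by positivity) ht0]
        have : t - p ≤ p * δ := by linarith
        have h5 : x * t * (t - p) ≤ x * t * (p * δ) := by gcongr
        nlinarith
      have h3 : ‖Ssum a (x/p)‖ ≤ ‖Ssum a (x/t)‖ + (x * δ / t + 1) := by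
        have := norm_add_le (Ssum a (x/t)) (Ssum a (x/p) - Ssum a (x/t))
        rw [add_sub_cancel] at this
        linarith
      have h4 : ‖Ssum a (x/p)‖^2 ≤ (‖Ssum a (x/t)‖ + (x * δ / t + 1))^2 := pow_le_pow_left₀ (norm_nonneg _) h3 2
      have e : 4 * x^2 * δ^2 * (1 / t^2) = 4 * (x * δ / t)^2 := by field_simp
      rw [e]
      nlinarith [sq_nonneg (‖Ssum a (x/t)‖ - (x * δ / t + 1)), sq_nonneg (x * δ / t - 1)]
    calc ENNReal.ofReal (‖Ssum a (x/p)‖^2) = ENNReal.ofReal (1 / (p*δ)) * ∫⁻ t in Set.Ioo (p:ℝ) (p * (1 + δ)), ENNReal.ofReal (‖Ssum a (x/p)‖^2) := by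
          rw [setLIntegral_const, Real.volume_Ioo, ← ENNReal.ofReal_mul (by positivity), ← ENNReal.ofReal_mul (by positivity)]
          congr 1
          field_simp; ring
      _ ≤ _ := by
          refine mul_le_mul_right ?_ _
          exact setLIntegral_mono' measurableSet_Ioo pw
  refine h1.trans ((smooth_sum x hx δ hδ g hg).trans (mul_le_mul_right ?_ _))
  simp only [hgdef]
  rw [lintegral_add_left (by fun_prop), lintegral_add_left (by fun_prop), lintegral_const_mul _ (by fun_prop), lintegral_const_mul _ (by fun_prop), inv_sq_int _ hs0,
    lintegral_indicator measurableSet_Iio, Measure.restrict_restrict measurableSet_Iio, setLIntegral_const]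
  refine add_le_add ?_ ?_
  · refine mul_le_mul_right ?_ _
    refine le_trans (lintegral_mono_set (Set.Ioi_subset_Ioi ?_)) (planch_main ha x hx0 N hN1)
    rw [div_le_iff₀ hN0]
    nlinarith [Real.mul_self_sqrt hx0.le]
  · have h5 : volume (Set.Iio (2*x) ∩ Set.Ioi (√x)) ≤ ENNReal.ofReal (2 * x) := by
      refine (measure_mono (t := Set.Ioo 0 (2*x)) ?_).trans ?_
      · rintro t ⟨h, h'⟩; exact ⟨lt_trans hs0 h', h⟩
      · rw [Real.volume_Ioo]; simp
    refine (add_le_add le_rfl (mul_le_mul_right h5 _)).trans ?_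
    rw [show (4:ENNReal) = ENNReal.ofReal 4 by simp, ← ENNReal.ofReal_mul (by positivity), ← ENNReal.ofReal_mul (by positivity), ← ENNReal.ofReal_add (by positivity) (by positivity)]
    refine ENNReal.ofReal_le_ofReal (le_of_eq ?_)
    have e1 : δ^2 * √x = 64 := by
      rw [hδ, div_pow, Real.sq_sqrt hs0.le]; field_simp; norm_num
    have e2 : 4 * x^2 * δ^2 * (1 / √x) = 256 * x := by
      rw [mul_one_div, div_eq_iff hs0.ne']
      have e3 : √x * √x = x := Real.mul_self_sqrt hx0.le
      have : 4 * x^2 * δ^2 * √x = 256 * x * √x * √x := by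
        calc 4 * x^2 * δ^2 * √x = 4 * x^2 * (δ^2 * √x) := by ring
          _ = 256 * x * x := by rw [e1]; ring
          _ = 256 * x * (√x * √x) := by rw [e3]
          _ = _ := by ring
      exact mul_right_cancel₀ hs0.ne' this
    rw [e2]; ring
end variance2

section variance3
variable {Ω : Type*} [MeasurableSpace Ω] {μ : Measure Ω} [IsProbabilityMeasure μ] {f : Ω → ℕ → ℂ}

lemma tend_ll : Tendsto (fun x : ℝ => Real.log (Real.log x)) atTop atTop :=
  Real.tendsto_log_atTop.comp Real.tendsto_log_atTop

lemma V_bound (hf : SRMF μ f) (η : ℝ) (hη : 0 < η) (hη2 : η < 1/2) :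
    ∀ᵐ ω ∂μ, ∃ x0 : ℝ, ∀ x ≥ x0, Vx (f ω) x ≤ x * Real.log (Real.log x) ^ (-(1/2) + η) := by
  obtain ⟨C, hC, hLN⟩ := LN_le
  filter_upwards [W_bound hf (η/2) (by linarith) (by linarith)] with ω ⟨N1, hN1⟩
  set K : ℝ := 3840 * C + 960 * 264 with hK
  have ev : ∀ᶠ x : ℝ in atTop, (2:ℝ)^44 ≤ x ∧ (N1:ℝ)^2 ≤ x ∧ 2 ≤ Real.log (Real.log x) ∧ K ≤ Real.log (Real.log x) ^ (η/2) := by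
    refine (eventually_ge_atTop _).and ((eventually_ge_atTop _).and ((tend_ll.eventually_ge_atTop 2).and ?_))
    exact ((tendsto_rpow_atTop (by linarith : 0 < η/2)).comp tend_ll).eventually_ge_atTop K
  obtain ⟨x0, h0⟩ := eventually_atTop.1 ev
  refine ⟨x0, fun x hx => ?_⟩
  obtain ⟨hx1, hx2, hL, hKL⟩ := h0 x hx
  have hx0 : 0 < x := by linarith [show (0:ℝ) < 2^44 by positivity]
  have hs : (2:ℝ)^22 ≤ √x := by
    apply Real.le_sqrt_of_sq_le; norm_num at hx1 ⊢; linarith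
  have hs0 : 0 < √x := by positivity
  set N := ⌈√x⌉₊
  have hN : √x ≤ N := Nat.le_ceil _
  have hNx : (N:ℝ) ≤ x := by
    have h1 : (N:ℝ) < √x + 1 := Nat.ceil_lt_add_one hs0.le
    have h2 := Real.mul_self_sqrt hx0.le
    norm_num at hs
    nlinarith
  have hNN1 : N ≥ N1 := by
    have : (N1:ℝ) ≤ N := le_trans (Real.le_sqrt_of_sq_le hx2) hN
    exact_mod_cast this
  have hN2 : 2 ≤ N := by
    have : (2:ℝ) ≤ N := by norm_num at hs; linarith
    exact_mod_cast this
  set L := Real.log (Real.log x) with hLdef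
  have hlx : 1 < Real.log x := by
    by_contra h
    push Not at h
    have h1 : (1:ℝ) < x := by norm_num at hx1; linarith
    have := Real.log_nonpos (Real.log_nonneg h1.le) h
    linarith
  have hlN : Real.log x / 2 ≤ Real.log N := by
    have := Real.log_le_log hs0 hN
    rw [Real.log_sqrt hx0.le] at this
    exact this
  have hlN2 : Real.log N ≤ Real.log x := Real.log_le_log (by linarith) hNx
  have hLN2 : L / 2 ≤ Real.log (Real.log N) := by
    have h1 := Real.log_le_log (by linarith) hlN
    rw [Real.log_div (by linarith) (by norm_num)] at h1
    have : Real.log 2 ≤ 1 := by linarith [Real.log_two_lt_d9]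
    linarith
  have hw : Real.log (Real.log N) ^ (-(1/2) + η/2) ≤ 2 * L ^ (-(1/2) + η/2) := by
    have h1 : Real.log (Real.log N) ^ (-(1/2) + η/2) ≤ (L/2) ^ (-(1/2) + η/2) :=
      rpow_le_rpow_of_nonpos (by linarith) hLN2 (by linarith)
    refine h1.trans ?_
    rw [div_rpow (by linarith) (by norm_num), div_eq_mul_inv, ← rpow_neg (by norm_num), mul_comm]
    have h2 : (2:ℝ) ^ (-(-(1/2) + η/2)) ≤ 2 ^ (1:ℝ) := rpow_le_rpow_of_exponent_le (by norm_num) (by linarith)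
    rw [rpow_one] at h2
    have : 0 ≤ L ^ (-(1/2) + η/2) := by apply rpow_nonneg; linarith
    exact mul_le_mul_of_nonneg_right h2 this
  set w := L ^ (-(1/2) + η/2) with hwdef
  have hw0 : 0 < w := by apply rpow_pos_of_pos; linarith
  have hlog : 1 / Real.log x ≤ w := by
    have h1 : L ≤ Real.log x := by
      have := Real.log_le_sub_one_of_pos (show 0 < Real.log x by linarith)
      linarith
    calc 1 / Real.log x ≤ 1 / L := by gcongr
      _ = L ^ (-1:ℝ) := by rw [rpow_neg_one, one_div]
      _ ≤ _ := rpow_le_rpow_of_exponent_le (by linarith) (by linarith)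
  have hV := V_le (cmu_f hf ω) x hx1 N hN
  have hWN := hN1 N hNN1
  have hfin : ENNReal.ofReal (Vx (f ω) x) ≤ ENNReal.ofReal (960 / Real.log x * (2 * (x * LN N * (2 * w)) + 264 * x)) := by
    refine hV.trans ?_
    rw [ENNReal.ofReal_mul (p := 960 / Real.log x) (by positivity)]
    refine mul_le_mul_right ?_ _
    have := LN_pos N
    rw [ENNReal.ofReal_add (by positivity) (by positivity)]
    refine add_le_add ?_ le_rfl
    rw [ENNReal.ofReal_mul (p := 2) (by positivity), ENNReal.ofReal_mul (p := x * LN N) (by positivity)]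
    rw [show ENNReal.ofReal 2 = (2:ENNReal) by simp]
    refine mul_le_mul_right ?_ _
    refine mul_le_mul_right ?_ _
    exact hWN.trans (ENNReal.ofReal_le_ofReal hw)
  have hL0 := LN_pos N
  have hR := (ENNReal.ofReal_le_ofReal_iff (by positivity)).1 hfin
  have hLNx : LN N ≤ C * Real.log x := (hLN N hN2).trans (by gcongr)
  refine hR.trans ?_
  have hlx0 : 0 < Real.log x := by linarith
  calc 960 / Real.log x * (2 * (x * LN N * (2 * w)) + 264 * x) 
      ≤ 960 / Real.log x * (2 * (x * (C * Real.log x) * (2 * w)) + 264 * x) := by gcongr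
    _ = x * (3840 * C * w + 960 * 264 * (1 / Real.log x)) := by field_simp; ring
    _ ≤ x * (3840 * C * w + 960 * 264 * w) := by gcongr
    _ = x * (K * w) := by rw [hK]; ring
    _ ≤ x * (L ^ (η/2) * w) := by gcongr
    _ = _ := by
        rw [hwdef, ← rpow_add (by linarith)]
        congr 2; ring
end variance3

section hoeff0
variable {Ω' : Type*} {m : MeasurableSpace Ω'}
lemma pm_sumC {ι : Type*} (F : Finset ι) (g : ι → Ω' → ℂ) (h : ∀ i ∈ F, Measurable (g i)) : Measurable (fun ω => ∑ i ∈ F, g i ω) :=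
  Finset.measurable_fun_sum F h
lemma pm_sumR {ι : Type*} (F : Finset ι) (g : ι → Ω' → ℝ) (h : ∀ i ∈ F, Measurable (g i)) : Measurable (fun ω => ∑ i ∈ F, g i ω) :=
  Finset.measurable_fun_sum F h
lemma pm_term (c : ℂ) (u v : Ω' → ℂ) (hu : Measurable u) (hv : Measurable v) : Measurable (fun ω => (c * u ω * v ω).re - ‖c * v ω‖^2 / 2) := by fun_prop
lemma pm_pair (u : Ω' → ℝ) (v : Ω' → ℂ) (hu : Measurable u) (hv : Measurable v) : Measurable (fun ω => (u ω, v ω)) := hu.prodMk hv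
end hoeff0

section hoeff
variable {Ω : Type*} [MeasurableSpace Ω] {μ : Measure Ω} [IsProbabilityMeasure μ] {f : Ω → ℕ → ℂ}

lemma uC_mgf (b : ℂ) : ∫⁻ z, ENNReal.ofReal (exp ((b * z).re)) ∂uC ≤ ENNReal.ofReal (exp (‖b‖^2 / 2)) := by
  set I := ∫⁻ z, ENNReal.ofReal (exp ((b * z).re)) ∂uC with hI
  have h1 : I = ∫⁻ z, ENNReal.ofReal (exp (-((b * z).re))) ∂uC := by
    have := uC_rot (-1) (by simp)
    rw [hI]
    nth_rewrite 1 [← this]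
    rw [lintegral_map (by fun_prop) (by fun_prop)]
    refine lintegral_congr fun z => ?_
    congr 2
    simp
  have h2 : 2 * I ≤ 2 * ENNReal.ofReal (exp (‖b‖^2 / 2)) := by
    rw [two_mul]
    nth_rewrite 2 [h1]
    rw [hI, ← lintegral_add_left (by fun_prop)]
    calc _ ≤ ∫⁻ z, 2 * ENNReal.ofReal (exp (‖b‖^2 / 2)) ∂uC := by
          refine lintegral_mono_ae ?_
          filter_upwards [uC_norm] with z hz
          rw [← ENNReal.ofReal_add (by positivity) (by positivity), show (2:ENNReal) = ENNReal.ofReal 2 by simp, ← ENNReal.ofReal_mul (by norm_num)]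
          refine ENNReal.ofReal_le_ofReal ?_
          have h3 := cosh_le_exp_half_sq ((b * z).re)
          rw [Real.cosh_eq] at h3
          have h4 : exp ((b*z).re^2/2) ≤ exp (‖b‖^2/2) := by
            refine exp_le_exp.2 ?_
            have h5 := Complex.abs_re_le_norm (b * z)
            rw [norm_mul, hz, mul_one] at h5
            have h6 := sq_le_sq' (neg_le_of_abs_le h5) (le_of_abs_le h5)
            linarith
          linarith
      _ = _ := by simp
  exact (ENNReal.mul_le_mul_iff_right (by simp) (by simp)).1 h2

def ZN (f : Ω → ℕ → ℂ) (c : ℂ) (x : ℝ) (N : ℕ) (ω : Ω) : ℝ :=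
  ∑ p ∈ (PR x).filter (· < N), ((c * f ω p * Ssum (f ω) (x / p)).re - ‖c * Ssum (f ω) (x / p)‖^2 / 2)

lemma Ssum_past (hf : SRMF μ f) (x : ℝ) (hx : 0 < x) (p : ℕ) (hp : p ∈ PR x) : Measurable[Past f p] (fun ω => Ssum (f ω) (x / p)) := by
  rw [mem_PR hx.le] at hp
  unfold Ssum
  refine pm_sumC _ (fun n ω => f ω n) fun n hn => ?_
  rw [Finset.mem_Icc, Nat.le_floor_iff (by positivity)] at hn
  refine Past_meas_lt hf.toIsSteinhausRMF n hn.1 ?_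
  have hs : 0 < √x := Real.sqrt_pos.2 hx
  have h1 : (n:ℝ) < p := by
    refine lt_of_le_of_lt hn.2 ?_
    rw [div_lt_iff₀ (by linarith)]
    nlinarith [Real.mul_self_sqrt hx.le]
  exact_mod_cast h1

lemma ZN_past (hf : SRMF μ f) (c : ℂ) (x : ℝ) (hx : 0 < x) (N : ℕ) : Measurable[Past f N] (ZN f c x N) := by
  unfold ZN
  refine pm_sumR _ (fun p ω => (c * f ω p * Ssum (f ω) (x / p)).re - ‖c * Ssum (f ω) (x / p)‖^2 / 2) fun p hp => ?_
  rw [Finset.mem_filter] at hp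
  have hp1 := (mem_PR hx.le).1 hp.1
  refine pm_term c _ _ (Past_meas_lt hf.toIsSteinhausRMF p hp1.1.one_lt.le hp.2) ?_
  exact (Ssum_past hf x hx p hp.1).mono (Past_mono f hp.2.le) le_rfl

lemma hoeff (hf : SRMF μ f) (c : ℂ) (x : ℝ) (hx : 0 < x) (N : ℕ) : ∫⁻ ω, ENNReal.ofReal (exp (ZN f c x N ω)) ∂μ ≤ 1 := by
  induction N with
  | zero => simp [ZN]
  | succ N ih =>
    by_cases hN : N ∈ PR x
    · have hNp := ((mem_PR hx.le).1 hN).1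
      have e : ∀ ω, ZN f c x (N+1) ω = ZN f c x N ω + ((c * f ω N * Ssum (f ω) (x / N)).re - ‖c * Ssum (f ω) (x / N)‖^2 / 2) := by
        intro ω
        unfold ZN
        have : (PR x).filter (· < N+1) = insert N ((PR x).filter (· < N)) := by
          ext q; simp only [Finset.mem_filter, Finset.mem_insert]
          constructor
          · rintro ⟨h1, h2⟩; rcases Nat.lt_succ_iff_lt_or_eq.1 h2 with h | h
            · exact Or.inr ⟨h1, h⟩
            · exact Or.inl h
          · rintro (h | h)
            · subst h; exact ⟨hN, by omega⟩
            · exact ⟨h.1, by omega⟩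
        rw [this, Finset.sum_insert (by simp), add_comm]
      have h1 := lintegral_step' hf.toIsSteinhausRMF hNp (fun ω => (ZN f c x N ω, Ssum (f ω) (x / N)))
        (pm_pair _ _ (ZN_past hf c x hx N) (Ssum_past hf x hx N hN))
        (fun q : (ℝ × ℂ) × ℂ => ENNReal.ofReal (exp (q.1.1 + ((c * q.2 * q.1.2).re - ‖c * q.1.2‖^2/2)))) (by fun_prop)
      simp only [] at h1
      simp_rw [e]
      rw [h1]
      refine le_trans (lintegral_mono fun ω => ?_) ih
      set s := Ssum (f ω) (x / N)
      calc ∫⁻ z, ENNReal.ofReal (exp (ZN f c x N ω + ((c * z * s).re - ‖c * s‖^2/2))) ∂uC 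
          = ∫⁻ z, ENNReal.ofReal (exp (ZN f c x N ω - ‖c * s‖^2/2)) * ENNReal.ofReal (exp ((c * s * z).re)) ∂uC := by
            refine lintegral_congr fun z => ?_
            rw [← ENNReal.ofReal_mul (by positivity), ← exp_add]
            rw [show c * z * s = c * s * z by ring]
            congr 2; ring
        _ = ENNReal.ofReal (exp (ZN f c x N ω - ‖c * s‖^2/2)) * ∫⁻ z, ENNReal.ofReal (exp ((c * s * z).re)) ∂uC := lintegral_const_mul _ (by fun_prop)
        _ ≤ ENNReal.ofReal (exp (ZN f c x N ω - ‖c * s‖^2/2)) * ENNReal.ofReal (exp (‖c * s‖^2/2)) := mul_le_mul_right (uC_mgf _) _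
        _ = _ := by
            rw [← ENNReal.ofReal_mul (by positivity), ← exp_add]; congr 2; ring
    · have : ∀ ω, ZN f c x (N+1) ω = ZN f c x N ω := by
        intro ω
        unfold ZN
        refine Finset.sum_congr ?_ fun _ _ => rfl
        ext q; simp only [Finset.mem_filter]
        constructor
        · rintro ⟨h1, h2⟩; rcases Nat.lt_succ_iff_lt_or_eq.1 h2 with h | h
          · exact ⟨h1, h⟩
          · subst h; exact absurd h1 hN
        · rintro ⟨h1, h2⟩; exact ⟨h1, by omega⟩
      simp_rw [this]; exact ih

def Mx (a : ℕ → ℂ) (x : ℝ) : ℂ := ∑ p ∈ PR x, a p * Ssum a (x / p)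

lemma ZN_top (c : ℂ) (x : ℝ) (ω : Ω) : ZN f c x (⌊x⌋₊ + 1) ω = (c * Mx (f ω) x).re - ‖c‖^2 * Vx (f ω) x / 2 := by
  have : (PR x).filter (· < ⌊x⌋₊ + 1) = PR x := by
    refine Finset.filter_true_of_mem fun p hp => ?_
    unfold PR at hp
    have := (Finset.mem_Icc.1 (Finset.mem_filter.1 hp).1).2
    omega
  unfold ZN
  rw [this, Finset.sum_sub_distrib]
  congr 1
  · unfold Mx
    rw [Finset.mul_sum, Complex.re_sum]
    refine Finset.sum_congr rfl fun p _ => by rw [mul_assoc]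
  · unfold Vx
    rw [Finset.mul_sum, Finset.sum_div]
    refine Finset.sum_congr rfl fun p _ => by rw [norm_mul, mul_pow]

lemma tail_dir (hf : SRMF μ f) (u : ℂ) (hu : ‖u‖ = 1) (x : ℝ) (hx : 0 < x) (s v : ℝ) (hs : 0 < s) (hv : 0 < v) :
    μ {ω | s ≤ (u * Mx (f ω) x).re ∧ Vx (f ω) x ≤ v} ≤ ENNReal.ofReal (exp (-(s^2 / (2 * v)))) := by
  set c : ℂ := ((s / v : ℝ) : ℂ) * u with hc
  have hcn : ‖c‖ = s / v := by rw [hc, norm_mul, hu, mul_one, Complex.norm_real, Real.norm_of_nonneg (by positivity)]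
  have h := hoeff hf c x hx (⌊x⌋₊ + 1)
  have hm : Measurable (fun ω => ENNReal.ofReal (exp (ZN f c x (⌊x⌋₊ + 1) ω))) := by
    have := (ZN_past hf c x hx (⌊x⌋₊ + 1)).mono (Past_le hf.toIsSteinhausRMF _) le_rfl
    fun_prop
  have h2 := mul_meas_ge_le_lintegral (μ := μ) hm (ENNReal.ofReal (exp (s^2 / (2*v))))
  have h3 : {ω | s ≤ (u * Mx (f ω) x).re ∧ Vx (f ω) x ≤ v} ⊆ {ω | ENNReal.ofReal (exp (s^2 / (2*v))) ≤ ENNReal.ofReal (exp (ZN f c x (⌊x⌋₊ + 1) ω))} := by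
    rintro ω ⟨h4, h5⟩
    refine ENNReal.ofReal_le_ofReal (exp_le_exp.2 ?_)
    rw [ZN_top, hcn, hc, mul_assoc, Complex.re_ofReal_mul]
    have e1 : s / v * s ≤ s / v * (u * Mx (f ω) x).re := by gcongr
    have e2 : (s/v)^2 * Vx (f ω) x ≤ (s/v)^2 * v := by gcongr
    have e3 : s / v * s - (s/v)^2 * v / 2 = s^2 / (2 * v) := by field_simp; ring
    linarith
  have h4 := (mul_le_mul_right (measure_mono (μ := μ) h3) (ENNReal.ofReal (exp (s^2 / (2*v))))).trans (h2.trans h)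
  have h5 := ofReal_div_bd (exp_pos (s^2/(2*v))) (h4.trans (le_of_eq (ENNReal.ofReal_one).symm))
  refine h5.trans (le_of_eq ?_)
  rw [exp_neg, one_div]

lemma tail_M (hf : SRMF μ f) (x : ℝ) (hx : 0 < x) (t v : ℝ) (ht : 0 < t) (hv : 0 < v) :
    μ {ω | t < ‖Mx (f ω) x‖ ∧ Vx (f ω) x ≤ v} ≤ ENNReal.ofReal (4 * exp (-(t^2 / (8 * v)))) := by
  have hsub : {ω | t < ‖Mx (f ω) x‖ ∧ Vx (f ω) x ≤ v} ⊆
     ({ω | t/2 ≤ ((1:ℂ) * Mx (f ω) x).re ∧ Vx (f ω) x ≤ v} ∪ {ω | t/2 ≤ ((-1:ℂ) * Mx (f ω) x).re ∧ Vx (f ω) x ≤ v}) ∪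
     ({ω | t/2 ≤ (Complex.I * Mx (f ω) x).re ∧ Vx (f ω) x ≤ v} ∪ {ω | t/2 ≤ (-Complex.I * Mx (f ω) x).re ∧ Vx (f ω) x ≤ v}) := by
    rintro ω ⟨h1, h2⟩
    have h3 := Complex.norm_le_abs_re_add_abs_im (Mx (f ω) x)
    simp only [Set.mem_union, Set.mem_setOf_eq, h2, and_true]
    simp only [one_mul, neg_mul, Complex.neg_re, Complex.I_mul_re, neg_neg]
    by_contra h
    push Not at h
    have := abs_lt.2 ⟨by linarith [h.1.2], h.1.1⟩
    have := abs_lt.2 ⟨by linarith [h.2.1], h.2.2⟩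
    linarith
  have e : ∀ u : ℂ, ‖u‖ = 1 → μ {ω | t/2 ≤ (u * Mx (f ω) x).re ∧ Vx (f ω) x ≤ v} ≤ ENNReal.ofReal (exp (-(t^2 / (8 * v)))) := by
    intro u hu
    refine (tail_dir hf u hu x hx (t/2) v (by linarith) hv).trans (le_of_eq ?_)
    congr 3; field_simp; norm_num
  refine (measure_mono hsub).trans ?_
  refine (measure_union_le _ _).trans ((add_le_add (measure_union_le _ _) (measure_union_le _ _)).trans ?_)
  refine (add_le_add (add_le_add (e 1 (by simp)) (e (-1) (by simp))) (add_le_add (e Complex.I (by simp)) (e (-Complex.I) (by simp)))).trans (le_of_eq ?_)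
  rw [← ENNReal.ofReal_add (by positivity) (by positivity), ← ENNReal.ofReal_add (by positivity) (by positivity)]
  congr 1; ring
end hoeff

section incr1

lemma Pfac_spec (n : ℕ) (hn : 2 ≤ n) : (Pfac n).Prime ∧ Pfac n ∣ n ∧ ∀ q : ℕ, q.Prime → q ∣ n → q ≤ Pfac n := by
  have h1 : n.primeFactors.Nonempty := Nat.nonempty_primeFactors.2 (by omega)
  have h2 : Pfac n = n.primeFactors.sup id := by unfold Pfac; rw [if_neg (by omega)]
  obtain ⟨p, hp, hp2⟩ := Finset.exists_mem_eq_sup n.primeFactors h1 id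
  rw [h2]
  refine ⟨?_, ?_, ?_⟩
  · rw [hp2]; exact Nat.prime_of_mem_primeFactors hp
  · rw [hp2]; exact Nat.dvd_of_mem_primeFactors hp
  · intro q hq hqn
    exact Finset.le_sup (f := id) (Nat.mem_primeFactors.2 ⟨hq, hqn, by omega⟩)

lemma Pfac_one : Pfac 1 = 1 := by simp [Pfac]

lemma Pfac_mul (p m : ℕ) (hp : p.Prime) (hm : 1 ≤ m) (hmp : m < p) : Pfac (p * m) = p := by
  have h2 : 2 ≤ p * m := le_trans hp.two_le (Nat.le_mul_of_pos_right p hm)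
  obtain ⟨h3, h4, h5⟩ := Pfac_spec (p * m) h2
  refine le_antisymm ?_ (h5 p hp (dvd_mul_right p m))
  rcases (Nat.Prime.dvd_mul h3).1 h4 with h | h
  · exact Nat.le_of_dvd hp.pos h
  · exact (Nat.le_of_dvd hm h).trans hmp.le

def Mq (a : ℕ → ℂ) (X : ℕ) : ℂ := ∑ n ∈ (Finset.Icc 1 X).filter (fun n => X < Pfac n ^ 2), a n

lemma thm_sum (a : ℕ → ℂ) (x : ℝ) (hx : 0 ≤ x) :
    ∑ n ∈ (Finset.Icc 1 ⌊x⌋₊).filter (fun n => Real.sqrt x < (Pfac n : ℝ)), a n = Mq a ⌊x⌋₊ := by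
  unfold Mq
  refine Finset.sum_congr (Finset.filter_congr fun n _ => ?_) fun _ _ => rfl
  rw [Real.sqrt_lt hx (by positivity), Nat.floor_lt hx]
  push_cast; rfl

lemma Mq_eq {a : ℕ → ℂ} (ha : CMu a) (X : ℕ) (hX : 1 ≤ X) : Mq a X = Mx a X := by
  unfold Mq Mx
  have hX0 : (0:ℝ) ≤ X := by positivity
  have hs : ∀ p : ℕ, √(X:ℝ) < p ↔ X < p^2 := by
    intro p
    rw [Real.sqrt_lt hX0 (by positivity)]
    exact_mod_cast Iff.rfl
  have hge : ∀ n ∈ (Finset.Icc 1 X).filter (fun n => X < Pfac n ^ 2), 2 ≤ n := by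
    intro n hn
    rw [Finset.mem_filter, Finset.mem_Icc] at hn
    by_contra h
    have : n = 1 := by omega
    subst this
    rw [Pfac_one] at hn
    omega
  have hmap : ∀ n ∈ (Finset.Icc 1 X).filter (fun n => X < Pfac n ^ 2), Pfac n ∈ PR (X:ℝ) := by
    intro n hn
    obtain ⟨h1, h2, h3⟩ := Pfac_spec n (hge n hn)
    rw [Finset.mem_filter, Finset.mem_Icc] at hn
    rw [mem_PR hX0, hs]
    refine ⟨h1, hn.2, ?_⟩
    exact_mod_cast (Nat.le_of_dvd hn.1.1 h2).trans hn.1.2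
  rw [← Finset.sum_fiberwise_of_maps_to hmap]
  refine Finset.sum_congr rfl fun p hp => ?_
  rw [mem_PR hX0, hs] at hp
  obtain ⟨hp1, hp2, hp3⟩ := hp
  unfold Ssum
  rw [Finset.mul_sum, Nat.floor_div_natCast, Nat.floor_natCast]
  symm
  have hmlt : ∀ m, m ≤ X / p → m < p := by
    intro m hm
    have h1 : m * p ≤ X := (Nat.le_div_iff_mul_le hp1.pos).1 hm
    by_contra h
    push Not at h
    nlinarith
  refine Finset.sum_bij' (fun m _ => p * m) (fun n _ => n / p) ?_ ?_ ?_ ?_ ?_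
  · intro m hm
    rw [Finset.mem_Icc] at hm
    have hlt := hmlt m hm.2
    rw [Finset.mem_filter, Finset.mem_filter, Finset.mem_Icc, Pfac_mul p m hp1 hm.1 hlt]
    refine ⟨⟨⟨Nat.mul_pos hp1.pos hm.1, ?_⟩, hp2⟩, rfl⟩
    rw [mul_comm]; exact (Nat.le_div_iff_mul_le hp1.pos).1 hm.2
  · intro n hn
    rw [Finset.mem_filter] at hn
    obtain ⟨h1, h2, h3⟩ := Pfac_spec n (hge n hn.1)
    rw [hn.2] at h2
    rw [Finset.mem_filter, Finset.mem_Icc] at hn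
    rw [Finset.mem_Icc]
    exact ⟨Nat.div_pos (Nat.le_of_dvd hn.1.1.1 h2) hp1.pos, Nat.div_le_div_right hn.1.1.2⟩
  · intro m hm
    exact Nat.mul_div_cancel_left m hp1.pos
  · intro n hn
    rw [Finset.mem_filter] at hn
    obtain ⟨h1, h2, h3⟩ := Pfac_spec n (hge n hn.1)
    rw [hn.2] at h2
    exact Nat.mul_div_cancel' h2
  · intro m hm
    rw [Finset.mem_Icc] at hm
    exact (ha.mul p m hp1.one_lt.le hm.1).symm

/-- index set of the increment -/
def Wset (a b : ℕ) : Finset ℕ := ((Finset.Ioc (Nat.sqrt a) (Nat.sqrt b)).filter Nat.Prime).biUnion (fun p => (Finset.Icc 1 p).image (fun m => p * m))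
def Fset (a b : ℕ) : Finset ℕ := Finset.Ioc a b ∪ Wset a b

lemma Fset_pos {a b n : ℕ} (h : n ∈ Fset a b) : 1 ≤ n := by
  unfold Fset Wset at h
  rw [Finset.mem_union] at h
  rcases h with h | h
  · have := Finset.mem_Ioc.1 h; omega
  · rw [Finset.mem_biUnion] at h
    obtain ⟨p, hp, h⟩ := h
    rw [Finset.mem_image] at h
    obtain ⟨m, hm, rfl⟩ := h
    rw [Finset.mem_Icc] at hm
    exact Nat.mul_pos (Finset.mem_filter.1 hp).2.pos hm.1

def cco (a b n : ℕ) : ℂ := (if n ≤ b ∧ b < Pfac n ^ 2 then 1 else 0) - (if n ≤ a ∧ a < Pfac n ^ 2 then 1 else 0)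

lemma cco_norm (a b n : ℕ) : ‖cco a b n‖ ≤ 1 := by
  unfold cco
  split_ifs <;> simp

lemma incr_eq (g : ℕ → ℂ) (a b : ℕ) (ha : 1 ≤ a) (hab : a ≤ b) : Mq g b - Mq g a = ∑ n ∈ Fset a b, cco a b n * g n := by
  have h1 : ∀ c ≤ b, Mq g c = ∑ n ∈ Finset.Icc 1 b, (if n ≤ c ∧ c < Pfac n ^ 2 then 1 else 0) * g n := by
    intro c hc
    unfold Mq
    simp only [ite_mul, one_mul, zero_mul]
    rw [← Finset.sum_filter]
    refine Finset.sum_congr ?_ fun _ _ => rfl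
    ext n
    simp only [Finset.mem_filter, Finset.mem_Icc]
    constructor
    · rintro ⟨⟨h1, h2⟩, h3⟩; exact ⟨⟨h1, h2.trans hc⟩, h2, h3⟩
    · rintro ⟨⟨h1, _⟩, h2, h3⟩; exact ⟨⟨h1, h2⟩, h3⟩
  rw [h1 b le_rfl, h1 a hab, ← Finset.sum_sub_distrib]
  have h2 : ∀ n, (if n ≤ b ∧ b < Pfac n ^ 2 then 1 else 0) * g n - (if n ≤ a ∧ a < Pfac n ^ 2 then 1 else 0) * g n = cco a b n * g n := by
    intro n; unfold cco; ring
  simp_rw [h2]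
  have hz1 : ∀ n, n ∈ Finset.Icc 1 b → n ∉ Fset a b → cco a b n * g n = 0 := by
    intro n hn hF
    rw [Finset.mem_Icc] at hn
    have hna : n ≤ a := by
      by_contra h
      exact hF (Finset.mem_union_left _ (Finset.mem_Ioc.2 ⟨by omega, hn.2⟩))
    suffices cco a b n = 0 by rw [this, zero_mul]
    unfold cco
    by_cases hP : a < Pfac n ^ 2
    · have hb : b < Pfac n ^ 2 := by
        by_contra hb
        push Not at hb
        apply hF
        refine Finset.mem_union_right _ ?_
        have hn2 : 2 ≤ n := by
          by_contra h
          have : n = 1 := by omega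
          subst this
          rw [Pfac_one] at hP
          omega
        obtain ⟨p1, p2, p3⟩ := Pfac_spec n hn2
        unfold Wset
        rw [Finset.mem_biUnion]
        refine ⟨Pfac n, ?_, ?_⟩
        · rw [Finset.mem_filter, Finset.mem_Ioc]
          refine ⟨⟨?_, ?_⟩, p1⟩
          · rw [Nat.sqrt_lt']; exact hP
          · rw [Nat.le_sqrt']; exact hb
        · rw [Finset.mem_image]
          refine ⟨n / Pfac n, ?_, Nat.mul_div_cancel' p2⟩
          rw [Finset.mem_Icc]
          refine ⟨Nat.div_pos (Nat.le_of_dvd (by omega) p2) p1.pos, ?_⟩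
          rw [Nat.div_le_iff_le_mul_add_pred p1.pos]
          nlinarith
      rw [if_pos ⟨hn.2, hb⟩, if_pos ⟨hna, hP⟩, sub_self]
    · have hb : ¬ b < Pfac n ^ 2 := fun h => hP (lt_of_le_of_lt hab h)
      rw [if_neg (fun h => hb h.2), if_neg (fun h => hP h.2), sub_self]
  have hz2 : ∀ n, n ∈ Fset a b → n ∉ Finset.Icc 1 b → cco a b n * g n = 0 := by
    intro n hn hI
    have h1 := Fset_pos hn
    have h2 : b < n := by
      by_contra h
      exact hI (Finset.mem_Icc.2 ⟨h1, by omega⟩)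
    unfold cco
    rw [if_neg (fun h => by omega), if_neg (fun h => by omega)]; simp
  calc _ = ∑ n ∈ Finset.Icc 1 b ∪ Fset a b, cco a b n * g n := 
        Finset.sum_subset Finset.subset_union_left fun n hn h => by
          rcases Finset.mem_union.1 hn with h' | h'
          · exact absurd h' h
          · exact hz2 n h' h
    _ = _ := (Finset.sum_subset Finset.subset_union_right fun n hn h => by
          rcases Finset.mem_union.1 hn with h' | h'
          · exact hz1 n h' h
          · exact absurd h' h).symm

end incr1

section moment4
variable {Ω : Type*} [MeasurableSpace Ω] {μ : Measure Ω} [IsProbabilityMeasure μ] {f : Ω → ℕ → ℂ}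

lemma normsq_sum' {ι : Type*} (F : Finset ι) (g : ι → ℂ) : ((‖∑ n ∈ F, g n‖^2 : ℝ) : ℂ) = ∑ m ∈ F, ∑ n ∈ F, g m * (starRingEnd ℂ) (g n) := by
  push_cast
  rw [← Complex.mul_conj', map_sum, Finset.sum_mul_sum]

lemma divisors_mul_card (m n : ℕ) : (m * n).divisors.card ≤ m.divisors.card * n.divisors.card := by
  rw [Nat.divisors_mul]
  exact Finset.card_mul_le

lemma pair_count (F : Finset ℕ) (hF : ∀ n ∈ F, 1 ≤ n) (N : ℕ) (hN : 1 ≤ N) : ((F ×ˢ F).filter (fun q => N = q.1 * q.2)).card ≤ N.divisors.card := by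
  refine Finset.card_le_card_of_injOn (fun q => q.1) ?_ ?_
  · intro q hq
    have hq := Finset.mem_filter.1 hq
    exact Nat.mem_divisors.2 ⟨⟨q.2, hq.2⟩, by omega⟩
  · intro q hq q' hq' h
    have hq := Finset.mem_filter.1 hq
    have hq' := Finset.mem_filter.1 hq'
    have h1 : q.1 = q'.1 := h
    have hpos := hF q.1 (Finset.mem_product.1 hq.1).1
    refine Prod.ext h1 ?_
    have h2 : q.1 * q.2 = q.1 * q'.2 := by rw [← hq.2, hq'.2, h1]
    exact Nat.eq_of_mul_eq_mul_left hpos h2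

lemma moment4 (hf : SRMF μ f) (F : Finset ℕ) (hF : ∀ n ∈ F, 1 ≤ n) (c : ℕ → ℂ) (hc : ∀ n, ‖c n‖ ≤ 1) :
    ∫ ω, ‖∑ n ∈ F, c n * f ω n‖^4 ∂μ ≤ ((∑ n ∈ F, n.divisors.card : ℕ) : ℝ)^2 := by
  set P := F ×ˢ F
  have hP : ∀ q ∈ P, 1 ≤ q.1 ∧ 1 ≤ q.2 := fun q hq => ⟨hF _ (Finset.mem_product.1 hq).1, hF _ (Finset.mem_product.1 hq).2⟩
  have e1 : ∀ ω, ((‖∑ n ∈ F, c n * f ω n‖^4 : ℝ) : ℂ) = ∑ q ∈ P, ∑ q' ∈ P, (c q.1 * c q.2 * (starRingEnd ℂ) (c q'.1 * c q'.2)) * (f ω (q.1 * q.2) * (starRingEnd ℂ) (f ω (q'.1 * q'.2))) := by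
    intro ω
    have h1 : ‖∑ n ∈ F, c n * f ω n‖^4 = ‖∑ q ∈ P, (c q.1 * f ω q.1) * (c q.2 * f ω q.2)‖^2 := by
      have : ∑ q ∈ P, (c q.1 * f ω q.1) * (c q.2 * f ω q.2) = (∑ n ∈ F, c n * f ω n) * (∑ n ∈ F, c n * f ω n) := by
        rw [Finset.sum_mul_sum, ← Finset.sum_product']
      rw [this, norm_mul]; ring
    rw [h1, normsq_sum']
    refine Finset.sum_congr rfl fun q hq => Finset.sum_congr rfl fun q' hq' => ?_
    rw [hf.map_mul ω _ _ (hP q hq).1 (hP q hq).2, hf.map_mul ω _ _ (hP q' hq').1 (hP q' hq').2]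
    simp only [map_mul]; ring
  have hintg : ∀ q ∈ P, ∀ q' ∈ P, Integrable (fun ω => (c q.1 * c q.2 * (starRingEnd ℂ) (c q'.1 * c q'.2)) * (f ω (q.1 * q.2) * (starRingEnd ℂ) (f ω (q'.1 * q'.2)))) μ := by
    intro q hq q' hq'
    refine Integrable.const_mul ?_ _
    refine Integrable.of_bound (C := 1) ?_ (ae_of_all _ fun ω => ?_)
    · have := hf.meas (q.1 * q.2)
      have := hf.meas (q'.1 * q'.2)
      exact ((hf.meas (q.1 * q.2)).mul (Complex.continuous_conj.measurable.comp (hf.meas (q'.1 * q'.2)))).aestronglyMeasurable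
    · rw [norm_mul, Complex.norm_conj, hf.norm_one ω _ (Nat.mul_pos (hP q hq).1 (hP q hq).2), hf.norm_one ω _ (Nat.mul_pos (hP q' hq').1 (hP q' hq').2), one_mul]
  have e2 : ((∫ ω, ‖∑ n ∈ F, c n * f ω n‖^4 ∂μ : ℝ) : ℂ) = ∑ q ∈ P, ∑ q' ∈ P, (c q.1 * c q.2 * (starRingEnd ℂ) (c q'.1 * c q'.2)) * (if q.1 * q.2 = q'.1 * q'.2 then 1 else 0) := by
    rw [← integral_complex_ofReal]
    simp_rw [e1]
    rw [integral_finset_sum _ (fun q hq => integrable_finset_sum _ (hintg q hq))]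
    refine Finset.sum_congr rfl fun q hq => ?_
    rw [integral_finset_sum _ (hintg q hq)]
    refine Finset.sum_congr rfl fun q' hq' => ?_
    rw [integral_const_mul, orthonormal_f hf _ _ (Nat.mul_pos (hP q hq).1 (hP q hq).2) (Nat.mul_pos (hP q' hq').1 (hP q' hq').2)]
  have h0 : 0 ≤ ∫ ω, ‖∑ n ∈ F, c n * f ω n‖^4 ∂μ := integral_nonneg fun ω => by positivity
  have e3 : ∫ ω, ‖∑ n ∈ F, c n * f ω n‖^4 ∂μ = ‖((∫ ω, ‖∑ n ∈ F, c n * f ω n‖^4 ∂μ : ℝ) : ℂ)‖ := by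
    rw [Complex.norm_real, Real.norm_of_nonneg h0]
  rw [e3, e2]
  calc _ ≤ ∑ q ∈ P, ∑ q' ∈ P, (if q.1 * q.2 = q'.1 * q'.2 then (1:ℝ) else 0) := by
        refine (norm_sum_le _ _).trans (Finset.sum_le_sum fun q hq => (norm_sum_le _ _).trans (Finset.sum_le_sum fun q' hq' => ?_))
        rw [norm_mul]
        have h1 : ‖c q.1 * c q.2 * (starRingEnd ℂ) (c q'.1 * c q'.2)‖ ≤ 1 := by
          rw [norm_mul, norm_mul, Complex.norm_conj, norm_mul]
          have a1 := mul_le_one₀ (hc q.1) (norm_nonneg _) (hc q.2)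
          have a2 := mul_le_one₀ (hc q'.1) (norm_nonneg _) (hc q'.2)
          exact mul_le_one₀ a1 (by positivity) a2
        split_ifs
        · simpa using h1
        · simp
    _ ≤ ∑ q ∈ P, ((q.1.divisors.card * q.2.divisors.card : ℕ) : ℝ) := by
        refine Finset.sum_le_sum fun q hq => ?_
        rw [Finset.sum_boole]
        exact_mod_cast (pair_count F hF (q.1 * q.2) (Nat.mul_pos (hP q hq).1 (hP q hq).2)).trans (divisors_mul_card _ _)
    _ = _ := by
        rw [sq]
        push_cast
        rw [Finset.sum_mul_sum, ← Finset.sum_product']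

lemma markov4 (hf : SRMF μ f) (F : Finset ℕ) (hF : ∀ n ∈ F, 1 ≤ n) (c : ℕ → ℂ) (hc : ∀ n, ‖c n‖ ≤ 1) (D s : ℝ) (hs : 0 < s)
    (hD : ((∑ n ∈ F, n.divisors.card : ℕ) : ℝ) ≤ D) :
    μ {ω | s < ‖∑ n ∈ F, c n * f ω n‖} ≤ ENNReal.ofReal (D^2 / s^4) := by
  have hm : Measurable (fun ω => ∑ n ∈ F, c n * f ω n) := Finset.measurable_fun_sum _ fun n _ => (hf.meas n).const_mul _
  have hi : Integrable (fun ω => ‖∑ n ∈ F, c n * f ω n‖^4) μ := by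
    refine Integrable.of_bound (C := (F.card : ℝ)^4) (hm.norm.pow_const 4).aestronglyMeasurable (ae_of_all _ fun ω => ?_)
    rw [Real.norm_of_nonneg (by positivity)]
    refine pow_le_pow_left₀ (norm_nonneg _) ?_ 4
    refine (norm_sum_le _ _).trans ?_
    calc _ ≤ ∑ n ∈ F, (1:ℝ) := Finset.sum_le_sum fun n hn => by
            rw [norm_mul, hf.norm_one ω n (hF n hn), mul_one]; exact hc n
      _ = _ := by simp
  have h1 := moment4 hf F hF c hc
  have h2 : ∫⁻ ω, ENNReal.ofReal (‖∑ n ∈ F, c n * f ω n‖^4) ∂μ ≤ ENNReal.ofReal (D^2) := by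
    rw [← ofReal_integral_eq_lintegral_ofReal hi (ae_of_all _ fun ω => by positivity)]
    refine ENNReal.ofReal_le_ofReal (h1.trans ?_)
    gcongr
  have h3 := mul_meas_ge_le_lintegral (μ := μ) (f := fun ω => ENNReal.ofReal (‖∑ n ∈ F, c n * f ω n‖^4)) (ENNReal.measurable_ofReal.comp (hm.norm.pow_const 4)) (ENNReal.ofReal (s^4))
  have h4 : {ω | s < ‖∑ n ∈ F, c n * f ω n‖} ⊆ {ω | ENNReal.ofReal (s^4) ≤ ENNReal.ofReal (‖∑ n ∈ F, c n * f ω n‖^4)} := by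
    intro ω hω
    have hω : s < ‖∑ n ∈ F, c n * f ω n‖ := hω
    exact ENNReal.ofReal_le_ofReal (by gcongr)
  exact ofReal_div_bd (by positivity) ((mul_le_mul_right (measure_mono (μ := μ) h4) _).trans (h3.trans h2))

end moment4

section divsum

lemma sumNat_biUnion_le (s : Finset ℕ) (t : ℕ → Finset ℕ) (g : ℕ → ℕ) : ∑ n ∈ s.biUnion t, g n ≤ ∑ i ∈ s, ∑ n ∈ t i, g n := by
  classical
  induction s using Finset.induction_on with
  | empty => simp
  | insert i s hi ih =>
    rw [Finset.biUnion_insert, Finset.sum_insert hi]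
    have := Finset.sum_union_inter (s₁ := t i) (s₂ := s.biUnion t) (f := g)
    omega

lemma div_half (n b : ℕ) (hn : 1 ≤ n) (hnb : n ≤ b) : n.divisors.card ≤ 2 * ((Finset.Icc 1 (Nat.sqrt b)).filter (fun d => d ∣ n)).card := by
  have h1 := Finset.card_filter_add_card_filter_not (s := n.divisors) (fun d => d ≤ Nat.sqrt n)
  have hs : Nat.sqrt n ≤ Nat.sqrt b := Nat.sqrt_le_sqrt hnb
  have h2 : (n.divisors.filter (fun d => d ≤ Nat.sqrt n)).card ≤ ((Finset.Icc 1 (Nat.sqrt b)).filter (fun d => d ∣ n)).card := by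
    refine Finset.card_le_card fun d hd => ?_
    rw [Finset.mem_filter, Nat.mem_divisors] at hd
    rw [Finset.mem_filter, Finset.mem_Icc]
    exact ⟨⟨Nat.pos_of_dvd_of_pos hd.1.1 hn, hd.2.trans hs⟩, hd.1.1⟩
  have h3 : (n.divisors.filter (fun d => ¬ d ≤ Nat.sqrt n)).card ≤ ((Finset.Icc 1 (Nat.sqrt b)).filter (fun d => d ∣ n)).card := by
    refine Finset.card_le_card_of_injOn (fun d => n / d) ?_ ?_
    · intro d hd
      have hd := Finset.mem_filter.1 hd
      rw [Nat.mem_divisors] at hd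
      obtain ⟨⟨hd1, _⟩, hd2⟩ := hd
      have hd0 : 0 < d := Nat.pos_of_dvd_of_pos hd1 hn
      push Not at hd2
      refine Finset.mem_coe.2 (Finset.mem_filter.2 ⟨Finset.mem_Icc.2 ⟨Nat.div_pos (Nat.le_of_dvd hn hd1) hd0, ?_⟩, Nat.div_dvd_of_dvd hd1⟩)
      refine le_trans ?_ hs
      have h5 : n < (Nat.sqrt n + 1) * (Nat.sqrt n + 1) := Nat.lt_succ_sqrt n
      have h6 : n / d < Nat.sqrt n + 1 := by
        rw [Nat.div_lt_iff_lt_mul hd0]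
        refine lt_of_lt_of_le h5 (Nat.mul_le_mul_left _ hd2)
      show n / d ≤ Nat.sqrt n
      omega
    · intro d hd d' hd' h
      have hd := Finset.mem_filter.1 hd
      have hd' := Finset.mem_filter.1 hd'
      rw [Nat.mem_divisors] at hd hd'
      have h : n / d = n / d' := h
      have e1 := Nat.div_mul_cancel hd.1.1
      have e2 := Nat.div_mul_cancel hd'.1.1
      have h0 : 0 < n / d := Nat.div_pos (Nat.le_of_dvd hn hd.1.1) (Nat.pos_of_dvd_of_pos hd.1.1 hn)
      rw [← h] at e2
      exact Nat.eq_of_mul_eq_mul_left h0 (e1.trans e2.symm)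
  omega

lemma mult_count (a b d : ℕ) (hd : 1 ≤ d) (hab : a ≤ b) : (((Finset.Ioc a b).filter (fun n => d ∣ n)).card : ℝ) ≤ ((b:ℝ) - a) * (d:ℝ)⁻¹ + 1 := by
  have hd0 : (0:ℝ) < d := by exact_mod_cast hd
  have h1 : ((Finset.Ioc a b).filter (fun n => d ∣ n)).card ≤ (Finset.Ioc (a/d) (b/d)).card := by
    refine Finset.card_le_card_of_injOn (fun n => n / d) ?_ ?_
    · intro n hn
      have hn := Finset.mem_filter.1 hn
      rw [Finset.mem_Ioc] at hn
      refine Finset.mem_coe.2 (Finset.mem_Ioc.2 ⟨?_, Nat.div_le_div_right hn.1.2⟩)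
      rw [Nat.div_lt_iff_lt_mul hd, Nat.div_mul_cancel hn.2]
      exact hn.1.1
    · intro n hn n' hn' h
      have hn := Finset.mem_filter.1 hn
      have hn' := Finset.mem_filter.1 hn'
      have h : n / d = n' / d := h
      rw [← Nat.div_mul_cancel hn.2, ← Nat.div_mul_cancel hn'.2, h]
  rw [Nat.card_Ioc] at h1
  have h2 : a / d ≤ b / d := Nat.div_le_div_right hab
  have h3 : (((Finset.Ioc a b).filter (fun n => d ∣ n)).card : ℝ) ≤ ((b/d : ℕ) : ℝ) - ((a/d : ℕ) : ℝ) := by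
    rw [← Nat.cast_sub h2]; exact_mod_cast h1
  have h4 : ((b/d : ℕ) : ℝ) ≤ (b:ℝ) / d := Nat.cast_div_le
  have h5 : (a:ℝ) / d < ((a/d : ℕ) : ℝ) + 1 := by
    rw [div_lt_iff₀ hd0]
    have : a < (a / d + 1) * d := by
      have := Nat.div_add_mod a d
      have := Nat.mod_lt a hd
      nlinarith
    exact_mod_cast this
  rw [sub_mul, ← div_eq_mul_inv, ← div_eq_mul_inv]
  linarith

lemma div_sum (a b : ℕ) (hab : a ≤ b) (hb : 1 ≤ b) : ((∑ n ∈ Finset.Ioc a b, n.divisors.card : ℕ) : ℝ) ≤ 2 * (((b:ℝ) - a) * (1 + Real.log b) + √b) := by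
  have h1 : ∑ n ∈ Finset.Ioc a b, n.divisors.card ≤ 2 * ∑ d ∈ Finset.Icc 1 (Nat.sqrt b), ((Finset.Ioc a b).filter (fun n => d ∣ n)).card := by
    calc _ ≤ ∑ n ∈ Finset.Ioc a b, 2 * ((Finset.Icc 1 (Nat.sqrt b)).filter (fun d => d ∣ n)).card := by
          refine Finset.sum_le_sum fun n hn => ?_
          rw [Finset.mem_Ioc] at hn
          exact div_half n b (by omega) hn.2
      _ = _ := by
          rw [← Finset.mul_sum]
          congr 1
          simp only [Finset.card_filter]
          exact Finset.sum_comm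
  have hab' : (0:ℝ) ≤ (b:ℝ) - a := by
    have : (a:ℝ) ≤ b := by exact_mod_cast hab
    linarith
  have h2 : (∑ d ∈ Finset.Icc 1 (Nat.sqrt b), (((Finset.Ioc a b).filter (fun n => d ∣ n)).card : ℝ)) ≤ ((b:ℝ) - a) * (1 + Real.log b) + √b := by
    calc _ ≤ ∑ d ∈ Finset.Icc 1 (Nat.sqrt b), (((b:ℝ) - a) * (d:ℝ)⁻¹ + 1) := by
          refine Finset.sum_le_sum fun d hd => ?_
          exact mult_count a b d (Finset.mem_Icc.1 hd).1 hab
      _ = ((b:ℝ) - a) * (∑ d ∈ Finset.Icc 1 (Nat.sqrt b), (d:ℝ)⁻¹) + Nat.sqrt b := by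
          rw [Finset.sum_add_distrib, ← Finset.mul_sum]; simp
      _ ≤ _ := by
          have h3 := harmonic_le_one_add_log (Nat.sqrt b)
          rw [harmonic_eq_sum_Icc] at h3
          push_cast at h3
          have hs1 : 1 ≤ Nat.sqrt b := Nat.le_sqrt.2 (by omega)
          have h4 : Real.log (Nat.sqrt b) ≤ Real.log b := Real.log_le_log (by exact_mod_cast hs1) (by exact_mod_cast Nat.sqrt_le_self b)
          have h5 : (Nat.sqrt b : ℝ) ≤ √b := Real.nat_sqrt_le_real_sqrt
          have h6 : ((b:ℝ) - a) * (∑ d ∈ Finset.Icc 1 (Nat.sqrt b), (d:ℝ)⁻¹) ≤ ((b:ℝ) - a) * (1 + Real.log b) := mul_le_mul_of_nonneg_left (by linarith) hab'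
          linarith
  calc ((∑ n ∈ Finset.Ioc a b, n.divisors.card : ℕ) : ℝ) ≤ ((2 * ∑ d ∈ Finset.Icc 1 (Nat.sqrt b), ((Finset.Ioc a b).filter (fun n => d ∣ n)).card : ℕ) : ℝ) := by exact_mod_cast h1
    _ = 2 * ∑ d ∈ Finset.Icc 1 (Nat.sqrt b), (((Finset.Ioc a b).filter (fun n => d ∣ n)).card : ℝ) := by push_cast; rfl
    _ ≤ _ := by linarith

lemma W_sum (a b : ℕ) (ha : 1 ≤ a) (hab : a ≤ b) : ((∑ n ∈ Wset a b, n.divisors.card : ℕ) : ℝ) ≤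
    (((b:ℝ) - a) / √a + 1) * (4 * (√b * (1 + Real.log b) + √b)) := by
  have hb : 1 ≤ b := ha.trans hab
  have ha0 : (0:ℝ) < a := by exact_mod_cast ha
  have hab' : (a:ℝ) ≤ b := by exact_mod_cast hab
  have hb1 : (1:ℝ) ≤ b := by exact_mod_cast hb
  have h1 : ∑ n ∈ Wset a b, n.divisors.card ≤ ∑ p ∈ (Finset.Ioc (Nat.sqrt a) (Nat.sqrt b)).filter Nat.Prime, 2 * ∑ m ∈ Finset.Icc 1 p, m.divisors.card := by
    unfold Wset
    refine (sumNat_biUnion_le _ _ _).trans (Finset.sum_le_sum fun p hp => ?_)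
    have hpp := (Finset.mem_filter.1 hp).2
    rw [Finset.sum_image (fun m _ m' _ h => Nat.eq_of_mul_eq_mul_left hpp.pos h), Finset.mul_sum]
    refine Finset.sum_le_sum fun m _ => ?_
    refine (divisors_mul_card p m).trans (le_of_eq ?_)
    rw [Nat.Prime.divisors hpp, Finset.card_pair hpp.one_lt.ne]
  have h2 : ∀ p ∈ (Finset.Ioc (Nat.sqrt a) (Nat.sqrt b)).filter Nat.Prime, ((2 * ∑ m ∈ Finset.Icc 1 p, m.divisors.card : ℕ) : ℝ) ≤ 4 * (√b * (1 + Real.log b) + √b) := by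
    intro p hp
    have hpp := (Finset.mem_filter.1 hp).2
    have hp2 := (Finset.mem_Ioc.1 (Finset.mem_filter.1 hp).1).2
    have h3 := div_sum 0 p (Nat.zero_le _) hpp.one_lt.le
    have e : Finset.Ioc 0 p = Finset.Icc 1 p := rfl
    rw [e] at h3
    have hp1 : (1:ℝ) ≤ p := by exact_mod_cast hpp.one_lt.le
    have hpb : (p:ℝ) ≤ √b := le_trans (by exact_mod_cast hp2) Real.nat_sqrt_le_real_sqrt
    have hpb2 : (p:ℝ) ≤ b := hpb.trans (by rw [Real.sqrt_le_left (by linarith)]; nlinarith)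
    have h4 : Real.log p ≤ Real.log b := Real.log_le_log (by linarith) hpb2
    have h5 : √(p:ℝ) ≤ √b := Real.sqrt_le_sqrt hpb2
    have h6 : 0 ≤ Real.log p := Real.log_nonneg hp1
    rw [Nat.cast_mul]
    have h7 : ((p:ℝ) - (0:ℕ)) * (1 + Real.log p) ≤ √b * (1 + Real.log b) := by
      rw [Nat.cast_zero, sub_zero]
      gcongr
    push_cast at h3 h7 ⊢
    linarith
  have h8 : 0 ≤ 4 * (√(b:ℝ) * (1 + Real.log b) + √b) := by
    have := Real.log_nonneg hb1
    positivity
  have h9 : (((Finset.Ioc (Nat.sqrt a) (Nat.sqrt b)).filter Nat.Prime).card : ℝ) ≤ ((b:ℝ) - a) / √a + 1 := by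
    have h10 : ((Finset.Ioc (Nat.sqrt a) (Nat.sqrt b)).filter Nat.Prime).card ≤ Nat.sqrt b - Nat.sqrt a := by
      refine (Finset.card_filter_le _ _).trans (le_of_eq (Nat.card_Ioc _ _))
    have h11 : Nat.sqrt a ≤ Nat.sqrt b := Nat.sqrt_le_sqrt hab
    have h12 : (((Finset.Ioc (Nat.sqrt a) (Nat.sqrt b)).filter Nat.Prime).card : ℝ) ≤ (Nat.sqrt b : ℝ) - Nat.sqrt a := by
      rw [← Nat.cast_sub h11]; exact_mod_cast h10
    have h13 : (Nat.sqrt b : ℝ) ≤ √b := Real.nat_sqrt_le_real_sqrt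
    have h14 : √(a:ℝ) ≤ Nat.sqrt a + 1 := Real.real_sqrt_le_nat_sqrt_succ
    have h15 : √(b:ℝ) - √a ≤ ((b:ℝ) - a) / √a := by
      rw [le_div_iff₀ (by positivity)]
      have e1 := Real.mul_self_sqrt ha0.le
      have e2 := Real.mul_self_sqrt (ha0.le.trans hab')
      have e3 := Real.sqrt_le_sqrt hab'
      nlinarith [Real.sqrt_nonneg (a:ℝ), Real.sqrt_nonneg (b:ℝ)]
    linarith
  calc ((∑ n ∈ Wset a b, n.divisors.card : ℕ) : ℝ) ≤ ∑ p ∈ (Finset.Ioc (Nat.sqrt a) (Nat.sqrt b)).filter Nat.Prime, ((2 * ∑ m ∈ Finset.Icc 1 p, m.divisors.card : ℕ) : ℝ) := by exact_mod_cast h1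
    _ ≤ ∑ p ∈ (Finset.Ioc (Nat.sqrt a) (Nat.sqrt b)).filter Nat.Prime, (4 * (√(b:ℝ) * (1 + Real.log b) + √b)) := Finset.sum_le_sum h2
    _ = (((Finset.Ioc (Nat.sqrt a) (Nat.sqrt b)).filter Nat.Prime).card : ℝ) * (4 * (√(b:ℝ) * (1 + Real.log b) + √b)) := by rw [Finset.sum_const, nsmul_eq_mul]
    _ ≤ _ := mul_le_mul_of_nonneg_right h9 h8

lemma F_sum (k r a : ℕ) (hk : 1 ≤ k) (hr : k ≤ 2 * r + 1) (ha : 2^k ≤ a) (hb : a + 2^r ≤ 2^(k+1)) :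
    ((∑ n ∈ Fset a (a + 2^r), n.divisors.card : ℕ) : ℝ) ≤ 100 * (2:ℝ)^r * k := by
  set b := a + 2^r with hbdef
  set H : ℝ := (2:ℝ)^r with hH
  have hH1 : 1 ≤ H := one_le_pow₀ (by norm_num)
  have ha1 : 1 ≤ a := le_trans Nat.one_le_two_pow ha
  have hab : a ≤ b := Nat.le_add_right _ _
  have hba : (b:ℝ) - a = H := by rw [hbdef, hH]; push_cast; ring
  have haR : (2:ℝ)^k ≤ a := by exact_mod_cast ha
  have hbR : (b:ℝ) ≤ 2^(k+1) := by exact_mod_cast hb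
  have ha0 : (0:ℝ) < a := by exact_mod_cast ha1
  have hb1 : (1:ℝ) ≤ b := by exact_mod_cast ha1.trans hab
  have hk1 : (1:ℝ) ≤ k := by exact_mod_cast hk
  have hlog : Real.log b ≤ k + 1 := by
    have h1 := Real.log_le_log (by linarith) hbR
    rw [Real.log_pow] at h1
    push_cast at h1
    have : Real.log 2 ≤ 1 := by linarith [Real.log_two_lt_d9]
    nlinarith
  have hsb : √(b:ℝ) ≤ 2 * H := by
    rw [Real.sqrt_le_left (by positivity)]
    refine hbR.trans ?_
    calc (2:ℝ)^(k+1) ≤ 2^(2*r+2) := pow_le_pow_right₀ (by norm_num) (by omega)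
      _ = _ := by rw [hH, mul_pow, ← pow_mul]; ring
  have hrat : √(b:ℝ) ≤ 2 * √a := by
    rw [Real.sqrt_le_left (by positivity), mul_pow, Real.sq_sqrt ha0.le]
    rw [pow_succ] at hbR
    linarith
  have hsa : 0 < √(a:ℝ) := Real.sqrt_pos.2 ha0
  have h1 := div_sum a b hab (ha1.trans hab)
  have h2 := W_sum a b ha1 hab
  rw [hba] at h1 h2
  have h3 : ∑ n ∈ Fset a b, n.divisors.card ≤ ∑ n ∈ Finset.Ioc a b, n.divisors.card + ∑ n ∈ Wset a b, n.divisors.card := by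
    unfold Fset
    rw [← Finset.sum_union_inter]
    exact Nat.le_add_right _ _
  have h4 : ((∑ n ∈ Fset a b, n.divisors.card : ℕ) : ℝ) ≤ ((∑ n ∈ Finset.Ioc a b, n.divisors.card : ℕ) : ℝ) + ((∑ n ∈ Wset a b, n.divisors.card : ℕ) : ℝ) := by exact_mod_cast h3
  have h5 : 2 * (H * (1 + Real.log b) + √b) ≤ 10 * H * k := by nlinarith
  have h6 : (H / √a + 1) * (4 * (√(b:ℝ) * (1 + Real.log b) + √b)) ≤ 64 * H * k := by
    have e1 : (H / √a + 1) * √b ≤ 4 * H := by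
      have : H / √a * √b ≤ 2 * H := by
        rw [div_mul_eq_mul_div, div_le_iff₀ hsa]; nlinarith
      linarith
    calc _ = ((H / √a + 1) * √b) * (4 * (2 + Real.log b)) := by ring
      _ ≤ (4 * H) * (4 * (2 + Real.log b)) := by
          have := Real.log_nonneg hb1
          gcongr
      _ ≤ _ := by nlinarith
  nlinarith [mul_nonneg (le_trans zero_le_one hH1) (le_trans zero_le_one hk1)]

lemma F_card (k r a b : ℕ) (hr : 2 * r ≤ k) (ha : 2^k ≤ a) (hab : a ≤ b) (hb : b ≤ a + 2^r) :
    ((Fset a b).card : ℝ) ≤ 3 * √b := by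
  set s := Nat.sqrt a
  have hs1 : a < (s+1)*(s+1) := Nat.lt_succ_sqrt a
  have hs2 : s * s ≤ a := Nat.sqrt_le a
  have hs3 : 2^r ≤ s := by
    rw [Nat.le_sqrt]
    calc 2^r * 2^r = 2^(2*r) := by rw [← pow_add]; ring_nf
      _ ≤ 2^k := Nat.pow_le_pow_right (by norm_num) hr
      _ ≤ a := ha
  have hs4 : Nat.sqrt b ≤ s + 1 := by
    have : Nat.sqrt b < s + 2 := by rw [Nat.sqrt_lt]; nlinarith
    omega
  have h1s : 1 ≤ s := le_trans Nat.one_le_two_pow hs3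
  have hc1 : (Finset.Ioc a b).card ≤ s := by rw [Nat.card_Ioc]; omega
  have hc2 : (Wset a b).card ≤ s + 1 := by
    unfold Wset
    refine Finset.card_biUnion_le.trans ?_
    have hsub : (Finset.Ioc (Nat.sqrt a) (Nat.sqrt b)).filter Nat.Prime ⊆ {s + 1} := by
      intro p hp
      have := Finset.mem_Ioc.1 (Finset.mem_filter.1 hp).1
      rw [Finset.mem_singleton]
      have h7 : s < p := this.1
      omega
    refine (Finset.sum_le_sum_of_subset hsub).trans ?_
    rw [Finset.sum_singleton]
    refine Finset.card_image_le.trans ?_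
    simp
  have hc : (Fset a b).card ≤ 3 * s := by
    unfold Fset
    refine (Finset.card_union_le _ _).trans ?_
    omega
  have h5 : (s:ℝ) ≤ √b := le_trans Real.nat_sqrt_le_real_sqrt (Real.sqrt_le_sqrt (by exact_mod_cast hab))
  have h6 : ((Fset a b).card : ℝ) ≤ 3 * s := by exact_mod_cast hc
  linarith
end divsum

section assembly
variable {Ω : Type*} [MeasurableSpace Ω] {μ : Measure Ω} [IsProbabilityMeasure μ] {f : Ω → ℕ → ℂ}

def sk (k : ℕ) : ℕ := 10 * (Nat.log 2 k + 1)

lemma sk_low (k : ℕ) : k^10 ≤ 2^(sk k) := by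
  unfold sk
  have h := (Nat.lt_pow_succ_log_self (b := 2) (by norm_num) k).le
  calc k^10 ≤ (2^(Nat.log 2 k + 1))^10 := Nat.pow_le_pow_left h 10
    _ = _ := by rw [← pow_mul, mul_comm]

lemma sk_up (k : ℕ) (hk : 1 ≤ k) : 2^(sk k) ≤ 1024 * k^10 := by
  unfold sk
  have h := Nat.pow_log_le_self 2 (x := k) (by omega)
  calc 2^(10 * (Nat.log 2 k + 1)) = 1024 * (2^(Nat.log 2 k))^10 := by rw [mul_add, pow_add, mul_comm 10, pow_mul]; ring
    _ ≤ _ := Nat.mul_le_mul_left _ (Nat.pow_le_pow_left h 10)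

def Eev (f : Ω → ℕ → ℂ) (k r j : ℕ) : Set Ω :=
  {ω | √((2:ℝ)^k) / k < ‖Mq (f ω) ((j+1) * 2^r) - Mq (f ω) (j * 2^r)‖}

lemma Eev_bound (hf : SRMF μ f) (k r j : ℕ) (hk : 1 ≤ k) (hr : k ≤ 2 * r + 1) (hr2 : r ≤ k)
    (hj : 2^(k-r) ≤ j) (hj2 : j + 1 ≤ 2^(k-r+1)) :
    μ (Eev f k r j) ≤ ENNReal.ofReal ((100 * (2:ℝ)^r * k)^2 * (k:ℝ)^4 / ((2:ℝ)^k)^2) := by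
  have hk0 : (0:ℝ) < k := by exact_mod_cast hk
  have ha : 2^k ≤ j * 2^r := by
    calc 2^k = 2^(k-r) * 2^r := by rw [← pow_add]; congr 1; omega
      _ ≤ _ := Nat.mul_le_mul_right _ hj
  have hb : j * 2^r + 2^r ≤ 2^(k+1) := by
    calc j * 2^r + 2^r = (j+1) * 2^r := by ring
      _ ≤ 2^(k-r+1) * 2^r := Nat.mul_le_mul_right _ hj2
      _ = 2^(k+1) := by rw [← pow_add]; congr 1; omega
  have ha1 : 1 ≤ j * 2^r := le_trans Nat.one_le_two_pow ha
  have hS := F_sum k r (j * 2^r) hk hr ha hb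
  have hs : 0 < √((2:ℝ)^k) / k := by positivity
  have hm := markov4 hf (Fset (j * 2^r) (j * 2^r + 2^r)) (fun n hn => Fset_pos hn) (cco (j * 2^r) (j * 2^r + 2^r)) (fun n => cco_norm _ _ n) _ _ hs hS
  have e : Eev f k r j = {ω | √((2:ℝ)^k) / k < ‖∑ n ∈ Fset (j * 2^r) (j * 2^r + 2^r), cco (j * 2^r) (j * 2^r + 2^r) n * f ω n‖} := by
    unfold Eev
    ext ω
    rw [Set.mem_setOf_eq, Set.mem_setOf_eq, add_one_mul, incr_eq (f ω) _ _ ha1 (Nat.le_add_right _ _)]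
  rw [e]
  refine hm.trans (le_of_eq ?_)
  congr 1
  have h4 : (√((2:ℝ)^k) / k)^4 = ((2:ℝ)^k)^2 / (k:ℝ)^4 := by
    rw [div_pow]
    congr 1
    calc √((2:ℝ)^k)^4 = (√((2:ℝ)^k)^2)^2 := by ring
      _ = _ := by rw [Real.sq_sqrt (by positivity)]
  rw [h4, div_div_eq_mul_div]

def Ek (f : Ω → ℕ → ℂ) (k : ℕ) : Set Ω :=
  ⋃ r ∈ Finset.Ico (k/2) (k - sk k), ⋃ j ∈ Finset.Ico (2^(k-r)) (2^(k-r+1)), Eev f k r j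

lemma Ek_bound (hf : SRMF μ f) (k : ℕ) (hk : 1 ≤ k) : μ (Ek f k) ≤ ENNReal.ofReal (10000 * (1 / (k:ℝ)^2)) := by
  have hk0 : (0:ℝ) < k := by exact_mod_cast hk
  have hk1 : (1:ℝ) ≤ k := by exact_mod_cast hk
  unfold Ek
  have hin : ∀ r ∈ Finset.Ico (k/2) (k - sk k), μ (⋃ j ∈ Finset.Ico (2^(k-r)) (2^(k-r+1)), Eev f k r j) ≤ ENNReal.ofReal (10000 * (1 / (k:ℝ)^3)) := by
    intro r hr
    rw [Finset.mem_Ico] at hr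
    refine (measure_biUnion_finset_le _ _).trans ?_
    calc _ ≤ ∑ j ∈ Finset.Ico (2^(k-r)) (2^(k-r+1)), ENNReal.ofReal ((100 * (2:ℝ)^r * k)^2 * (k:ℝ)^4 / ((2:ℝ)^k)^2) := by
          refine Finset.sum_le_sum fun j hj => ?_
          rw [Finset.mem_Ico] at hj
          exact Eev_bound hf k r j hk (by omega) (by omega) hj.1 hj.2
      _ = ENNReal.ofReal ((2:ℝ)^(k-r) * ((100 * (2:ℝ)^r * k)^2 * (k:ℝ)^4 / ((2:ℝ)^k)^2)) := by
          rw [Finset.sum_const, Nat.card_Ico, nsmul_eq_mul, ENNReal.ofReal_mul (p := (2:ℝ)^(k-r)) (by positivity)]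
          congr 1
          have : 2^(k-r+1) - 2^(k-r) = 2^(k-r) := by rw [pow_succ]; omega
          rw [this, ENNReal.ofReal_pow (by norm_num)]
          push_cast
          simp
      _ ≤ _ := by
          refine ENNReal.ofReal_le_ofReal ?_
          have e1 : (2:ℝ)^k = 2^(k-r) * 2^r := by rw [← pow_add]; congr 1; omega
          have e2 : (2:ℝ)^(k-r) * ((100 * (2:ℝ)^r * k)^2 * (k:ℝ)^4 / ((2:ℝ)^k)^2) = 10000 * ((k:ℝ)^6 / 2^(k-r)) := by
            rw [e1]; field_simp; ring
          rw [e2]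
          have h1 : (k:ℝ)^10 ≤ 2^(k-r) := by
            calc (k:ℝ)^10 ≤ 2^(sk k) := by exact_mod_cast sk_low k
              _ ≤ _ := pow_le_pow_right₀ (by norm_num) (by omega)
          refine mul_le_mul_of_nonneg_left ?_ (by norm_num)
          rw [div_le_div_iff₀ (by positivity) (by positivity), one_mul]
          calc (k:ℝ)^6 * (k:ℝ)^3 = (k:ℝ)^9 := by ring
            _ ≤ (k:ℝ)^10 := pow_le_pow_right₀ hk1 (by norm_num)
            _ ≤ _ := h1
  refine (measure_biUnion_finset_le _ _).trans ((Finset.sum_le_sum hin).trans ?_)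
  rw [Finset.sum_const, Nat.card_Ico, nsmul_eq_mul]
  have h2 : ((k - sk k - k/2 : ℕ) : ENNReal) ≤ ENNReal.ofReal (k:ℝ) := by
    rw [ENNReal.ofReal_natCast]
    exact_mod_cast (by omega : k - sk k - k/2 ≤ k)
  refine (mul_le_mul_left h2 _).trans ?_
  rw [← ENNReal.ofReal_mul (p := (k:ℝ)) hk0.le]
  refine ENNReal.ofReal_le_ofReal (le_of_eq ?_)
  field_simp

lemma summ_sq (C : ℝ) : Summable (fun k : ℕ => C * (1 / (k:ℝ)^2)) :=
  (Real.summable_one_div_nat_pow.2 (by norm_num)).mul_left C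

lemma Ek_as (hf : SRMF μ f) : ∀ᵐ ω ∂μ, ∀ᶠ k in atTop, ω ∉ Ek f k :=
  BC (Ek f) _ (summ_sq 10000) 1 (fun k hk => Ek_bound hf k hk)

def Tr (r X : ℕ) : ℕ := X / 2^r * 2^r

lemma Tr_le (r X : ℕ) : Tr r X ≤ X := Nat.div_mul_le_self _ _
lemma Tr_lt (r X : ℕ) : X ≤ Tr r X + 2^r := by
  unfold Tr
  have := Nat.div_add_mod X (2^r)
  have := Nat.mod_lt X (Nat.two_pow_pos r)
  rw [mul_comm]; omega

lemma Tr_low (k r X : ℕ) (hr : r ≤ k) (hX : 2^k ≤ X) : 2^(k-r) ≤ X / 2^r := by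
  rw [Nat.le_div_iff_mul_le (Nat.two_pow_pos r), ← pow_add]
  rwa [show k - r + r = k by omega]

lemma Tr_up (k r X : ℕ) (hr : r ≤ k) (hX : X < 2^(k+1)) : X / 2^r < 2^(k-r+1) := by
  rw [Nat.div_lt_iff_lt_mul (Nat.two_pow_pos r), ← pow_add]
  rwa [show k - r + 1 + r = k + 1 by omega]

lemma step_bd (a : ℕ → ℂ) (B : ℝ) (hB : 0 ≤ B) (k r X : ℕ) (hr : r + 1 ≤ k) (hX : 2^k ≤ X) (hX2 : X < 2^(k+1))
    (h : ∀ j ∈ Finset.Ico (2^(k-r)) (2^(k-r+1)), ‖Mq a ((j+1) * 2^r) - Mq a (j * 2^r)‖ ≤ B) :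
    ‖Mq a (Tr r X) - Mq a (Tr (r+1) X)‖ ≤ B := by
  unfold Tr
  have e1 : X / 2^(r+1) = X / 2^r / 2 := by rw [Nat.div_div_eq_div_mul, pow_succ]
  have hl := Tr_low k (r+1) X hr hX
  have hu := Tr_up k r X (by omega) hX2
  rw [e1] at hl ⊢
  have e2 : 2^(k-r) = 2^(k-(r+1)) * 2 := by rw [← pow_succ]; congr 1; omega
  have e3 : X / 2^r / 2 * 2^(r+1) = (X / 2^r / 2 * 2) * 2^r := by rw [pow_succ]; ring
  rw [e3]
  set m := X / 2^r with hm
  rcases Nat.even_or_odd m with he | ho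
  · have : m / 2 * 2 = m := by obtain ⟨c, hc⟩ := he; omega
    rw [this, sub_self, norm_zero]; exact hB
  · have h1 : m = m / 2 * 2 + 1 := by obtain ⟨c, hc⟩ := ho; omega
    have h2 := h (m / 2 * 2) (Finset.mem_Ico.2 ⟨by omega, by omega⟩)
    rwa [← h1] at h2

lemma chain_bd (a : ℕ → ℂ) (B : ℝ) (hB : 0 ≤ B) (k r1 X : ℕ) (hX : 2^k ≤ X) (hX2 : X < 2^(k+1)) (d : ℕ) (hd : r1 + d ≤ k)
    (h : ∀ r ∈ Finset.Ico r1 (r1 + d), ∀ j ∈ Finset.Ico (2^(k-r)) (2^(k-r+1)), ‖Mq a ((j+1) * 2^r) - Mq a (j * 2^r)‖ ≤ B) :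
    ‖Mq a (Tr r1 X) - Mq a (Tr (r1 + d) X)‖ ≤ d * B := by
  induction d with
  | zero => simp
  | succ d ih =>
    have h1 := ih (by omega) (fun r hr => h r (Finset.mem_Ico.2 ⟨(Finset.mem_Ico.1 hr).1, by have := (Finset.mem_Ico.1 hr).2; omega⟩))
    have h2 := step_bd a B hB k (r1 + d) X (by omega) hX hX2 (h (r1 + d) (Finset.mem_Ico.2 ⟨by omega, by omega⟩))
    have h3 := norm_sub_le_norm_sub_add_norm_sub (Mq a (Tr r1 X)) (Mq a (Tr (r1 + d) X)) (Mq a (Tr (r1 + d + 1) X))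
    push_cast
    rw [← add_assoc]
    linarith

def r0k (k : ℕ) : ℕ := max (k/2) (k - sk k)

lemma r0k_le (k : ℕ) : r0k k ≤ k := by unfold r0k; omega

/-- Deterministic reduction to the sparse test points. -/
lemma red_test (hf : SRMF μ f) (ω : Ω) (k X : ℕ) (hk : 1 ≤ k) (hX : 2^k ≤ X) (hX2 : X < 2^(k+1)) (hE : ω ∉ Ek f k) :
    ‖Mq (f ω) X - Mq (f ω) (Tr (r0k k) X)‖ ≤ 4 * √X := by
  have hk0 : (0:ℝ) < k := by exact_mod_cast hk
  have hB : 0 ≤ √((2:ℝ)^k) / k := by positivity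
  have h1 : ‖Mq (f ω) X - Mq (f ω) (Tr (k/2) X)‖ ≤ 3 * √X := by
    have ha : 2^k ≤ Tr (k/2) X := by
      unfold Tr
      calc 2^k = 2^(k-k/2) * 2^(k/2) := by rw [← pow_add]; congr 1; omega
        _ ≤ _ := Nat.mul_le_mul_right _ (Tr_low k _ X (by omega) hX)
    have ha1 : 1 ≤ Tr (k/2) X := le_trans Nat.one_le_two_pow ha
    rw [incr_eq (f ω) _ _ ha1 (Tr_le _ _)]
    refine le_trans (norm_sum_le _ _) (le_trans ?_ (F_card k (k/2) (Tr (k/2) X) X (by omega) ha (Tr_le _ _) (Tr_lt _ _)))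
    rw [← nsmul_one, ← Finset.sum_const]
    refine Finset.sum_le_sum fun n hn => ?_
    rw [norm_mul, hf.norm_one ω n (Fset_pos hn), mul_one]
    exact cco_norm _ _ n
  have h2 : ‖Mq (f ω) (Tr (k/2) X) - Mq (f ω) (Tr (r0k k) X)‖ ≤ √X := by
    have hle : k/2 ≤ r0k k := le_max_left _ _
    obtain ⟨d, hd⟩ := Nat.exists_eq_add_of_le hle
    rw [hd]
    refine (chain_bd (f ω) _ hB k (k/2) X hX hX2 d (by have := r0k_le k; omega) ?_).trans ?_
    · intro r hr j hj
      by_contra hc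
      push Not at hc
      refine hE ?_
      unfold Ek
      rw [Finset.mem_Ico] at hr
      have hr' : r ∈ Finset.Ico (k/2) (k - sk k) := by
        rw [Finset.mem_Ico]
        unfold r0k at hd
        omega
      exact Set.mem_biUnion hr' (Set.mem_biUnion hj hc)
    · have hdk : (d:ℝ) ≤ k := by exact_mod_cast (by have := r0k_le k; omega : d ≤ k)
      calc (d:ℝ) * (√((2:ℝ)^k) / k) ≤ k * (√((2:ℝ)^k) / k) := mul_le_mul_of_nonneg_right hdk hB
        _ = √((2:ℝ)^k) := by field_simp
        _ ≤ √X := Real.sqrt_le_sqrt (by exact_mod_cast hX)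
  have h3 := norm_sub_le_norm_sub_add_norm_sub (Mq (f ω) X) (Mq (f ω) (Tr (k/2) X)) (Mq (f ω) (Tr (r0k k) X))
  linarith
end assembly

section final
variable {Ω : Type*} [MeasurableSpace Ω] {μ : Measure Ω} [IsProbabilityMeasure μ] {f : Ω → ℕ → ℂ}

def Lg (x : ℝ) : ℝ := Real.log (Real.log x)

def Gev (f : Ω → ℕ → ℂ) (ε : ℝ) (k j : ℕ) : Set Ω :=
  {ω | √((j * 2^(r0k k) : ℕ) : ℝ) * Lg ((j * 2^(r0k k) : ℕ) : ℝ) ^ (1/4 + ε/2) < ‖Mx (f ω) ((j * 2^(r0k k) : ℕ) : ℝ)‖ ∧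
    Vx (f ω) ((j * 2^(r0k k) : ℕ) : ℝ) ≤ ((j * 2^(r0k k) : ℕ) : ℝ) * Lg ((j * 2^(r0k k) : ℕ) : ℝ) ^ (-(1/2) + ε/2)}

def Gk (f : Ω → ℕ → ℂ) (ε : ℝ) (k : ℕ) : Set Ω :=
  ⋃ j ∈ Finset.Ico (2^(k-r0k k)) (2^(k-r0k k+1)), Gev f ε k j

lemma Lg_low (k : ℕ) (hk : 4 ≤ k) (y : ℝ) (hy : (2:ℝ)^k ≤ y) : Real.log k / 2 ≤ Lg y := by
  have hk4 : (4:ℝ) ≤ k := by exact_mod_cast hk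
  unfold Lg
  have h1 : (k:ℝ) * Real.log 2 ≤ Real.log y := by
    rw [← Real.log_pow]
    exact Real.log_le_log (by positivity) hy
  have h2 : √(k:ℝ) ≤ k * Real.log 2 := by
    have h3 : (1:ℝ)/2 ≤ Real.log 2 := by linarith [Real.log_two_gt_d9]
    have h4 : √(k:ℝ) ≤ k * (1/2) := by
      rw [Real.sqrt_le_left (by positivity)]; nlinarith
    nlinarith
  rw [← Real.log_sqrt (by positivity)]
  exact Real.log_le_log (by positivity) (h2.trans h1)

lemma tend_logk : Tendsto (fun k : ℕ => Real.log k / 2) atTop atTop :=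
  (Real.tendsto_log_atTop.comp tendsto_natCast_atTop_atTop).atTop_div_const (by norm_num)

lemma Gk_bound (hf : SRMF μ f) (ε : ℝ) (hε : 0 < ε) : ∃ K : ℕ, ∀ k ≥ K, μ (Gk f ε k) ≤ ENNReal.ofReal (4096 * (1 / (k:ℝ)^2)) := by
  have ht : Tendsto (fun k : ℕ => (Real.log k / 2) ^ (ε/2)) atTop atTop := (tendsto_rpow_atTop (by positivity)).comp tend_logk
  obtain ⟨K, hK⟩ := eventually_atTop.1 (ht.eventually_ge_atTop 192)
  refine ⟨max K 4, fun k hk => ?_⟩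
  have hk4 : 4 ≤ k := le_trans (le_max_right _ _) hk
  have h192 := hK k (le_trans (le_max_left _ _) hk)
  have hk4R : (4:ℝ) ≤ k := by exact_mod_cast hk4
  have hk0 : (0:ℝ) < k := by linarith
  have hlk : 0 < Real.log k := Real.log_pos (by linarith)
  have hin : ∀ j ∈ Finset.Ico (2^(k-r0k k)) (2^(k-r0k k+1)), μ (Gev f ε k j) ≤ ENNReal.ofReal (4 * ((k:ℝ)^12)⁻¹) := by
    intro j hj
    rw [Finset.mem_Ico] at hj
    unfold Gev
    have hyN : 2^k ≤ j * 2^(r0k k) := by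
      calc 2^k = 2^(k-r0k k) * 2^(r0k k) := by rw [← pow_add]; congr 1; have := r0k_le k; omega
        _ ≤ _ := Nat.mul_le_mul_right _ hj.1
    have hy : (2:ℝ)^k ≤ ((j * 2^(r0k k) : ℕ) : ℝ) := by exact_mod_cast hyN
    generalize ((j * 2^(r0k k) : ℕ) : ℝ) = y at hy ⊢
    have hy0 : 0 < y := lt_of_lt_of_le (by positivity) hy
    have hL := Lg_low k hk4 y hy
    have hL0 : 0 < Lg y := by linarith
    refine (tail_M hf y hy0 (√y * Lg y ^ (1/4 + ε/2)) (y * Lg y ^ (-(1/2) + ε/2)) (by positivity) (by positivity)).trans ?_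
    refine ENNReal.ofReal_le_ofReal ?_
    refine mul_le_mul_of_nonneg_left ?_ (by norm_num)
    have e1 : (√y * Lg y ^ (1/4 + ε/2))^2 / (8 * (y * Lg y ^ (-(1/2) + ε/2))) = Lg y * Lg y ^ (ε/2) / 8 := by
      have a1 : (Lg y ^ (1/4 + ε/2))^2 = Lg y * Lg y ^ (ε/2) * Lg y ^ (-(1/2) + ε/2) := by
        rw [← Real.rpow_natCast, ← Real.rpow_mul hL0.le]
        conv_rhs => rw [← Real.rpow_one (Lg y), Real.rpow_one (Lg y)]
        rw [← Real.rpow_one_add' hL0.le (by positivity), ← Real.rpow_add hL0]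
        congr 1
        push_cast
        ring
      rw [mul_pow, Real.sq_sqrt hy0.le, a1]
      have : 0 < Lg y ^ (-(1/2) + ε/2) := by positivity
      field_simp
    rw [e1]
    have h2 : (192:ℝ) ≤ Lg y ^ (ε/2) := h192.trans (Real.rpow_le_rpow (by positivity) hL (by positivity))
    have h3 : 12 * Real.log k ≤ Lg y * Lg y ^ (ε/2) / 8 := by nlinarith
    calc Real.exp (-(Lg y * Lg y ^ (ε/2) / 8)) ≤ Real.exp (-(12 * Real.log k)) := Real.exp_le_exp.2 (by linarith)
      _ = ((k:ℝ)^12)⁻¹ := by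
        rw [Real.exp_neg]
        congr 1
        rw [show (12:ℝ) * Real.log k = Real.log ((k:ℝ)^12) by rw [Real.log_pow]; norm_num, Real.exp_log (by positivity)]
  unfold Gk
  refine (measure_biUnion_finset_le _ _).trans ((Finset.sum_le_sum hin).trans ?_)
  rw [Finset.sum_const, Nat.card_Ico, nsmul_eq_mul]
  have h2 : ((2^(k-r0k k+1) - 2^(k-r0k k) : ℕ) : ENNReal) ≤ ENNReal.ofReal (1024 * (k:ℝ)^10) := by
    have h3 : 2^(k-r0k k+1) - 2^(k-r0k k) ≤ 1024 * k^10 := by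
      have h4 : 2^(k-r0k k+1) - 2^(k-r0k k) = 2^(k-r0k k) := by rw [pow_succ]; omega
      rw [h4]
      refine le_trans (Nat.pow_le_pow_right (by norm_num) ?_) (sk_up k (by omega))
      unfold r0k
      omega
    have h5 : (1024 * (k:ℝ)^10) = ((1024 * k^10 : ℕ) : ℝ) := by push_cast; ring
    rw [h5, ENNReal.ofReal_natCast]
    exact Nat.cast_le.2 h3
  refine (mul_le_mul_left h2 _).trans ?_
  rw [← ENNReal.ofReal_mul (p := 1024 * (k:ℝ)^10) (by positivity)]
  refine ENNReal.ofReal_le_ofReal (le_of_eq ?_)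
  field_simp
  ring

lemma Gk_as (hf : SRMF μ f) (ε : ℝ) (hε : 0 < ε) : ∀ᵐ ω ∂μ, ∀ᶠ k in atTop, ω ∉ Gk f ε k := by
  obtain ⟨K, hK⟩ := Gk_bound hf ε hε
  exact BC (Gk f ε) _ (summ_sq 4096) K hK

lemma main_SRMF (hf : SRMF μ f) (ε : ℝ) (hε : 0 < ε) (hε1 : ε < 1/4) :
    ∀ᵐ ω ∂μ, ∀ᶠ x : ℝ in atTop, ‖Mq (f ω) ⌊x⌋₊‖ ≤ √x * Real.log (Real.log x) ^ ((1:ℝ)/4 + ε) := by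
  filter_upwards [Ek_as hf, Gk_as hf ε hε, V_bound hf (ε/2) (by positivity) (by linarith)] with ω hE hG hV
  obtain ⟨x0, hV⟩ := hV
  obtain ⟨K1, hE⟩ := eventually_atTop.1 hE
  obtain ⟨K2, hG⟩ := eventually_atTop.1 hG
  obtain ⟨K3, hK3⟩ : ∃ K3 : ℕ, x0 ≤ (2:ℝ)^K3 := by
    obtain ⟨n, hn⟩ := pow_unbounded_of_one_lt x0 (one_lt_two (α := ℝ))
    exact ⟨n, hn.le⟩
  set K := max (max K1 K2) (max K3 4) with hK
  have hbig : ∀ᶠ x : ℝ in atTop, 5 ≤ Lg x ^ (ε/2) :=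
    ((tendsto_rpow_atTop (by positivity)).comp tend_ll).eventually_ge_atTop 5
  have hbig2 : ∀ᶠ x : ℝ in atTop, 1 ≤ Lg x := tend_ll.eventually_ge_atTop 1
  filter_upwards [hbig, hbig2, eventually_ge_atTop ((2:ℝ)^K)] with x h5 h1 hx
  have hx0 : 0 < x := lt_of_lt_of_le (by positivity) hx
  have hXK : 2^K ≤ ⌊x⌋₊ := Nat.le_floor (by exact_mod_cast hx)
  set X := ⌊x⌋₊ with hXdef
  have hXx : (X:ℝ) ≤ x := Nat.floor_le hx0.le
  have hXne : X ≠ 0 := by have := Nat.one_le_two_pow (n := K); omega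
  set k := Nat.log 2 X with hkdef
  have hKk : K ≤ k := Nat.le_log_of_pow_le (by norm_num) hXK
  have hX1 : 2^k ≤ X := Nat.pow_log_le_self 2 hXne
  have hX2 : X < 2^(k+1) := Nat.lt_pow_succ_log_self (by norm_num) X
  have hk1 : K1 ≤ k := by omega
  have hk2 : K2 ≤ k := by omega
  have hk3 : K3 ≤ k := by omega
  have hk4 : 4 ≤ k := by omega
  have hred := red_test hf ω k X (by omega) hX1 hX2 (hE k hk1)
  have hj : X / 2^(r0k k) ∈ Finset.Ico (2^(k-r0k k)) (2^(k-r0k k+1)) :=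
    Finset.mem_Ico.2 ⟨Tr_low k _ X (r0k_le k) hX1, Tr_up k _ X (r0k_le k) hX2⟩
  have hG' : ω ∉ Gev f ε k (X / 2^(r0k k)) := by
    intro h
    refine hG k hk2 ?_
    unfold Gk
    exact Set.mem_biUnion hj h
  have hTX : Tr (r0k k) X ≤ X := Tr_le _ _
  have hTk : 2^k ≤ Tr (r0k k) X := by
    unfold Tr
    calc 2^k = 2^(k-r0k k) * 2^(r0k k) := by rw [← pow_add]; congr 1; have := r0k_le k; omega
      _ ≤ _ := Nat.mul_le_mul_right _ (Finset.mem_Ico.1 hj).1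
  have hTX' : ((Tr (r0k k) X : ℕ) : ℝ) ≤ x := le_trans (by exact_mod_cast hTX) hXx
  have hTk' : (2:ℝ)^k ≤ ((Tr (r0k k) X : ℕ) : ℝ) := by exact_mod_cast hTk
  unfold Gev at hG'
  rw [Set.mem_setOf_eq] at hG'
  change ¬ (√((Tr (r0k k) X : ℕ) : ℝ) * Lg ((Tr (r0k k) X : ℕ) : ℝ) ^ (1/4 + ε/2) < ‖Mx (f ω) ((Tr (r0k k) X : ℕ) : ℝ)‖ ∧
    Vx (f ω) ((Tr (r0k k) X : ℕ) : ℝ) ≤ ((Tr (r0k k) X : ℕ) : ℝ) * Lg ((Tr (r0k k) X : ℕ) : ℝ) ^ (-(1/2) + ε/2)) at hG'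
  rw [← Mq_eq (cmu_f hf ω) _ (le_trans Nat.one_le_two_pow hTk)] at hG'
  generalize Tr (r0k k) X = Y at hG' hred hTX' hTk'
  have hYx0 : x0 ≤ (Y:ℝ) := hK3.trans (le_trans (pow_le_pow_right₀ (by norm_num) hk3) hTk')
  have hVY := hV Y hYx0
  have hM : ‖Mq (f ω) Y‖ ≤ √Y * Lg Y ^ (1/4 + ε/2) := by
    by_contra hc
    push Not at hc
    exact hG' ⟨hc, hVY⟩
  have hY1 : (1:ℝ) < Y := lt_of_lt_of_le (one_lt_pow₀ (by norm_num) (by omega)) hTk'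
  have hLY0 : 0 ≤ Lg Y := by
    have := Lg_low k hk4 Y hTk'
    have : 0 ≤ Real.log k := Real.log_natCast_nonneg k
    linarith
  have hLL : Lg Y ≤ Lg x := by
    unfold Lg
    exact Real.log_le_log (Real.log_pos hY1) (Real.log_le_log (by linarith) hTX')
  have hM2 : ‖Mq (f ω) Y‖ ≤ √x * Lg x ^ (1/4 + ε/2) := by
    refine hM.trans ?_
    have := Real.sqrt_le_sqrt hTX'
    have := Real.rpow_le_rpow hLY0 hLL (by positivity : 0 ≤ 1/4 + ε/2)
    gcongr
  have hXs : √(X:ℝ) ≤ √x := Real.sqrt_le_sqrt hXx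
  have h6 : ‖Mq (f ω) X‖ ≤ ‖Mq (f ω) X - Mq (f ω) Y‖ + ‖Mq (f ω) Y‖ := by
    have := norm_add_le (Mq (f ω) X - Mq (f ω) Y) (Mq (f ω) Y)
    rwa [sub_add_cancel] at this
  have h7 : ‖Mq (f ω) X‖ ≤ √x * (Lg x ^ (1/4 + ε/2) + 4) := by linarith
  refine h7.trans (mul_le_mul_of_nonneg_left ?_ (Real.sqrt_nonneg _))
  change _ ≤ Lg x ^ ((1:ℝ)/4 + ε)
  have e : Lg x ^ ((1:ℝ)/4 + ε) = Lg x ^ ((1:ℝ)/4 + ε/2) * Lg x ^ (ε/2) := by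
    rw [← Real.rpow_add (by linarith)]; congr 1; ring
  rw [e]
  have h8 : 1 ≤ Lg x ^ ((1:ℝ)/4 + ε/2) := Real.one_le_rpow h1 (by positivity)
  nlinarith
end final

theorem almost_sure_upper_bound_steinhaus
    {Ω : Type*} [MeasurableSpace Ω] (μ : Measure Ω) [IsProbabilityMeasure μ]
    (f : Ω → ℕ → ℂ) (hf : IsSteinhausRMF μ f) :
    ∃ ε₀ : ℝ, 0 < ε₀ ∧ ∀ ε : ℝ, 0 < ε → ε < ε₀ →
      ∀ᵐ ω ∂μ, ∀ᶠ x : ℝ in atTop,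
        ‖∑ n ∈ (Finset.Icc 1 ⌊x⌋₊).filter (fun n => Real.sqrt x < (Pfac n : ℝ)), f ω n‖ ≤
          Real.sqrt x * Real.log (Real.log x) ^ ((1 : ℝ) / 4 + ε) := by
  obtain ⟨g, hg, hgf⟩ := exists_SRMF hf
  refine ⟨1/4, by norm_num, fun ε hε hε1 => ?_⟩
  filter_upwards [hgf, main_SRMF hg ε hε hε1] with ω hω h
  filter_upwards [h, eventually_ge_atTop (0:ℝ)] with x hx hx0
  rw [thm_sum _ _ hx0, ← hω]
  exact hx
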